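/- Let T be large and let A be a parameter with T^{−1/2} ≪ A ≪ T^{3/2}. Then ∑_{(1/A)(T/(2π))^{3/2} ≤ k ≤ (1/A)(T/π)^{3/2}} d(k) k^{−1/6} e^{3πi(Ak)^{2/3}} = √3 · A^{−4/3} ∑_{A(T/(2π))^{1/2} ≤ k ≤ A(T/π)^{1/2}} d(k) k^{1/2} e^{−πi(k/A)²} + O(A^{−5/6} T^{3/4+ε}) + O(A^{1/6} T^{1/4+ε}) + O(A^{−1/3} T^{1/3+ε}), and in particular the left-hand side is ≪ A^{1/6} T^{3/4} log T. -/

import Mathlib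

open Complex Filter Real MeasureTheory Finset

noncomputable def chi (s : ℂ) : ℂ :=
  2 ^ s * (π : ℂ) ^ (s - 1) * Complex.sin (π * s / 2) * Complex.Gamma (1 - s)

noncomputable def Z (t : ℝ) : ℂ :=
  chi (1 / 2 + I * t) ^ (-(1 / 2 : ℂ)) * riemannZeta (1 / 2 + I * t)

/-- number of positive divisors -/
noncomputable def d (k : ℕ) : ℕ := k.divisors.card

/-- number of ordered triples of positive integers with product `n` -/
noncomputable def d3 (n : ℕ) : ℕ :=
  ((Finset.Icc 1 n ×ˢ Finset.Icc 1 n ×ˢ Finset.Icc 1 n).filter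
    fun p : ℕ × ℕ × ℕ => p.1 * p.2.1 * p.2.2 = n).card

/-- sum over integers `a ≤ k ≤ b` where terms at integer endpoints are halved -/
noncomputable def psum (a b : ℝ) (f : ℕ → ℂ) : ℂ :=
  ∑ k ∈ Finset.Icc ⌈a⌉₊ ⌊b⌋₊,
    (if (k : ℝ) = a ∨ (k : ℝ) = b then (1 / 2 : ℂ) else 1) * f k

/-- The additive character `x ↦ exp (2πix)`. -/
noncomputable def unitExp (x : ℝ) : ℂ := Complex.exp (((2 * Real.pi * x : ℝ) : ℂ) * I)

lemma norm_unitExp (x : ℝ) : ‖unitExp x‖ = 1 := Complex.norm_exp_ofReal_mul_I _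

lemma unitExp_add (x y : ℝ) : unitExp (x + y) = unitExp x * unitExp y := by
  unfold unitExp
  rw [← Complex.exp_add]
  congr 1
  push_cast
  ring

lemma unitExp_zero : unitExp 0 = 1 := by simp [unitExp]

lemma unitExp_int (n : ℤ) : unitExp n = 1 := by
  unfold unitExp
  rw [← Complex.exp_int_mul_two_pi_mul_I n]
  congr 1
  push_cast
  ring

lemma unitExp_conj (x : ℝ) : (starRingEnd ℂ) (unitExp x) = unitExp (-x) := by
  unfold unitExp
  rw [← Complex.exp_conj, map_mul, Complex.conj_ofReal, Complex.conj_I]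
  congr 1
  push_cast
  ring

lemma continuous_unitExp : Continuous unitExp := by
  unfold unitExp
  fun_prop

lemma hasDerivAt_unitExp {f : ℝ → ℝ} {f' x : ℝ} (hf : HasDerivAt f f' x) :
    HasDerivAt (fun x => unitExp (f x)) (2 * Real.pi * I * f' * unitExp (f x)) x := by
  unfold unitExp
  have h1 : HasDerivAt (fun x => ((2 * Real.pi * f x : ℝ) : ℂ) * I)
      (((2 * Real.pi * f' : ℝ) : ℂ) * I) x :=
    ((hf.const_mul (2 * Real.pi)).ofReal_comp).mul_const I
  convert h1.cexp using 1
  push_cast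
  ring

lemma two_pi_I_ne : (2 * Real.pi * I : ℂ) ≠ 0 := Complex.two_pi_I_ne_zero

lemma norm_two_pi_I : ‖(2 * Real.pi * I : ℂ)‖ = 2 * Real.pi := by
  simp [abs_of_pos Real.pi_pos]

/-- Integration by parts against an oscillating factor. -/
lemma integral_mul_unitExp_eq {a b : ℝ} (hab : a ≤ b) {q q' φ φ' : ℝ → ℝ}
    (hq : ∀ x ∈ Set.Icc a b, HasDerivAt q (q' x) x)
    (hφ : ∀ x ∈ Set.Icc a b, HasDerivAt φ (φ' x) x)
    (hq' : IntervalIntegrable q' volume a b) (hφ' : ContinuousOn φ' (Set.Icc a b)) :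
    ∫ x in a..b, ((q x * φ' x : ℝ) : ℂ) * unitExp (φ x) =
      (q b * unitExp (φ b) - q a * unitExp (φ a) - ∫ x in a..b, (q' x : ℂ) * unitExp (φ x)) /
        (2 * Real.pi * I) := by
  have hu : Set.uIcc a b = Set.Icc a b := Set.uIcc_of_le hab
  have hφc : ContinuousOn φ (Set.Icc a b) := fun x hx => (hφ x hx).continuousAt.continuousWithinAt
  have hec : ContinuousOn (fun x => unitExp (φ x)) (Set.Icc a b) :=
    continuous_unitExp.comp_continuousOn hφc
  have key := intervalIntegral.integral_mul_deriv_eq_deriv_mul (a := a) (b := b)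
    (u := fun x => (q x : ℂ)) (u' := fun x => (q' x : ℂ)) (v := fun x => unitExp (φ x))
    (v' := fun x => 2 * Real.pi * I * φ' x * unitExp (φ x))
    (fun x hx => (hq x (hu ▸ hx)).ofReal_comp)
    (fun x hx => hasDerivAt_unitExp (hφ x (hu ▸ hx)))
    (by
      have := hq'
      rw [intervalIntegrable_iff] at this ⊢
      exact this.ofReal)
    (by
      apply ContinuousOn.intervalIntegrable
      rw [hu]
      exact (continuousOn_const.mul (Complex.continuous_ofReal.comp_continuousOn hφ')).mul hec)
  rw [eq_div_iff two_pi_I_ne, ← key, ← intervalIntegral.integral_mul_const]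
  congr 1
  ext x
  push_cast
  ring

lemma norm_integral_mul_unitExp_le_integral_abs {a b : ℝ} (hab : a ≤ b) (q φ : ℝ → ℝ) :
    ‖∫ x in a..b, (q x : ℂ) * unitExp (φ x)‖ ≤ ∫ x in a..b, |q x| := by
  refine (intervalIntegral.norm_integral_le_integral_norm hab).trans (le_of_eq ?_)
  congr 1
  ext x
  simp [norm_unitExp]

/-- First derivative test. -/
lemma norm_integral_mul_unitExp_le {a b : ℝ} (hab : a ≤ b) {q q' φ φ' : ℝ → ℝ} {B D : ℝ}
    (hq : ∀ x ∈ Set.Icc a b, HasDerivAt q (q' x) x)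
    (hφ : ∀ x ∈ Set.Icc a b, HasDerivAt φ (φ' x) x)
    (hq' : IntervalIntegrable q' volume a b) (hφ' : ContinuousOn φ' (Set.Icc a b))
    (hB : ∀ x ∈ Set.Icc a b, |q x| ≤ B) (hD : ∫ x in a..b, |q' x| ≤ D) :
    ‖∫ x in a..b, ((q x * φ' x : ℝ) : ℂ) * unitExp (φ x)‖ ≤ B + D := by
  rw [integral_mul_unitExp_eq hab hq hφ hq' hφ', norm_div, norm_two_pi_I,
    div_le_iff₀ (by positivity)]
  have h1 := norm_integral_mul_unitExp_le_integral_abs hab q' φ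
  have ha : ‖(q a : ℂ) * unitExp (φ a)‖ ≤ B := by
    simpa [norm_unitExp] using hB a ⟨le_rfl, hab⟩
  have hb : ‖(q b : ℂ) * unitExp (φ b)‖ ≤ B := by
    simpa [norm_unitExp] using hB b ⟨hab, le_rfl⟩
  have hB0 : 0 ≤ B := (norm_nonneg _).trans ha
  have hD0 : 0 ≤ D := le_trans (intervalIntegral.integral_nonneg hab fun x _ => abs_nonneg _) hD
  have := Real.pi_gt_three
  calc _ ≤ ‖(q b : ℂ) * unitExp (φ b)‖ + ‖(q a : ℂ) * unitExp (φ a)‖ +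
        ‖∫ x in a..b, (q' x : ℂ) * unitExp (φ x)‖ :=
      (norm_sub_le _ _).trans (add_le_add_left (norm_sub_le _ _) _)
    _ ≤ B + B + D := by linarith
    _ ≤ _ := by nlinarith

/-- The total variation of a function whose derivative has constant sign. -/
lemma intervalIntegrable_and_integral_abs_deriv {a b : ℝ} (hab : a ≤ b) {q q' : ℝ → ℝ}
    (hq : ∀ x ∈ Set.Icc a b, HasDerivAt q (q' x) x)
    (hs : (∀ x ∈ Set.Icc a b, 0 ≤ q' x) ∨ (∀ x ∈ Set.Icc a b, q' x ≤ 0)) :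
    IntervalIntegrable q' volume a b ∧ ∫ x in a..b, |q' x| = |q b - q a| := by
  have hu : Set.uIcc a b = Set.Icc a b := Set.uIcc_of_le hab
  have hI : Set.Ioo (min a b) (max a b) ⊆ Set.Icc a b := by
    rw [min_eq_left hab, max_eq_right hab]
    exact Set.Ioo_subset_Icc_self
  have hc : ContinuousOn q (Set.uIcc a b) := by
    rw [hu]
    exact fun x hx => (hq x hx).continuousAt.continuousWithinAt
  rcases hs with hs | hs
  · have hi := intervalIntegral.intervalIntegrable_deriv_of_nonneg hc
      (fun x hx => hq x (hI hx)) (fun x hx => hs x (hI hx))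
    refine ⟨hi, ?_⟩
    have h1 : ∫ x in a..b, q' x = q b - q a :=
      intervalIntegral.integral_eq_sub_of_hasDerivAt (fun x hx => hq x (hu ▸ hx)) hi
    have h2 : ∫ x in a..b, |q' x| = ∫ x in a..b, q' x :=
      intervalIntegral.integral_congr fun x hx => abs_of_nonneg (hs x (hu ▸ hx))
    rw [h2, ← h1, abs_of_nonneg (intervalIntegral.integral_nonneg hab hs)]
  · have hi' := intervalIntegral.intervalIntegrable_deriv_of_nonneg hc.neg
      (fun x hx => (hq x (hI hx)).neg) (fun x hx => neg_nonneg.2 (hs x (hI hx)))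
    have hi : IntervalIntegrable q' volume a b := by
      simpa [Pi.neg_def] using hi'.neg
    refine ⟨hi, ?_⟩
    have h1 : ∫ x in a..b, q' x = q b - q a :=
      intervalIntegral.integral_eq_sub_of_hasDerivAt (fun x hx => hq x (hu ▸ hx)) hi
    have h2 : ∫ x in a..b, |q' x| = ∫ x in a..b, -q' x :=
      intervalIntegral.integral_congr fun x hx => abs_of_nonpos (hs x (hu ▸ hx))
    rw [h2, intervalIntegral.integral_neg, ← h1, abs_of_nonpos]
    rw [← neg_nonneg, ← intervalIntegral.integral_neg]
    exact intervalIntegral.integral_nonneg hab fun x hx => neg_nonneg.2 (hs x hx)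

/-- First derivative test for a monotone nonnegative amplitude. -/
lemma norm_integral_mul_unitExp_le_of_monotone {a b : ℝ} (hab : a ≤ b) {q q' φ φ' : ℝ → ℝ} {B : ℝ}
    (hq : ∀ x ∈ Set.Icc a b, HasDerivAt q (q' x) x)
    (hφ : ∀ x ∈ Set.Icc a b, HasDerivAt φ (φ' x) x)
    (hs : (∀ x ∈ Set.Icc a b, 0 ≤ q' x) ∨ (∀ x ∈ Set.Icc a b, q' x ≤ 0))
    (hφ' : ContinuousOn φ' (Set.Icc a b))
    (hB : ∀ x ∈ Set.Icc a b, 0 ≤ q x ∧ q x ≤ B) :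
    ‖∫ x in a..b, ((q x * φ' x : ℝ) : ℂ) * unitExp (φ x)‖ ≤ 2 * B := by
  obtain ⟨hi, hv⟩ := intervalIntegrable_and_integral_abs_deriv hab hq hs
  have h := norm_integral_mul_unitExp_le hab hq hφ hi hφ' (B := B) (D := B)
    (fun x hx => abs_le.2 ⟨by linarith [hB x hx], (hB x hx).2⟩) (by
      rw [hv]
      have h1 := hB a ⟨le_rfl, hab⟩
      have h2 := hB b ⟨hab, le_rfl⟩
      exact abs_le.2 ⟨by linarith, by linarith⟩)
  linarith

lemma integral_gaussian_damped_sub_le {δ u : ℝ} (hδ : 0 < δ) (hu : 0 < u) :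
    ‖(Real.pi / (δ - 2 * Real.pi * I) : ℂ) ^ (1 / 2 : ℂ) / 2 -
      ∫ x in (0 : ℝ)..u, (Real.exp (-δ * x ^ 2) : ℂ) * unitExp (x ^ 2)‖ ≤ 1 / u := by
  set b : ℂ := δ - 2 * Real.pi * I with hb
  have hbre : 0 < b.re := by simp [hb, hδ]
  have hfun : ∀ x : ℝ, (Real.exp (-δ * x ^ 2) : ℂ) * unitExp (x ^ 2) = cexp (-b * (x : ℂ) ^ 2) := by
    intro x
    unfold unitExp
    rw [Complex.ofReal_exp, ← Complex.exp_add, hb]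
    congr 1
    push_cast
    ring
  simp_rw [hfun]
  rw [← integral_gaussian_complex_Ioi hbre]
  have hfi : Integrable (fun x : ℝ => cexp (-b * (x : ℂ) ^ 2)) := integrable_cexp_neg_mul_sq hbre
  have hlim := intervalIntegral_tendsto_integral_Ioi 0 hfi.integrableOn tendsto_id
  have hlim2 := (hlim.sub_const
    (∫ x in (0 : ℝ)..u, cexp (-b * (x : ℂ) ^ 2))).norm
  refine le_of_tendsto hlim2 ?_
  filter_upwards [eventually_ge_atTop u] with R hR
  simp only [id]
  rw [intervalIntegral.integral_interval_sub_left hfi.intervalIntegrable hfi.intervalIntegrable]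
  have hpos : ∀ x ∈ Set.Icc u R, 0 < x := fun x hx => hu.trans_le hx.1
  have key := norm_integral_mul_unitExp_le_of_monotone hR
    (q := fun x => Real.exp (-δ * x ^ 2) / (2 * x))
    (q' := fun x => (Real.exp (-δ * x ^ 2) * (-δ * (2 * x)) * (2 * x) -
      Real.exp (-δ * x ^ 2) * 2) / (2 * x) ^ 2)
    (φ := fun x => x ^ 2) (φ' := fun x => 2 * x) (B := 1 / (2 * u)) (fun x hx => by
      have h1 : HasDerivAt (fun x : ℝ => -δ * x ^ 2) (-δ * (2 * x)) x := by
        simpa using (hasDerivAt_pow 2 x).const_mul (-δ)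
      have h2 : HasDerivAt (fun x : ℝ => 2 * x) 2 x := by
        simpa using (hasDerivAt_id x).const_mul 2
      exact h1.exp.div h2 (by have := hpos x hx; positivity))
    (fun x _ => by simpa using hasDerivAt_pow 2 x)
    (Or.inr fun x hx => by
      have := hpos x hx
      apply div_nonpos_of_nonpos_of_nonneg _ (by positivity)
      have h3 : 0 < Real.exp (-δ * x ^ 2) := Real.exp_pos _
      have : 0 < Real.exp (-δ * x ^ 2) * (δ * (2 * x)) * (2 * x) := by positivity
      nlinarith)
    (by fun_prop)
    (fun x hx => by
      have := hpos x hx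
      refine ⟨by positivity, ?_⟩
      apply div_le_div₀ zero_le_one _ (by positivity) (by linarith [hx.1])
      exact Real.exp_le_one_iff.2 (by nlinarith [sq_nonneg x]))
  calc _ = ‖∫ x in u..R, ((Real.exp (-δ * x ^ 2) / (2 * x) * (2 * x) : ℝ) : ℂ) *
        unitExp (x ^ 2)‖ := by
        congr 1
        apply intervalIntegral.integral_congr
        intro x hx
        rw [Set.uIcc_of_le hR] at hx
        have := hpos x hx
        simp only
        rw [← hfun, div_mul_cancel₀ _ (by positivity)]
    _ ≤ _ := key
    _ = 1 / u := by field_simp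

lemma sqrt_I_half : (Real.pi / ((0 : ℝ) - 2 * Real.pi * I) : ℂ) ^ (1 / 2 : ℂ) =
    unitExp (1 / 8) / Real.sqrt 2 := by
  have hp : (Real.pi : ℂ) ≠ 0 := by exact_mod_cast Real.pi_ne_zero
  have h2 : ((Real.sqrt 2 : ℝ) : ℂ) ^ 2 = 2 := by
    norm_cast
    exact Real.sq_sqrt (by norm_num)
  have he : unitExp (1 / 8) ^ 2 = I := by
    rw [sq, ← unitExp_add]
    unfold unitExp
    refine Eq.trans ?_ Complex.exp_pi_div_two_mul_I
    congr 1
    push_cast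
    ring
  have h1 : (Real.pi / ((0 : ℝ) - 2 * Real.pi * I) : ℂ) =
      (unitExp (1 / 8) / Real.sqrt 2) ^ (2 : ℂ) := by
    have : (unitExp (1 / 8) / Real.sqrt 2) ^ (2 : ℂ) = (unitExp (1 / 8) / Real.sqrt 2) ^ 2 := by
      exact_mod_cast Complex.cpow_natCast _ 2
    rw [this, div_pow, h2, he, div_eq_div_iff (by simp) two_ne_zero]
    push_cast
    linear_combination (2 * Real.pi : ℂ) * Complex.I_mul_I
  rw [h1, show (1 / 2 : ℂ) = 2⁻¹ by norm_num]
  have hcp : ∀ z : ℂ, z ^ (2 : ℂ) = z ^ (2 : ℕ) := fun z => by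
    exact_mod_cast Complex.cpow_natCast z 2
  rw [hcp, Complex.sq_cpow_two_inv]
  have : (unitExp (1 / 8) / Real.sqrt 2).re = Real.cos (Real.pi / 4) / Real.sqrt 2 := by
    rw [Complex.div_ofReal_re]
    congr 1
    unfold unitExp
    rw [Complex.exp_ofReal_mul_I_re]
    congr 1
    ring
  rw [this, Real.cos_pi_div_four]
  positivity

lemma norm_integral_zero_fresnel_sub_le {u : ℝ} (hu : 0 ≤ u) :
    ‖(∫ x in (0 : ℝ)..u, unitExp (x ^ 2)) - unitExp (1 / 8) / Real.sqrt 2 / 2‖ ≤ 4 / (1 + u) := by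
  rcases lt_or_ge u 1 with h1 | h1
  · have hJ : ‖∫ x in (0 : ℝ)..u, unitExp (x ^ 2)‖ ≤ 1 * |u - 0| :=
      intervalIntegral.norm_integral_le_of_norm_le_const fun x _ => (norm_unitExp _).le
    have hc : ‖unitExp (1 / 8) / Real.sqrt 2 / 2‖ ≤ 1 := by
      rw [norm_div, norm_div, norm_unitExp, Complex.norm_real, Real.norm_eq_abs,
        abs_of_nonneg (Real.sqrt_nonneg _)]
      have h2 : 1 ≤ Real.sqrt 2 := Real.one_le_sqrt.2 (by norm_num)
      have h3 : 1 / Real.sqrt 2 ≤ 1 := by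
        rw [div_le_one (by positivity)]
        exact h2
      have : ‖(2 : ℂ)‖ = 2 := by simp
      rw [this]
      linarith
    rw [sub_zero, abs_of_nonneg hu] at hJ
    refine (norm_sub_le _ _).trans ?_
    rw [le_div_iff₀ (by linarith)]
    nlinarith
  · have hu0 : 0 < u := by linarith
    have hle : ‖(∫ x in (0 : ℝ)..u, unitExp (x ^ 2)) - unitExp (1 / 8) / Real.sqrt 2 / 2‖ ≤
        1 / u := by
      rw [← sqrt_I_half, norm_sub_rev]
      have hcont1 : ContinuousAt (fun δ : ℝ =>
          (Real.pi / ((δ : ℂ) - 2 * Real.pi * I) : ℂ) ^ (1 / 2 : ℂ) / 2) 0 := by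
        have hp : (Real.pi : ℂ) ≠ 0 := by exact_mod_cast Real.pi_ne_zero
        have hne : ((0 : ℝ) : ℂ) - 2 * Real.pi * I ≠ 0 := by
          simp [Complex.I_ne_zero]
        have hin : ContinuousAt (fun δ : ℝ => (Real.pi / ((δ : ℂ) - 2 * Real.pi * I) : ℂ)) 0 := by
          have hden : ContinuousAt (fun δ : ℝ => (δ : ℂ) - 2 * Real.pi * I) 0 := by fun_prop
          exact continuousAt_const.div hden hne
        refine (hin.cpow continuousAt_const ?_).div_const 2
        right
        have : (Real.pi / (((0 : ℝ) : ℂ) - 2 * Real.pi * I) : ℂ) = I / 2 := by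
          rw [div_eq_div_iff hne two_ne_zero]
          push_cast
          linear_combination (2 * Real.pi : ℂ) * Complex.I_mul_I
        rw [this]
        simp
      have hcont2 : Continuous (fun δ : ℝ =>
          ∫ x in (0 : ℝ)..u, (Real.exp (-δ * x ^ 2) : ℂ) * unitExp (x ^ 2)) := by
        apply intervalIntegral.continuous_parametric_intervalIntegral_of_continuous'
        have := continuous_unitExp
        fun_prop
      have hlim := ((hcont1.sub hcont2.continuousAt).norm.tendsto).mono_left
        (nhdsWithin_le_nhds (s := Set.Ioi 0))
      have := le_of_tendsto (b := 1 / u) hlim (by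
        filter_upwards [self_mem_nhdsWithin] with δ hδ
        exact integral_gaussian_damped_sub_le hδ hu0)
      simpa using this
    refine hle.trans ?_
    rw [div_le_div_iff₀ hu0 (by linarith)]
    linarith

/-- The Fresnel integral over a finite interval. -/
lemma norm_integral_fresnel_sub_le (u v : ℝ) (huv : u ≤ v) :
    ‖(∫ x in u..v, unitExp (x ^ 2)) -
      (if u < 0 ∧ 0 ≤ v then unitExp (1 / 8) / Real.sqrt 2 else 0)‖ ≤
      4 * (1 / (1 + |u|) + 1 / (1 + |v|)) := by
  have hc : Continuous fun x : ℝ => unitExp (x ^ 2) := continuous_unitExp.comp (continuous_pow 2)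
  have hi : ∀ a b : ℝ, IntervalIntegrable (fun x : ℝ => unitExp (x ^ 2)) volume a b :=
    fun a b => hc.intervalIntegrable a b
  have hodd : ∀ w : ℝ, (∫ x in (0 : ℝ)..w, unitExp (x ^ 2)) =
      -∫ x in (0 : ℝ)..(-w), unitExp (x ^ 2) := by
    intro w
    have := intervalIntegral.integral_comp_neg (fun x : ℝ => unitExp (x ^ 2)) (a := 0) (b := w)
    simp only [neg_sq, neg_zero] at this
    rw [this, intervalIntegral.integral_symm]
  have hsplit : (∫ x in u..v, unitExp (x ^ 2)) =
      (∫ x in (0 : ℝ)..v, unitExp (x ^ 2)) - ∫ x in (0 : ℝ)..u, unitExp (x ^ 2) :=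
    (intervalIntegral.integral_interval_sub_left (hi _ _) (hi _ _)).symm
  set c : ℂ := unitExp (1 / 8) / Real.sqrt 2 with hcdef
  have hfin : ∀ {z w : ℂ} {s t : ℝ}, ‖z‖ ≤ 4 / s → ‖w‖ ≤ 4 / t →
      ‖z - w‖ ≤ 4 * (1 / t + 1 / s) := by
    intro z w s t hz hw
    calc ‖z - w‖ ≤ ‖z‖ + ‖w‖ := norm_sub_le _ _
      _ ≤ 4 / s + 4 / t := add_le_add hz hw
      _ = _ := by ring
  rcases lt_or_ge u 0 with hu | hu
  · have hU := norm_integral_zero_fresnel_sub_le (u := -u) (by linarith)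
    rw [← abs_of_neg hu] at hU
    rcases lt_or_ge v 0 with hv | hv
    · have hV := norm_integral_zero_fresnel_sub_le (u := -v) (by linarith)
      rw [← abs_of_neg hv] at hV
      rw [if_neg (by intro h; linarith [h.2]), hsplit, sub_zero, hodd v, hodd u,
        ← abs_of_neg hv, ← abs_of_neg hu, ← norm_neg]
      refine Eq.trans_le ?_ (hfin hV hU)
      congr 1
      ring
    · have hV := norm_integral_zero_fresnel_sub_le hv
      rw [if_pos ⟨hu, hv⟩, hsplit, hodd u, ← abs_of_neg hu]
      rw [← norm_neg] at hU
      conv_rhs => rw [abs_of_nonneg hv]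
      convert hfin hV hU using 2
      ring
  · have hU := norm_integral_zero_fresnel_sub_le hu
    have hV := norm_integral_zero_fresnel_sub_le (hu.trans huv)
    rw [if_neg (by intro h; linarith [h.1]), hsplit, sub_zero, abs_of_nonneg hu,
      abs_of_nonneg (hu.trans huv)]
    convert hfin hV hU using 2
    ring

/-- Stationary phase for the phase `w ^ 2` and an amplitude `α w' + ρ (w ^ 2)'` with monotone
`ρ`. -/
lemma norm_integral_stationary_sub_le {a b α B : ℝ} (hab : a ≤ b) (hα : 0 ≤ α)
    {w w' ρ ρ' : ℝ → ℝ}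
    (hw : ∀ x ∈ Set.Icc a b, HasDerivAt w (w' x) x) (hw' : ContinuousOn w' (Set.Icc a b))
    (hwmono : w a ≤ w b)
    (hρ : ∀ x ∈ Set.Icc a b, HasDerivAt ρ (ρ' x) x)
    (hs : (∀ x ∈ Set.Icc a b, 0 ≤ ρ' x) ∨ (∀ x ∈ Set.Icc a b, ρ' x ≤ 0))
    (hB : ∀ x ∈ Set.Icc a b, 0 ≤ ρ x ∧ ρ x ≤ B) :
    ‖(∫ x in a..b, ((α * w' x + ρ x * (2 * w x * w' x) : ℝ) : ℂ) * unitExp (w x ^ 2)) -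
      (if w a < 0 ∧ 0 ≤ w b then α * (unitExp (1 / 8) / Real.sqrt 2) else 0)‖ ≤
      4 * α * (1 / (1 + |w a|) + 1 / (1 + |w b|)) + 2 * B := by
  have hu : Set.uIcc a b = Set.Icc a b := Set.uIcc_of_le hab
  have hwc : ContinuousOn w (Set.Icc a b) := fun x hx => (hw x hx).continuousAt.continuousWithinAt
  have hρc : ContinuousOn ρ (Set.Icc a b) := fun x hx => (hρ x hx).continuousAt.continuousWithinAt
  have hec : ContinuousOn (fun x => unitExp (w x ^ 2)) (Set.Icc a b) :=
    continuous_unitExp.comp_continuousOn (hwc.pow 2)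
  have hsub : ∫ x in a..b, (w' x : ℂ) * unitExp (w x ^ 2) =
      ∫ y in (w a)..(w b), unitExp (y ^ 2) := by
    have := intervalIntegral.integral_deriv_smul_comp (a := a) (b := b) (f := w) (f' := w')
      (g := fun y : ℝ => unitExp (y ^ 2)) (fun x hx => hw x (hu ▸ hx)) (by rwa [hu])
      (continuous_unitExp.comp (continuous_pow 2))
    rw [← this]
    rfl
  have h2 := norm_integral_mul_unitExp_le_of_monotone hab (q := ρ) (q' := ρ')
    (φ := fun x => w x ^ 2) (φ' := fun x => 2 * w x * w' x) (B := B) hρ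
    (fun x hx => by simpa using (hw x hx).fun_pow 2) hs
    ((continuousOn_const.mul hwc).mul hw') hB
  have hsplit : (∫ x in a..b, ((α * w' x + ρ x * (2 * w x * w' x) : ℝ) : ℂ) *
        unitExp (w x ^ 2)) =
      α * (∫ x in a..b, (w' x : ℂ) * unitExp (w x ^ 2)) +
      ∫ x in a..b, ((ρ x * (2 * w x * w' x) : ℝ) : ℂ) * unitExp (w x ^ 2) := by
    rw [← intervalIntegral.integral_const_mul, ← intervalIntegral.integral_add]
    · congr 1
      ext x
      push_cast
      ring
    · apply ContinuousOn.intervalIntegrable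
      rw [hu]
      exact continuousOn_const.mul ((Complex.continuous_ofReal.comp_continuousOn hw').mul hec)
    · apply ContinuousOn.intervalIntegrable
      rw [hu]
      exact (Complex.continuous_ofReal.comp_continuousOn
        (hρc.mul ((continuousOn_const.mul hwc).mul hw'))).mul hec
  have h1 := norm_integral_fresnel_sub_le (w a) (w b) hwmono
  rw [hsplit, hsub]
  have h3 : (if w a < 0 ∧ 0 ≤ w b then α * (unitExp (1 / 8) / Real.sqrt 2) else 0 : ℂ) =
      α * (if w a < 0 ∧ 0 ≤ w b then (unitExp (1 / 8) / Real.sqrt 2) else 0) := by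
    split_ifs <;> simp
  rw [h3]
  calc _ = ‖(α : ℂ) * ((∫ y in (w a)..(w b), unitExp (y ^ 2)) -
        (if w a < 0 ∧ 0 ≤ w b then (unitExp (1 / 8) / Real.sqrt 2) else 0)) +
        ∫ x in a..b, ((ρ x * (2 * w x * w' x) : ℝ) : ℂ) * unitExp (w x ^ 2)‖ := by
        congr 1
        ring
    _ ≤ α * (4 * (1 / (1 + |w a|) + 1 / (1 + |w b|))) + 2 * B := by
        refine (norm_add_le _ _).trans (add_le_add ?_ h2)
        rw [norm_mul, Complex.norm_real, Real.norm_eq_abs, abs_of_nonneg hα]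
        gcongr
    _ = _ := by ring

private lemma mul_neg_iff_of_left_pos {a b : ℝ} (ha : 0 < a) : a * b < 0 ↔ b < 0 :=
  ⟨fun h => neg_of_mul_neg_right h ha.le, fun h => mul_neg_of_pos_of_neg ha h⟩

private lemma stationary_error_le {X c y α κ : ℝ} (hX : 0 < X) (hκ : κ = Real.sqrt (X / 2))
    (hακ : α * κ ≤ 1) (hy : κ * |c| ≤ |y|) :
    α * (1 / (1 + |y|)) ≤ 2 * (1 / (Real.sqrt X + X * |c|)) := by
  have hκ0 : 0 < κ := hκ ▸ Real.sqrt_pos.2 (by positivity)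
  have hκ2 : κ ^ 2 = X / 2 := by rw [hκ, Real.sq_sqrt (by positivity)]
  have hsX : 0 < Real.sqrt X := Real.sqrt_pos.2 hX
  have hκs : Real.sqrt X ≤ 2 * κ := by
    rw [hκ]
    apply Real.sqrt_le_iff.2 ⟨by positivity, ?_⟩
    rw [mul_pow, Real.sq_sqrt (by positivity)]
    linarith
  have h1 : α ≤ 1 / κ := by
    rw [le_div_iff₀ hκ0]
    exact hακ
  have hc : 0 ≤ |c| := abs_nonneg c
  calc α * (1 / (1 + |y|)) ≤ (1 / κ) * (1 / (1 + κ * |c|)) := by gcongr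
    _ = 1 / (κ + X / 2 * |c|) := by
        rw [← hκ2]
        field_simp
    _ ≤ 1 / ((Real.sqrt X + X * |c|) / 2) := by
        apply one_div_le_one_div_of_le (by positivity)
        linarith
    _ = _ := by field_simp

lemma norm_integral_sqrt_mul_quadratic_sub_le {X t₁ t₂ : ℝ} (hX : 0 < X) (h1 : 0 < t₁)
    (h12 : t₁ ≤ t₂) :
    ‖(∫ t in t₁..t₂, (Real.sqrt t : ℂ) * unitExp (X / 2 * (t - 1) ^ 2)) -
      (if t₁ < 1 ∧ 1 ≤ t₂ then unitExp (1 / 8) / Real.sqrt X else 0)‖ ≤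
      8 * (1 / (Real.sqrt X + X * |t₁ - 1|) + 1 / (Real.sqrt X + X * |t₂ - 1|) + 1 / X) := by
  set κ := Real.sqrt (X / 2) with hκ
  have hκ0 : 0 < κ := Real.sqrt_pos.2 (by positivity)
  have hκ2 : κ ^ 2 = X / 2 := Real.sq_sqrt (by positivity)
  have hpos : ∀ t ∈ Set.Icc t₁ t₂, 0 < t := fun t ht => h1.trans_le ht.1
  have key := norm_integral_stationary_sub_le (a := t₁) (b := t₂) (α := 1 / κ) (B := 1 / X)
    h12 (by positivity) (w := fun t => κ * (t - 1)) (w' := fun _ => κ)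
    (ρ := fun t => 1 / (X * (Real.sqrt t + 1)))
    (ρ' := fun t => -(X * (1 / (2 * Real.sqrt t))) / (X * (Real.sqrt t + 1)) ^ 2)
    (fun t _ => by simpa using ((hasDerivAt_id t).sub_const 1).const_mul κ)
    continuousOn_const
    (by gcongr)
    (fun t ht => by
      have ht0 := hpos t ht
      have hd : HasDerivAt (fun t => X * (Real.sqrt t + 1)) (X * (1 / (2 * Real.sqrt t))) t :=
        ((Real.hasDerivAt_sqrt ht0.ne').add_const 1).const_mul X
      simp only [one_div] at hd ⊢
      exact hd.fun_inv (by positivity))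
    (Or.inr fun t ht => by
      have ht0 := hpos t ht
      rw [neg_div]
      exact neg_nonpos.2 (by positivity))
    (fun t ht => by
      have ht0 := hpos t ht
      refine ⟨by positivity, ?_⟩
      apply one_div_le_one_div_of_le hX
      have := Real.sqrt_nonneg t
      nlinarith)
  have hI : (∫ t in t₁..t₂, (Real.sqrt t : ℂ) * unitExp (X / 2 * (t - 1) ^ 2)) =
      ∫ t in t₁..t₂, ((1 / κ * κ + 1 / (X * (Real.sqrt t + 1)) * (2 * (κ * (t - 1)) * κ) : ℝ) : ℂ) *
        unitExp ((κ * (t - 1)) ^ 2) := by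
    apply intervalIntegral.integral_congr
    intro t ht
    rw [Set.uIcc_of_le h12] at ht
    have ht0 := hpos t ht
    have hs := Real.sq_sqrt ht0.le
    have hs0 := Real.sqrt_nonneg t
    simp only
    congr 2
    · have : 2 * (κ * (t - 1)) * κ = X * (t - 1) := by linear_combination 2 * (t - 1) * hκ2
      rw [this, one_div_mul_cancel hκ0.ne']
      field_simp
      linear_combination hs
    · rw [mul_pow, hκ2]
  have hif : (if t₁ < 1 ∧ 1 ≤ t₂ then unitExp (1 / 8) / Real.sqrt X else 0 : ℂ) =
      if κ * (t₁ - 1) < 0 ∧ 0 ≤ κ * (t₂ - 1) then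
        ((1 / κ : ℝ) : ℂ) * (unitExp (1 / 8) / Real.sqrt 2) else 0 := by
    have e1 : κ * (t₁ - 1) < 0 ↔ t₁ < 1 := by rw [mul_neg_iff_of_left_pos hκ0, sub_neg]
    have e2 : 0 ≤ κ * (t₂ - 1) ↔ 1 ≤ t₂ := by rw [mul_nonneg_iff_of_pos_left hκ0, sub_nonneg]
    simp only [e1, e2]
    congr 1
    have : Real.sqrt X = κ * Real.sqrt 2 := by
      rw [hκ, ← Real.sqrt_mul (by positivity)]
      congr 1
      ring
    rw [this]
    push_cast
    have : (κ : ℂ) ≠ 0 := by exact_mod_cast hκ0.ne'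
    field_simp
  rw [hI, hif]
  refine key.trans ?_
  have ha : 1 / κ * κ ≤ 1 := (one_div_mul_cancel hκ0.ne').le
  have e1 := stationary_error_le (y := κ * (t₁ - 1)) (c := t₁ - 1) hX hκ ha
    (by rw [abs_mul, abs_of_pos hκ0])
  have e2 := stationary_error_le (y := κ * (t₂ - 1)) (c := t₂ - 1) hX hκ ha
    (by rw [abs_mul, abs_of_pos hκ0])
  have : 0 < 1 / X := by positivity
  nlinarith

lemma norm_integral_mul_sqrt_mul_cubic_sub_le {X t₁ t₂ : ℝ} (hX : 0 < X) (h1 : 0 < t₁)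
    (h12 : t₁ ≤ t₂) :
    ‖(∫ t in t₁..t₂, ((t * Real.sqrt t : ℝ) : ℂ) * unitExp (X / 2 * (t - 1) ^ 2 * (2 * t + 1))) -
      (if t₁ < 1 ∧ 1 ≤ t₂ then unitExp (1 / 8) / Real.sqrt (3 * X) else 0)‖ ≤
      8 * (1 / (Real.sqrt X + X * |t₁ - 1|) + 1 / (Real.sqrt X + X * |t₂ - 1|) + 1 / X) := by
  set κ := Real.sqrt (X / 2) with hκ
  have hκ0 : 0 < κ := Real.sqrt_pos.2 (by positivity)
  have hκ2 : κ ^ 2 = X / 2 := Real.sq_sqrt (by positivity)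
  have h3 : 0 < Real.sqrt 3 := Real.sqrt_pos.2 (by norm_num)
  have h3s : Real.sqrt 3 ^ 2 = 3 := Real.sq_sqrt (by norm_num)
  have hpos : ∀ t ∈ Set.Icc t₁ t₂, 0 < t := fun t ht => h1.trans_le ht.1
  have hsq : ∀ t : ℝ, 0 < t → HasDerivAt (fun t => Real.sqrt (2 * t + 1))
      (1 / Real.sqrt (2 * t + 1)) t := by
    intro t ht
    have hl : HasDerivAt (fun t : ℝ => 2 * t + 1) 2 t := by
      simpa using ((hasDerivAt_id t).const_mul 2).add_const 1
    have hs : 0 < Real.sqrt (2 * t + 1) := Real.sqrt_pos.2 (by positivity)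
    convert hl.sqrt (by positivity) using 1
    field_simp
  set D : ℝ → ℝ := fun t => Real.sqrt t + Real.sqrt 3 / Real.sqrt (2 * t + 1) with hD
  set D' : ℝ → ℝ := fun t => 1 / (2 * Real.sqrt t) -
    Real.sqrt 3 * (1 / Real.sqrt (2 * t + 1)) / Real.sqrt (2 * t + 1) ^ 2 with hD'
  have hDd : ∀ t : ℝ, 0 < t → HasDerivAt D (D' t) t := by
    intro t ht
    have hs : 0 < Real.sqrt (2 * t + 1) := Real.sqrt_pos.2 (by positivity)
    refine ((Real.hasDerivAt_sqrt ht.ne').fun_add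
      ((hasDerivAt_const t (Real.sqrt 3)).fun_div (hsq t ht) hs.ne')).congr_deriv ?_
    simp only [hD']
    ring
  have hD0 : ∀ t : ℝ, 0 < t → 0 ≤ D' t := by
    intro t ht
    have hs : 0 < Real.sqrt (2 * t + 1) := Real.sqrt_pos.2 (by positivity)
    have hst : 0 < Real.sqrt t := Real.sqrt_pos.2 ht
    have e1 := Real.sq_sqrt ht.le
    have e2 := Real.sq_sqrt (by positivity : 0 ≤ 2 * t + 1)
    simp only [hD']
    rw [sub_nonneg, mul_one_div, div_div, div_le_div_iff₀ (by positivity) (by positivity), one_mul]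
    apply le_of_sq_le_sq _ (by positivity)
    have : (Real.sqrt (2 * t + 1) * Real.sqrt (2 * t + 1) ^ 2) ^ 2 = (2 * t + 1) ^ 3 := by
      calc _ = (Real.sqrt (2 * t + 1) ^ 2) ^ 3 := by ring
        _ = _ := by rw [e2]
    rw [this]
    have : (Real.sqrt 3 * (2 * Real.sqrt t)) ^ 2 = 12 * t := by
      rw [mul_pow, mul_pow, h3s, e1]
      ring
    rw [this]
    nlinarith [sq_nonneg (t - 1), sq_nonneg (4 * t - 1), pow_pos ht 3]
  have hD1 : ∀ t : ℝ, 0 < t → 1 ≤ D t := by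
    intro t ht
    have hs : 0 < Real.sqrt (2 * t + 1) := Real.sqrt_pos.2 (by positivity)
    have hst : 0 < Real.sqrt t := Real.sqrt_pos.2 ht
    simp only [hD]
    rcases le_total 1 t with h | h
    · have : 1 ≤ Real.sqrt t := Real.one_le_sqrt.2 h
      have : 0 < Real.sqrt 3 / Real.sqrt (2 * t + 1) := by positivity
      linarith
    · have : 1 ≤ Real.sqrt 3 / Real.sqrt (2 * t + 1) := by
        rw [one_le_div hs]
        exact Real.sqrt_le_sqrt (by linarith)
      linarith
  have key := norm_integral_stationary_sub_le (a := t₁) (b := t₂) (α := 1 / (Real.sqrt 3 * κ))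
    (B := 1 / X)
    h12 (by positivity) (w := fun t => κ * (t - 1) * Real.sqrt (2 * t + 1))
    (w' := fun t => κ * (3 * t) / Real.sqrt (2 * t + 1))
    (ρ := fun t => (1 + 2 / (2 * t + 1)) * (D t)⁻¹ * (1 / (3 * X)))
    (ρ' := fun t => (-(2 * 2) / (2 * t + 1) ^ 2 * (D t)⁻¹ +
      (1 + 2 / (2 * t + 1)) * (-D' t / D t ^ 2)) * (1 / (3 * X)))
    (fun t ht => by
      have ht0 := hpos t ht
      have hs : 0 < Real.sqrt (2 * t + 1) := Real.sqrt_pos.2 (by positivity)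
      have e2 := Real.sq_sqrt (by positivity : 0 ≤ 2 * t + 1)
      refine (((hasDerivAt_id' t).sub_const 1).const_mul κ |>.fun_mul (hsq t ht0)).congr_deriv ?_
      field_simp
      linear_combination e2)
    (by
      intro t ht
      have ht0 := hpos t ht
      have hs : 0 < Real.sqrt (2 * t + 1) := Real.sqrt_pos.2 (by positivity)
      apply ContinuousAt.continuousWithinAt
      exact ContinuousAt.div (by fun_prop) (by fun_prop) hs.ne')
    (by
      rcases le_total 1 t₁ with h | h
      · have : 0 ≤ t₁ - 1 := by linarith
        have : 0 ≤ t₂ - 1 := by linarith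
        gcongr
      · rcases le_total 1 t₂ with h' | h'
        · have e1 : κ * (t₁ - 1) * Real.sqrt (2 * t₁ + 1) ≤ 0 :=
            mul_nonpos_of_nonpos_of_nonneg (mul_nonpos_of_nonneg_of_nonpos hκ0.le (by linarith))
              (Real.sqrt_nonneg _)
          have : 0 ≤ t₂ - 1 := by linarith
          have : 0 ≤ κ * (t₂ - 1) * Real.sqrt (2 * t₂ + 1) := by positivity
          linarith
        · have hq : ∀ t : ℝ, 0 < t → t ≤ 1 → κ * (t - 1) * Real.sqrt (2 * t + 1) =
              -(κ * Real.sqrt ((1 - t) ^ 2 * (2 * t + 1))) := by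
            intro t ht h
            rw [Real.sqrt_mul (by positivity), Real.sqrt_sq (by linarith)]
            ring
          rw [hq t₁ h1 h, hq t₂ (h1.trans_le h12) h']
          apply neg_le_neg
          gcongr κ * Real.sqrt ?_
          nlinarith [mul_nonneg (sub_nonneg.2 h12) (mul_nonneg h1.le (sub_nonneg.2 h)),
            mul_nonneg (sub_nonneg.2 h12) (mul_nonneg (h1.le.trans h12) (sub_nonneg.2 h')),
            mul_nonneg (sub_nonneg.2 h12) (mul_nonneg (h1.le.trans h12) (sub_nonneg.2 h)),
            mul_nonneg (sub_nonneg.2 h12) (mul_nonneg (h1.le) (sub_nonneg.2 h'))])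
    (fun t ht => by
      have ht0 := hpos t ht
      have hl : HasDerivAt (fun t : ℝ => 2 * t + 1) 2 t := by
        simpa using ((hasDerivAt_id t).const_mul 2).add_const 1
      have h2 : HasDerivAt (fun t : ℝ => 1 + 2 / (2 * t + 1)) (-(2 * 2) / (2 * t + 1) ^ 2) t := by
        refine (((hasDerivAt_const t (2 : ℝ)).fun_div hl (by positivity)).const_add 1).congr_deriv ?_
        ring
      exact ((h2.mul ((hDd t ht0).inv (by linarith [hD1 t ht0]))).mul_const _))
    (Or.inr fun t ht => by
      have ht0 := hpos t ht
      have e1 := hD1 t ht0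
      have e0 := hD0 t ht0
      have : 0 ≤ (2 * 2) / (2 * t + 1) ^ 2 * (D t)⁻¹ := by positivity
      have : 0 ≤ (1 + 2 / (2 * t + 1)) * (D' t / D t ^ 2) := by positivity
      apply mul_nonpos_of_nonpos_of_nonneg _ (by positivity)
      rw [neg_div, neg_div, neg_mul, mul_neg]
      linarith)
    (fun t ht => by
      have ht0 := hpos t ht
      have e1 := hD1 t ht0
      refine ⟨by positivity, ?_⟩
      have e2 : (D t)⁻¹ ≤ 1 := inv_le_one_of_one_le₀ e1
      have e3 : 2 / (2 * t + 1) ≤ 2 := by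
        rw [div_le_iff₀ (by positivity)]
        linarith
      calc (1 + 2 / (2 * t + 1)) * (D t)⁻¹ * (1 / (3 * X)) ≤ (1 + 2) * 1 * (1 / (3 * X)) := by
            gcongr
        _ = 1 / X := by field_simp; norm_num)
  have hI : (∫ t in t₁..t₂, ((t * Real.sqrt t : ℝ) : ℂ) *
        unitExp (X / 2 * (t - 1) ^ 2 * (2 * t + 1))) =
      ∫ t in t₁..t₂, ((1 / (Real.sqrt 3 * κ) * (κ * (3 * t) / Real.sqrt (2 * t + 1)) +
        (1 + 2 / (2 * t + 1)) * (D t)⁻¹ * (1 / (3 * X)) *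
        (2 * (κ * (t - 1) * Real.sqrt (2 * t + 1)) * (κ * (3 * t) / Real.sqrt (2 * t + 1))) : ℝ) :
          ℂ) * unitExp ((κ * (t - 1) * Real.sqrt (2 * t + 1)) ^ 2) := by
    apply intervalIntegral.integral_congr
    intro t ht
    rw [Set.uIcc_of_le h12] at ht
    have ht0 := hpos t ht
    have hs : 0 < Real.sqrt (2 * t + 1) := Real.sqrt_pos.2 (by positivity)
    have e2 := Real.sq_sqrt (by positivity : 0 ≤ 2 * t + 1)
    have e1 := Real.sq_sqrt ht0.le
    simp only
    congr 2
    · have e3 : 2 * (κ * (t - 1) * Real.sqrt (2 * t + 1)) * (κ * (3 * t) / Real.sqrt (2 * t + 1)) =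
          3 * X * (t * (t - 1)) := by
        field_simp
        linear_combination 2 * (t - 1) * hκ2
      have e4 : 1 / (Real.sqrt 3 * κ) * (κ * (3 * t) / Real.sqrt (2 * t + 1)) =
          t * (Real.sqrt 3 / Real.sqrt (2 * t + 1)) := by
        field_simp
        linear_combination - h3s
      have e5 : (1 + 2 / (2 * t + 1)) * (D t)⁻¹ * (t - 1) =
          Real.sqrt t - Real.sqrt 3 / Real.sqrt (2 * t + 1) := by
        have hDp : 0 < D t := by linarith [hD1 t ht0]
        have : (Real.sqrt t - Real.sqrt 3 / Real.sqrt (2 * t + 1)) * D t =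
            (1 + 2 / (2 * t + 1)) * (t - 1) := by
          simp only [hD]
          have : (Real.sqrt t - Real.sqrt 3 / Real.sqrt (2 * t + 1)) *
              (Real.sqrt t + Real.sqrt 3 / Real.sqrt (2 * t + 1)) =
              Real.sqrt t ^ 2 - Real.sqrt 3 ^ 2 / Real.sqrt (2 * t + 1) ^ 2 := by ring
          rw [this, e1, h3s, e2]
          field_simp
          ring
        rw [mul_right_comm, ← this]
        field_simp
      rw [e3, e4]
      have : (1 + 2 / (2 * t + 1)) * (D t)⁻¹ * (1 / (3 * X)) * (3 * X * (t * (t - 1))) =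
          t * ((1 + 2 / (2 * t + 1)) * (D t)⁻¹ * (t - 1)) := by
        field_simp
      rw [this, e5]
      ring
    · rw [mul_pow, mul_pow, hκ2, e2]
  have hif : (if t₁ < 1 ∧ 1 ≤ t₂ then unitExp (1 / 8) / Real.sqrt (3 * X) else 0 : ℂ) =
      if κ * (t₁ - 1) * Real.sqrt (2 * t₁ + 1) < 0 ∧ 0 ≤ κ * (t₂ - 1) * Real.sqrt (2 * t₂ + 1) then
        ((1 / (Real.sqrt 3 * κ) : ℝ) : ℂ) * (unitExp (1 / 8) / Real.sqrt 2) else 0 := by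
    have s1 : 0 < Real.sqrt (2 * t₁ + 1) := Real.sqrt_pos.2 (by positivity)
    have s2 : 0 < Real.sqrt (2 * t₂ + 1) := Real.sqrt_pos.2 (by linarith)
    have e1 : κ * (t₁ - 1) * Real.sqrt (2 * t₁ + 1) < 0 ↔ t₁ < 1 := by
      rw [mul_comm, mul_neg_iff_of_left_pos s1, mul_neg_iff_of_left_pos hκ0, sub_neg]
    have e2 : 0 ≤ κ * (t₂ - 1) * Real.sqrt (2 * t₂ + 1) ↔ 1 ≤ t₂ := by
      rw [mul_nonneg_iff_of_pos_right s2, mul_nonneg_iff_of_pos_left hκ0, sub_nonneg]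
    simp only [e1, e2]
    congr 1
    have : Real.sqrt (3 * X) = Real.sqrt 3 * (κ * Real.sqrt 2) := by
      rw [hκ, ← Real.sqrt_mul (by positivity), ← Real.sqrt_mul (by positivity)]
      congr 1
      ring
    rw [this]
    push_cast
    have : (κ : ℂ) ≠ 0 := by exact_mod_cast hκ0.ne'
    field_simp
  rw [hI, hif]
  refine key.trans ?_
  have h31 : 1 ≤ Real.sqrt 3 := Real.one_le_sqrt.2 (by norm_num)
  have ha : 1 / (Real.sqrt 3 * κ) * κ ≤ 1 := by
    have : 1 / (Real.sqrt 3 * κ) * κ = 1 / Real.sqrt 3 := by field_simp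
    rw [this, div_le_one h3]
    exact h31
  have hy : ∀ t : ℝ, 0 < t → κ * |t - 1| ≤ |κ * (t - 1) * Real.sqrt (2 * t + 1)| := by
    intro t ht
    rw [abs_mul, abs_mul, abs_of_pos hκ0, abs_of_nonneg (Real.sqrt_nonneg _)]
    have : 1 ≤ Real.sqrt (2 * t + 1) := Real.one_le_sqrt.2 (by linarith)
    exact le_mul_of_one_le_right (by positivity) this
  have e1 := stationary_error_le hX hκ ha (hy t₁ h1)
  have e2 := stationary_error_le hX hκ ha (hy t₂ (h1.trans_le h12))
  have : 0 < 1 / X := by positivity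
  nlinarith

lemma tendsto_integral_mul_unitExp {a b : ℝ} (hab : a ≤ b) (h : ℝ → ℂ) {w : ℕ → ℝ}
    (hw : Tendsto w atTop (cocompact ℝ)) :
    Tendsto (fun M => ∫ y in a..b, h y * unitExp (-(y * w M))) atTop (nhds 0) := by
  have h1 := (Real.tendsto_integral_exp_smul_cocompact ((Set.Ioc a b).indicator h)).comp hw
  refine h1.congr fun M => ?_
  simp only [Function.comp]
  rw [intervalIntegral.integral_of_le hab, ← integral_indicator measurableSet_Ioc]
  congr 1
  ext y
  by_cases hy : y ∈ Set.Ioc a b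
  · simp only [Set.indicator_of_mem hy]
    rw [Circle.smul_def, Real.fourierChar_apply, smul_eq_mul, mul_comm]
    unfold unitExp
    push_cast
    rfl
  · simp [Set.indicator_of_notMem hy]

lemma dirichlet_kernel_mul (M : ℕ) (y : ℝ) :
    (unitExp (y / 2) - unitExp (-(y / 2))) *
      (1 + ∑ ν ∈ Finset.Icc 1 M, (unitExp (-(ν * y)) + unitExp (ν * y))) =
    unitExp (-(y * (-(M + 1 / 2)))) - unitExp (-(y * (M + 1 / 2))) := by
  induction M with
  | zero =>
    simp only [Nat.cast_zero, zero_add, Finset.Icc_eq_empty_of_lt Nat.zero_lt_one,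
      Finset.sum_empty, add_zero, mul_one]
    congr 2 <;> ring
  | succ M ih =>
    rw [Finset.sum_Icc_succ_top (by omega), ← add_assoc, mul_add, ih]
    have e1 : unitExp (y / 2) * unitExp (-((M + 1 : ℕ) * y)) = unitExp (-(y * (M + 1 / 2))) := by
      rw [← unitExp_add]; congr 1; push_cast; ring
    have e2 : unitExp (y / 2) * unitExp ((M + 1 : ℕ) * y) =
        unitExp (-(y * (-((M + 1 : ℕ) + 1 / 2)))) := by
      rw [← unitExp_add]; congr 1; push_cast; ring
    have e3 : unitExp (-(y / 2)) * unitExp (-((M + 1 : ℕ) * y)) =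
        unitExp (-(y * ((M + 1 : ℕ) + 1 / 2))) := by
      rw [← unitExp_add]; congr 1; push_cast; ring
    have e4 : unitExp (-(y / 2)) * unitExp ((M + 1 : ℕ) * y) =
        unitExp (-(y * (-(M + 1 / 2)))) := by
      rw [← unitExp_add]; congr 1; push_cast; ring
    linear_combination e1 + e2 - e3 - e4

lemma unitExp_sub_eq_sinc (y : ℝ) :
    unitExp (y / 2) - unitExp (-(y / 2)) =
      2 * Real.pi * I * (y * (Real.sinc (Real.pi * y) : ℂ)) := by
  have h1 : Real.pi * y * Real.sinc (Real.pi * y) = Real.sin (Real.pi * y) := by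
    rcases eq_or_ne y 0 with rfl | hy
    · simp
    · rw [Real.sinc_of_ne_zero (mul_ne_zero Real.pi_ne_zero hy)]
      field_simp
  have h2 : (Real.pi * y * Real.sinc (Real.pi * y) : ℂ) = Complex.sin (Real.pi * y) := by
    exact_mod_cast congrArg Complex.ofReal h1
  have h3 : unitExp (y / 2) - unitExp (-(y / 2)) = 2 * I * Complex.sin (Real.pi * y) := by
    rw [Complex.sin]
    unfold unitExp
    have e1 : (((2 * Real.pi * (y / 2) : ℝ) : ℂ) * I) = Real.pi * y * I := by push_cast; ring
    have e2 : (((2 * Real.pi * (-(y / 2)) : ℝ) : ℂ) * I) = -(Real.pi * y) * I := by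
      push_cast; ring
    rw [e1, e2]
    linear_combination (cexp (Real.pi * y * I) - cexp (-(Real.pi * y) * I)) * Complex.I_mul_I
  rw [h3, ← h2]
  ring

lemma sinc_pi_mul_pos {y : ℝ} (hy : y ∈ Set.Icc (-(1 / 2) : ℝ) (1 / 2)) :
    0 < Real.sinc (Real.pi * y) := by
  have key : ∀ y : ℝ, 0 < y → y ≤ 1 / 2 → 0 < Real.sinc (Real.pi * y) := by
    intro y h0 h1
    have hp := Real.pi_pos
    rw [Real.sinc_of_ne_zero (by positivity)]
    apply div_pos (Real.sin_pos_of_pos_of_lt_pi (by positivity) (by nlinarith)) (by positivity)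
  rcases lt_trichotomy y 0 with h | h | h
  · rw [← Real.sinc_neg, ← mul_neg]
    exact key _ (by linarith) (by linarith [hy.1])
  · simp [h]
  · exact key _ h hy.2

lemma integral_unitExp_mul_unit (n : ℤ) (hn : n ≠ 0) :
    ∫ y in (-(1 / 2) : ℝ)..(1 / 2), unitExp (n * y) = 0 := by
  have hn' : (2 * Real.pi * I * n : ℂ) ≠ 0 := mul_ne_zero two_pi_I_ne (by exact_mod_cast hn)
  have h := integral_exp_mul_complex (a := -(1 / 2)) (b := 1 / 2) hn'
  have e : ∀ y : ℝ, unitExp (n * y) = cexp (2 * Real.pi * I * n * y) := by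
    intro y
    unfold unitExp
    congr 1
    push_cast
    ring
  simp_rw [e, h]
  rw [← e, ← e]
  have : (n * (1 / 2) : ℝ) = n + n * (-(1 / 2)) := by ring
  rw [this, unitExp_add, unitExp_int]
  simp

/-- Convergence of the symmetric partial sums of a Fourier series at the centre of the period. -/
lemma tendsto_dirichlet_integral {F : ℝ → ℂ}
    (hF : ContinuousOn F (Set.Icc (-(1 / 2)) (1 / 2))) (hd : DifferentiableAt ℝ F 0) :
    Tendsto (fun M : ℕ => ∫ y in (-(1 / 2) : ℝ)..(1 / 2),
      F y * (1 + ∑ ν ∈ Finset.Icc 1 M, (unitExp (-(ν * y)) + unitExp (ν * y)))) atTop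
      (nhds (F 0)) := by
  have hle : (-(1 / 2) : ℝ) ≤ 1 / 2 := by norm_num
  have hu : Set.uIcc (-(1 / 2) : ℝ) (1 / 2) = Set.Icc (-(1 / 2)) (1 / 2) := Set.uIcc_of_le hle
  set h : ℝ → ℂ := fun y => dslope F 0 y / (2 * Real.pi * I * (Real.sinc (Real.pi * y) : ℂ)) with hh
  have hds : ContinuousOn (dslope F 0) (Set.Icc (-(1 / 2)) (1 / 2)) :=
    (continuousOn_dslope (Icc_mem_nhds (by norm_num) (by norm_num))).2 ⟨hF, hd⟩
  have hden : ∀ y ∈ Set.Icc (-(1 / 2) : ℝ) (1 / 2),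
      (2 * Real.pi * I * (Real.sinc (Real.pi * y) : ℂ)) ≠ 0 := fun y hy =>
    mul_ne_zero two_pi_I_ne (by exact_mod_cast (sinc_pi_mul_pos hy).ne')
  have hhc : ContinuousOn h (Set.Icc (-(1 / 2)) (1 / 2)) := by
    refine hds.div ?_ hden
    have := Real.continuous_sinc
    fun_prop
  have hDc : ∀ M : ℕ, Continuous fun y : ℝ =>
      (1 + ∑ ν ∈ Finset.Icc 1 M, (unitExp (-(ν * y)) + unitExp (ν * y))) := by
    intro M
    have := continuous_unitExp
    fun_prop
  have hD1 : ∀ M : ℕ, ∫ y in (-(1 / 2) : ℝ)..(1 / 2),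
      (1 + ∑ ν ∈ Finset.Icc 1 M, (unitExp (-(ν * y)) + unitExp (ν * y))) = 1 := by
    intro M
    have hc := continuous_unitExp
    rw [intervalIntegral.integral_add (by simp) (by
      apply Continuous.intervalIntegrable
      fun_prop), intervalIntegral.integral_finsetSum (fun i _ => by
      apply Continuous.intervalIntegrable
      fun_prop), Finset.sum_eq_zero]
    · norm_num
    · intro ν hν
      have hν0 : (ν : ℤ) ≠ 0 := by
        have := (Finset.mem_Icc.1 hν).1
        omega
      rw [intervalIntegral.integral_add (by
        apply Continuous.intervalIntegrable
        fun_prop) (by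
        apply Continuous.intervalIntegrable
        fun_prop)]
      have h1 := integral_unitExp_mul_unit ν hν0
      have h2 := integral_unitExp_mul_unit (-ν) (by simpa using hν0)
      push_cast at h1 h2
      simp only [neg_mul] at h2
      rw [h1, h2, add_zero]
  have hw1 : Tendsto (fun M : ℕ => -((M : ℝ) + 1 / 2)) atTop (cocompact ℝ) :=
    (tendsto_neg_atTop_atBot.comp
      (tendsto_atTop_add_const_right _ _ tendsto_natCast_atTop_atTop)).mono_right atBot_le_cocompact
  have hw2 : Tendsto (fun M : ℕ => ((M : ℝ) + 1 / 2)) atTop (cocompact ℝ) :=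
    (tendsto_atTop_add_const_right _ _ tendsto_natCast_atTop_atTop).mono_right atTop_le_cocompact
  have hlim := ((tendsto_integral_mul_unitExp hle h hw1).sub
    (tendsto_integral_mul_unitExp hle h hw2)).const_add (F 0)
  rw [sub_zero, add_zero] at hlim
  refine hlim.congr fun M => ?_
  have hc := continuous_unitExp
  rw [← intervalIntegral.integral_sub]
  · have e1 : ∫ y in (-(1 / 2) : ℝ)..(1 / 2),
        F y * (1 + ∑ ν ∈ Finset.Icc 1 M, (unitExp (-(ν * y)) + unitExp (ν * y))) =
        (∫ y in (-(1 / 2) : ℝ)..(1 / 2),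
          (F y - F 0) * (1 + ∑ ν ∈ Finset.Icc 1 M, (unitExp (-(ν * y)) + unitExp (ν * y)))) +
        F 0 * ∫ y in (-(1 / 2) : ℝ)..(1 / 2),
          (1 + ∑ ν ∈ Finset.Icc 1 M, (unitExp (-(ν * y)) + unitExp (ν * y))) := by
      rw [← intervalIntegral.integral_const_mul, ← intervalIntegral.integral_add]
      · congr 1
        ext y
        ring
      · apply ContinuousOn.intervalIntegrable
        rw [hu]
        exact (hF.sub continuousOn_const).mul (hDc M).continuousOn
      · exact (continuous_const.mul (hDc M)).intervalIntegrable _ _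
    rw [e1, hD1, mul_one, add_comm]
    congr 1
    apply intervalIntegral.integral_congr
    intro y hy
    rw [hu] at hy
    have hne : (Real.sinc (Real.pi * y) : ℂ) ≠ 0 := by exact_mod_cast (sinc_pi_mul_pos hy).ne'
    have hk := dirichlet_kernel_mul M y
    rw [unitExp_sub_eq_sinc] at hk
    have hs := sub_smul_dslope F 0 y
    rw [sub_zero, Complex.real_smul] at hs
    simp only
    rw [← mul_sub, ← hk, ← hs, hh]
    field_simp
  · apply ContinuousOn.intervalIntegrable
    rw [hu]
    exact hhc.mul (by fun_prop)
  · apply ContinuousOn.intervalIntegrable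
    rw [hu]
    exact hhc.mul (by fun_prop)

/-- Poisson summation over half-integer endpoints, with symmetric partial sums. -/
lemma tendsto_poisson_sum {F F' : ℝ → ℂ} {p q : ℕ} (hpq : p ≤ q)
    (hF : ∀ x ∈ Set.Icc ((p : ℝ) + 1 / 2) (q + 1 / 2), HasDerivAt F (F' x) x) :
    Tendsto (fun M : ℕ => ∫ x in ((p : ℝ) + 1 / 2)..(q + 1 / 2),
      F x * (1 + ∑ ν ∈ Finset.Icc 1 M, (unitExp (-(ν * x)) + unitExp (ν * x)))) atTop
      (nhds (∑ n ∈ Finset.Ioc p q, F n)) := by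
  have hc := continuous_unitExp
  have hDc : ∀ M : ℕ, Continuous fun y : ℝ =>
      (1 + ∑ ν ∈ Finset.Icc 1 M, (unitExp (-(ν * y)) + unitExp (ν * y))) := by
    intro M
    fun_prop
  induction q, hpq using Nat.le_induction with
  | base => simp
  | succ q hpq ih =>
    have hpq' : (p : ℝ) ≤ q := by exact_mod_cast hpq
    have hFc : ContinuousOn F (Set.Icc ((p : ℝ) + 1 / 2) ((q + 1 : ℕ) + 1 / 2)) := fun x hx =>
      (hF x hx).continuousAt.continuousWithinAt
    have h1 := ih (fun x hx => hF x ⟨hx.1, hx.2.trans (by push_cast; linarith)⟩)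
    have hmem : ∀ y : ℝ, y ∈ Set.Icc (-(1 / 2) : ℝ) (1 / 2) →
        y + (q + 1 : ℕ) ∈ Set.Icc ((p : ℝ) + 1 / 2) ((q + 1 : ℕ) + 1 / 2) := by
      intro y hy
      push_cast
      exact ⟨by linarith [hy.1], by linarith [hy.2]⟩
    have h2 := tendsto_dirichlet_integral (F := fun y => F (y + (q + 1 : ℕ)))
      (hFc.comp (by fun_prop) hmem)
      (by
        have := hF ((q + 1 : ℕ) : ℝ) (by push_cast; exact ⟨by linarith, by linarith⟩)
        have h' : HasDerivAt F (F' ((q + 1 : ℕ) : ℝ)) (0 + ((q + 1 : ℕ) : ℝ)) := by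
          simpa using this
        exact (h'.comp_add_const 0 _).differentiableAt)
    rw [Finset.sum_Ioc_succ_top hpq]
    refine (h1.add (by simpa only [zero_add] using h2)).congr fun M => ?_
    have e : ∫ y in (-(1 / 2) : ℝ)..(1 / 2), F (y + (q + 1 : ℕ)) *
        (1 + ∑ ν ∈ Finset.Icc 1 M, (unitExp (-(ν * y)) + unitExp (ν * y))) =
        ∫ x in ((q : ℝ) + 1 / 2)..((q + 1 : ℕ) + 1 / 2), F x *
        (1 + ∑ ν ∈ Finset.Icc 1 M, (unitExp (-(ν * x)) + unitExp (ν * x))) := by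
      have := intervalIntegral.integral_comp_add_right (a := -(1 / 2)) (b := 1 / 2)
        (fun x : ℝ => F x *
          (1 + ∑ ν ∈ Finset.Icc 1 M, (unitExp (-(ν * x)) + unitExp (ν * x)))) ((q + 1 : ℕ) : ℝ)
      have e3 : (-(1 / 2) : ℝ) + (q + 1 : ℕ) = q + 1 / 2 := by push_cast; ring
      rw [e3, add_comm (1 / 2 : ℝ)] at this
      rw [← this]
      apply intervalIntegral.integral_congr
      intro y _
      simp only
      congr 2
      apply Finset.sum_congr rfl
      intro ν _
      have p1 : unitExp (ν * (y + (q + 1 : ℕ))) = unitExp (ν * y) := by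
        rw [mul_add, unitExp_add]
        have := unitExp_int (ν * (q + 1 : ℕ))
        push_cast at this ⊢
        rw [this, mul_one]
      have p2 : unitExp (-(ν * (y + (q + 1 : ℕ)))) = unitExp (-(ν * y)) := by
        rw [← unitExp_conj, p1, unitExp_conj]
      rw [p1, p2]
    rw [e, intervalIntegral.integral_add_adjacent_intervals]
    · apply ContinuousOn.intervalIntegrable
      rw [Set.uIcc_of_le (by linarith)]
      exact (hFc.mono (Set.Icc_subset_Icc_right (by push_cast; linarith))).mul (hDc M).continuousOn
    · apply ContinuousOn.intervalIntegrable
      rw [Set.uIcc_of_le (by push_cast; linarith)]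
      exact (hFc.mono (Set.Icc_subset_Icc_left (by linarith))).mul (hDc M).continuousOn

lemma norm_sum_unitExp_le (V : ℕ) {x : ℝ} (hx : x ∈ Set.Icc (0 : ℝ) 1) :
    ‖∑ ν ∈ Finset.range (V + 1), unitExp (-(ν * x))‖ ≤
      2 / (1 / ((V : ℝ) + 1) + x) + 2 / (1 / ((V : ℝ) + 1) + (1 - x)) := by
  set S := ‖∑ ν ∈ Finset.range (V + 1), unitExp (-(ν * x))‖ with hS
  have hV : (0 : ℝ) < (V : ℝ) + 1 := by positivity
  set δ : ℝ := 1 / ((V : ℝ) + 1) with hδ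
  have hδ0 : 0 < δ := by positivity
  have hS0 : 0 ≤ S := norm_nonneg _
  have h1 : S * δ ≤ 1 := by
    have : S ≤ (V : ℝ) + 1 := by
      refine (norm_sum_le _ _).trans ?_
      simp [norm_unitExp]
    rw [hδ, mul_one_div, div_le_one hV]
    exact this
  have h2 : S * (2 * Real.sin (Real.pi * x)) ≤ 2 := by
    have hpow : ∀ ν : ℕ, unitExp (-(ν * x)) = unitExp (-x) ^ ν := by
      intro ν
      unfold unitExp
      rw [← Complex.exp_nat_mul]
      congr 1
      push_cast
      ring
    have hg := geom_sum_mul (unitExp (-x)) (V + 1)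
    simp_rw [← hpow] at hg
    have hn := congrArg norm hg
    rw [norm_mul, ← hS] at hn
    have h3 : ‖unitExp (-x) - 1‖ = 2 * Real.sin (Real.pi * x) := by
      unfold unitExp
      rw [mul_comm, Complex.norm_exp_I_mul_ofReal_sub_one]
      have : 2 * Real.pi * -x / 2 = -(Real.pi * x) := by ring
      rw [this, Real.sin_neg, mul_neg, norm_neg, Real.norm_eq_abs, abs_of_nonneg]
      have := Real.sin_nonneg_of_nonneg_of_le_pi (x := Real.pi * x)
        (mul_nonneg Real.pi_pos.le hx.1) (by nlinarith [Real.pi_pos, hx.2])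
      linarith
    rw [h3] at hn
    rw [hn]
    refine (norm_sub_le _ _).trans ?_
    rw [norm_unitExp, norm_one]
    norm_num
  have key : ∀ y : ℝ, 0 ≤ y → y ≤ 1 / 2 → Real.sin (Real.pi * y) = Real.sin (Real.pi * x) →
      S ≤ 2 / (δ + y) := by
    intro y h0 hy he
    have hj := Real.mul_le_sin (x := Real.pi * y) (by positivity) (by nlinarith [Real.pi_pos])
    have : 2 / Real.pi * (Real.pi * y) = 2 * y := by field_simp
    rw [this, he] at hj
    rw [le_div_iff₀ (by positivity)]
    nlinarith
  have p1 : 0 < 2 / (δ + x) := by have := hx.1; positivity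
  have p2 : 0 < 2 / (δ + (1 - x)) := by
    have : 0 ≤ 1 - x := by linarith [hx.2]
    positivity
  rcases le_total x (1 / 2) with h | h
  · linarith [key x hx.1 h rfl]
  · have := key (1 - x) (by linarith [hx.2]) (by linarith) (by
      rw [mul_sub, mul_one, Real.sin_pi_sub])
    linarith

lemma integral_two_div_add {δ : ℝ} (hδ : 0 < δ) :
    ∫ x in (0 : ℝ)..1, (2 / (δ + x) + 2 / (δ + (1 - x))) = 4 * Real.log ((δ + 1) / δ) := by
  have hc : ∀ x ∈ Set.Icc (0 : ℝ) 1, HasDerivAt (fun x => 2 * Real.log (δ + x) -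
      2 * Real.log (δ + (1 - x))) (2 / (δ + x) + 2 / (δ + (1 - x))) x := by
    intro x hx
    have h1 : 0 < δ + x := by linarith [hx.1]
    have h2 : 0 < δ + (1 - x) := by linarith [hx.2]
    have d1 := (((hasDerivAt_id' x).const_add δ).log h1.ne').const_mul 2
    have d2 := ((((hasDerivAt_id' x).const_sub 1).const_add δ).log h2.ne').const_mul 2
    refine (d1.fun_sub d2).congr_deriv ?_
    ring
  rw [intervalIntegral.integral_eq_sub_of_hasDerivAt
    (f := fun x => 2 * Real.log (δ + x) - 2 * Real.log (δ + (1 - x)))]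
  · simp only [add_zero, sub_zero, sub_self]
    rw [Real.log_div (by linarith) hδ.ne']
    ring
  · rw [Set.uIcc_of_le zero_le_one]
    exact hc
  · apply ContinuousOn.intervalIntegrable
    rw [Set.uIcc_of_le zero_le_one]
    intro x hx
    have h1 : 0 < δ + x := by linarith [hx.1]
    have h2 : 0 < δ + (1 - x) := by linarith [hx.2]
    apply ContinuousAt.continuousWithinAt
    exact (continuousAt_const.div (by fun_prop) h1.ne').add
      (continuousAt_const.div (by fun_prop) h2.ne')

lemma norm_sum_integral_short_le {F : ℝ → ℂ} {G x₁ x₂ : ℝ} {n : ℕ} (V : ℕ) (h1 : (n : ℝ) ≤ x₁)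
    (h12 : x₁ ≤ x₂) (h2 : x₂ ≤ n + 1) (hF : ContinuousOn F (Set.Icc x₁ x₂))
    (hG : ∀ x ∈ Set.Icc x₁ x₂, ‖F x‖ ≤ G) :
    ‖∑ ν ∈ Finset.range (V + 1), ∫ x in x₁..x₂, F x * unitExp (-(ν * x))‖ ≤
      4 * G * Real.log (V + 2) := by
  have hG0 : 0 ≤ G := (norm_nonneg _).trans (hG x₁ ⟨le_rfl, h12⟩)
  have hcu := continuous_unitExp
  have hu : Set.uIcc x₁ x₂ = Set.Icc x₁ x₂ := Set.uIcc_of_le h12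
  set δ : ℝ := 1 / ((V : ℝ) + 1) with hδ
  have hδ0 : 0 < δ := by positivity
  rw [← intervalIntegral.integral_finsetSum (fun ν _ => by
    apply ContinuousOn.intervalIntegrable
    rw [hu]
    exact hF.mul (by fun_prop))]
  simp_rw [← Finset.mul_sum]
  have hper : ∀ (ν : ℕ) (x : ℝ), unitExp (-(ν * x)) = unitExp (-(ν * (x - n))) := by
    intro ν x
    have : -(ν * x) = -(ν * (x - n)) + (-(ν * n : ℤ) : ℤ) := by push_cast; ring
    rw [this, unitExp_add, unitExp_int, mul_one]
  set K : ℝ → ℝ := fun x => 2 / (δ + x) + 2 / (δ + (1 - x)) with hK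
  have hKc : ContinuousOn (fun x => K (x - n)) (Set.Icc (n : ℝ) (n + 1)) := by
    intro x hx
    have h1 : 0 < δ + (x - n) := by linarith [hx.1]
    have h2 : 0 < δ + (1 - (x - n)) := by linarith [hx.2]
    have c1 : ContinuousAt (fun x : ℝ => δ + (x - n)) x := by fun_prop
    have c2 : ContinuousAt (fun x : ℝ => δ + (1 - (x - n))) x := by fun_prop
    apply ContinuousAt.continuousWithinAt
    exact (continuousAt_const.div c1 h1.ne').add (continuousAt_const.div c2 h2.ne')
  have hK0 : ∀ x ∈ Set.Icc (n : ℝ) (n + 1), 0 ≤ K (x - n) := by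
    intro x hx
    have h1 : 0 < δ + (x - n) := by linarith [hx.1]
    have h2 : 0 < δ + (1 - (x - n)) := by linarith [hx.2]
    simp only [hK]
    positivity
  have hsub : Set.Icc x₁ x₂ ⊆ Set.Icc (n : ℝ) (n + 1) := Set.Icc_subset_Icc h1 h2
  calc _ ≤ ∫ x in x₁..x₂, G * K (x - n) := by
        apply intervalIntegral.norm_integral_le_of_norm_le h12
        · refine ae_of_all _ fun x hx => ?_
          have hx' : x ∈ Set.Icc x₁ x₂ := ⟨hx.1.le, hx.2⟩
          have hx'' := hsub hx'
          rw [norm_mul]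
          apply mul_le_mul (hG x hx') _ (norm_nonneg _) hG0
          simp_rw [fun ν : ℕ => hper ν x]
          exact norm_sum_unitExp_le V ⟨by linarith [hx''.1], by linarith [hx''.2]⟩
        · apply ContinuousOn.intervalIntegrable
          rw [hu]
          exact continuousOn_const.mul (hKc.mono hsub)
    _ ≤ ∫ x in (n : ℝ)..(n + 1), G * K (x - n) := by
        apply intervalIntegral.integral_mono_interval h1 h12 h2
        · refine (ae_restrict_iff' measurableSet_Ioc).2 (ae_of_all _ fun x hx => ?_)
          exact mul_nonneg hG0 (hK0 x ⟨hx.1.le, hx.2⟩)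
        · apply ContinuousOn.intervalIntegrable
          rw [Set.uIcc_of_le (by linarith)]
          exact continuousOn_const.mul hKc
    _ = 4 * G * Real.log (V + 2) := by
        rw [intervalIntegral.integral_const_mul, intervalIntegral.integral_comp_sub_right K,
          sub_self, add_sub_cancel_left, integral_two_div_add hδ0]
        have : (δ + 1) / δ = V + 2 := by
          rw [hδ]
          field_simp
          ring
        rw [this]
        ring

/-- A real function of constant sign on a closed interval. -/
def ConstSignOn (h : ℝ → ℝ) (a b : ℝ) : Prop :=
  (∀ x ∈ Set.Icc a b, 0 ≤ h x) ∨ (∀ x ∈ Set.Icc a b, h x ≤ 0)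

/-- Regularity of an amplitude `g` and a phase `f` under which the sum of `g(n) e(f(n))` is
approximated by the integrals in a truncated Poisson formula. -/
structure AmplitudePhase (g g' g'' f f' f'' : ℝ → ℝ) (G V a b : ℝ) : Prop where
  deriv_g : ∀ x ∈ Set.Icc a b, HasDerivAt g (g' x) x
  deriv_g' : ∀ x ∈ Set.Icc a b, HasDerivAt g' (g'' x) x
  deriv_f : ∀ x ∈ Set.Icc a b, HasDerivAt f (f' x) x
  deriv_f' : ∀ x ∈ Set.Icc a b, HasDerivAt f' (f'' x) x
  cont_g'' : ContinuousOn g'' (Set.Icc a b)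
  cont_f'' : ContinuousOn f'' (Set.Icc a b)
  sign_g' : ConstSignOn g' a b
  sign_g'' : ConstSignOn g'' a b
  sign_f'' : ConstSignOn f'' a b
  bound_g : ∀ x ∈ Set.Icc a b, |g x| ≤ G
  bound_g' : ∀ x ∈ Set.Icc a b, |g' x| ≤ G
  bound_f' : ∀ x ∈ Set.Icc a b, 0 ≤ f' x ∧ f' x ≤ V / 2

namespace AmplitudePhase

variable {g g' g'' f f' f'' : ℝ → ℝ} {G V a b : ℝ}

lemma mono (h : AmplitudePhase g g' g'' f f' f'' G V a b) {a' b' : ℝ} (ha : a ≤ a') (hb : b' ≤ b) :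
    AmplitudePhase g g' g'' f f' f'' G V a' b' := by
  have hs : Set.Icc a' b' ⊆ Set.Icc a b := Set.Icc_subset_Icc ha hb
  have hc : ∀ {u : ℝ → ℝ}, ConstSignOn u a b → ConstSignOn u a' b' := by
    intro u hu
    exact hu.imp (fun H x hx => H x (hs hx)) (fun H x hx => H x (hs hx))
  exact ⟨fun x hx => h.deriv_g x (hs hx), fun x hx => h.deriv_g' x (hs hx),
    fun x hx => h.deriv_f x (hs hx), fun x hx => h.deriv_f' x (hs hx), h.cont_g''.mono hs,
    h.cont_f''.mono hs, hc h.sign_g', hc h.sign_g'', hc h.sign_f'', fun x hx => h.bound_g x (hs hx),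
    fun x hx => h.bound_g' x (hs hx), fun x hx => h.bound_f' x (hs hx)⟩

lemma continuousOn_g (h : AmplitudePhase g g' g'' f f' f'' G V a b) :
    ContinuousOn g (Set.Icc a b) := fun x hx => (h.deriv_g x hx).continuousAt.continuousWithinAt

lemma continuousOn_g' (h : AmplitudePhase g g' g'' f f' f'' G V a b) :
    ContinuousOn g' (Set.Icc a b) := fun x hx => (h.deriv_g' x hx).continuousAt.continuousWithinAt

lemma continuousOn_f (h : AmplitudePhase g g' g'' f f' f'' G V a b) :
    ContinuousOn f (Set.Icc a b) := fun x hx => (h.deriv_f x hx).continuousAt.continuousWithinAt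

lemma continuousOn_f' (h : AmplitudePhase g g' g'' f f' f'' G V a b) :
    ContinuousOn f' (Set.Icc a b) := fun x hx => (h.deriv_f' x hx).continuousAt.continuousWithinAt

lemma integral_abs_g' (h : AmplitudePhase g g' g'' f f' f'' G V a b) (hab : a ≤ b) :
    ∫ x in a..b, |g' x| ≤ 2 * G := by
  rw [(intervalIntegrable_and_integral_abs_deriv hab h.deriv_g h.sign_g').2]
  have h1 := h.bound_g a ⟨le_rfl, hab⟩
  have h2 := h.bound_g b ⟨hab, le_rfl⟩
  exact (abs_sub _ _).trans (by linarith)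

lemma integral_abs_g'' (h : AmplitudePhase g g' g'' f f' f'' G V a b) (hab : a ≤ b) :
    ∫ x in a..b, |g'' x| ≤ 2 * G := by
  rw [(intervalIntegrable_and_integral_abs_deriv hab h.deriv_g' h.sign_g'').2]
  have h1 := h.bound_g' a ⟨le_rfl, hab⟩
  have h2 := h.bound_g' b ⟨hab, le_rfl⟩
  exact (abs_sub _ _).trans (by linarith)

lemma integral_abs_f'' (h : AmplitudePhase g g' g'' f f' f'' G V a b) (hab : a ≤ b) :
    ∫ x in a..b, |f'' x| ≤ V / 2 := by
  rw [(intervalIntegrable_and_integral_abs_deriv hab h.deriv_f' h.sign_f'').2]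
  have h1 := h.bound_f' a ⟨le_rfl, hab⟩
  have h2 := h.bound_f' b ⟨hab, le_rfl⟩
  rw [abs_le]
  constructor <;> linarith

lemma deriv_shift (h : AmplitudePhase g g' g'' f f' f'' G V a b) (c : ℝ) :
    ∀ x ∈ Set.Icc a b, HasDerivAt (fun x => f x + c * x) (f' x + c) x := by
  intro x hx
  refine ((h.deriv_f x hx).fun_add ((hasDerivAt_id' x).const_mul c)).congr_deriv ?_
  ring

lemma deriv_quot (h : AmplitudePhase g g' g'' f f' f'' G V a b) {c : ℝ}
    (hc : ∀ x ∈ Set.Icc a b, f' x + c ≠ 0) :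
    ∀ x ∈ Set.Icc a b, HasDerivAt (fun x => g x / (f' x + c))
      (g' x / (f' x + c) - g x * f'' x / (f' x + c) ^ 2) x := by
  intro x hx
  have := hc x hx
  refine ((h.deriv_g x hx).fun_div ((h.deriv_f' x hx).add_const c) this).congr_deriv ?_
  field_simp

lemma continuousOn_quot_deriv (h : AmplitudePhase g g' g'' f f' f'' G V a b) {c : ℝ}
    (hc : ∀ x ∈ Set.Icc a b, f' x + c ≠ 0) :
    ContinuousOn (fun x => g' x / (f' x + c)) (Set.Icc a b) ∧
    ContinuousOn (fun x => g x * f'' x / (f' x + c) ^ 2) (Set.Icc a b) := by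
  have h1 := h.continuousOn_f'.add (continuousOn_const (c := c))
  exact ⟨h.continuousOn_g'.div h1 hc, (h.continuousOn_g.mul h.cont_f'').div (h1.pow 2)
    (fun x hx => pow_ne_zero 2 (hc x hx))⟩

/-- The term left over after one integration by parts. -/
lemma norm_integral_quot_deriv_le (h : AmplitudePhase g g' g'' f f' f'' G V a b) (hab : a ≤ b)
    {c ρ : ℝ} (hρ : 0 < ρ) (hc : ∀ x ∈ Set.Icc a b, ρ ≤ |f' x + c|) :
    ‖∫ x in a..b, ((g' x / (f' x + c) - g x * f'' x / (f' x + c) ^ 2 : ℝ) : ℂ) *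
      unitExp (f x + c * x)‖ ≤ 3 * G / ρ ^ 2 + G * V / ρ ^ 3 + G * V / (2 * ρ ^ 2) := by
  have hu : Set.uIcc a b = Set.Icc a b := Set.uIcc_of_le hab
  have hc0 : ∀ x ∈ Set.Icc a b, f' x + c ≠ 0 := fun x hx h0 => by
    have := hc x hx
    rw [h0, abs_zero] at this
    linarith
  have hG : 0 ≤ G := (abs_nonneg _).trans (h.bound_g a ⟨le_rfl, hab⟩)
  obtain ⟨c1, c2⟩ := h.continuousOn_quot_deriv hc0
  have ce : ContinuousOn (fun x => unitExp (f x + c * x)) (Set.Icc a b) :=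
    continuous_unitExp.comp_continuousOn (h.continuousOn_f.add (by fun_prop))
  have hsq : ∀ x ∈ Set.Icc a b, ρ ^ 2 ≤ (f' x + c) ^ 2 := by
    intro x hx
    rw [← sq_abs (f' x + c)]
    exact pow_le_pow_left₀ hρ.le (hc x hx) 2
  have hcub : ∀ x ∈ Set.Icc a b, ρ ^ 3 ≤ |f' x + c| ^ 3 :=
    fun x hx => pow_le_pow_left₀ hρ.le (hc x hx) 3
  have hf1 : IntervalIntegrable (fun x => |f'' x|) volume a b :=
    ContinuousOn.intervalIntegrable (by rw [hu]; exact h.cont_f''.abs)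
  have hg1 : IntervalIntegrable (fun x => |g'' x|) volume a b :=
    ContinuousOn.intervalIntegrable (by rw [hu]; exact h.cont_g''.abs)
  have split : ∫ x in a..b, ((g' x / (f' x + c) - g x * f'' x / (f' x + c) ^ 2 : ℝ) : ℂ) *
      unitExp (f x + c * x) =
      (∫ x in a..b, ((g' x / (f' x + c) : ℝ) : ℂ) * unitExp (f x + c * x)) -
      ∫ x in a..b, ((g x * f'' x / (f' x + c) ^ 2 : ℝ) : ℂ) * unitExp (f x + c * x) := by
    rw [← intervalIntegral.integral_sub]
    · congr 1
      ext x
      push_cast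
      ring
    · apply ContinuousOn.intervalIntegrable
      rw [hu]
      exact (Complex.continuous_ofReal.comp_continuousOn c1).mul ce
    · apply ContinuousOn.intervalIntegrable
      rw [hu]
      exact (Complex.continuous_ofReal.comp_continuousOn c2).mul ce
  have second : ‖∫ x in a..b, ((g x * f'' x / (f' x + c) ^ 2 : ℝ) : ℂ) * unitExp (f x + c * x)‖ ≤
      G * V / (2 * ρ ^ 2) := by
    refine (norm_integral_mul_unitExp_le_integral_abs hab _ _).trans ?_
    calc _ ≤ ∫ x in a..b, G / ρ ^ 2 * |f'' x| := by
          apply intervalIntegral.integral_mono_on hab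
          · exact ContinuousOn.intervalIntegrable (by rw [hu]; exact c2.abs)
          · exact hf1.const_mul _
          · intro x hx
            rw [abs_div, abs_mul, abs_of_nonneg (sq_nonneg (f' x + c)), div_mul_eq_mul_div]
            have := h.bound_g x hx
            have := hsq x hx
            gcongr
      _ ≤ G / ρ ^ 2 * (V / 2) := by
          rw [intervalIntegral.integral_const_mul]
          have := h.integral_abs_f'' hab
          gcongr
      _ = _ := by field_simp
  have hr : ∀ x ∈ Set.Icc a b, HasDerivAt (fun x => g' x / (f' x + c) ^ 2)
      (g'' x / (f' x + c) ^ 2 - 2 * g' x * f'' x / (f' x + c) ^ 3) x := by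
    intro x hx
    have h0 := hc0 x hx
    refine ((h.deriv_g' x hx).fun_div (((h.deriv_f' x hx).add_const c).fun_pow 2)
      (pow_ne_zero 2 h0)).congr_deriv ?_
    field_simp
    ring
  have hc' := h.continuousOn_f'.add (continuousOn_const (c := c))
  have hrc : ContinuousOn (fun x => g'' x / (f' x + c) ^ 2 -
      2 * g' x * f'' x / (f' x + c) ^ 3) (Set.Icc a b) :=
    (h.cont_g''.div (hc'.pow 2) (fun x hx => pow_ne_zero 2 (hc0 x hx))).sub
      (((continuousOn_const.mul h.continuousOn_g').mul h.cont_f'').div (hc'.pow 3)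
        (fun x hx => pow_ne_zero 3 (hc0 x hx)))
  have first : ‖∫ x in a..b, ((g' x / (f' x + c) : ℝ) : ℂ) * unitExp (f x + c * x)‖ ≤
      3 * G / ρ ^ 2 + G * V / ρ ^ 3 := by
    have e : ∫ x in a..b, ((g' x / (f' x + c) : ℝ) : ℂ) * unitExp (f x + c * x) =
        ∫ x in a..b, ((g' x / (f' x + c) ^ 2 * (f' x + c) : ℝ) : ℂ) * unitExp (f x + c * x) := by
      apply intervalIntegral.integral_congr
      intro x hx
      rw [hu] at hx
      have h0 := hc0 x hx
      have : g' x / (f' x + c) ^ 2 * (f' x + c) = g' x / (f' x + c) := by field_simp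
      simp only [this]
    rw [e]
    refine (norm_integral_mul_unitExp_le hab hr (h.deriv_shift c)
      (ContinuousOn.intervalIntegrable (by rw [hu]; exact hrc)) hc' (B := G / ρ ^ 2)
      (D := 2 * G / ρ ^ 2 + G * V / ρ ^ 3) ?_ ?_).trans (le_of_eq (by ring))
    · intro x hx
      rw [abs_div, abs_of_nonneg (sq_nonneg (f' x + c))]
      have := h.bound_g' x hx
      have := hsq x hx
      gcongr
    · calc _ ≤ ∫ x in a..b, (1 / ρ ^ 2 * |g'' x| + 2 * G / ρ ^ 3 * |f'' x|) := by
            apply intervalIntegral.integral_mono_on hab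
            · exact ContinuousOn.intervalIntegrable (by rw [hu]; exact hrc.abs)
            · exact (hg1.const_mul _).add (hf1.const_mul _)
            · intro x hx
              refine (abs_sub _ _).trans ?_
              rw [abs_div, abs_div, abs_mul, abs_mul, abs_pow, abs_pow, sq_abs, abs_two,
                div_mul_eq_mul_div, div_mul_eq_mul_div, one_mul]
              have := h.bound_g' x hx
              have := hsq x hx
              have := hcub x hx
              gcongr
        _ ≤ 1 / ρ ^ 2 * (2 * G) + 2 * G / ρ ^ 3 * (V / 2) := by
            rw [intervalIntegral.integral_add (hg1.const_mul _) (hf1.const_mul _),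
              intervalIntegral.integral_const_mul, intervalIntegral.integral_const_mul]
            have := h.integral_abs_f'' hab
            have := h.integral_abs_g'' hab
            gcongr
        _ = _ := by field_simp
  rw [split]
  exact (norm_sub_le _ _).trans (by linarith)

end AmplitudePhase

namespace AmplitudePhase

variable {g g' g'' f f' f'' : ℝ → ℝ} {G V a b : ℝ}

/-- Frequencies far from the range of `f'`: the contributions of `ν` and `-ν` cancel at
half-integer endpoints. -/
lemma norm_integral_add_integral_le (h : AmplitudePhase g g' g'' f f' f'' G V a b) (hab : a ≤ b)
    {p q ν : ℕ} (ha : a = p + 1 / 2) (hb : b = q + 1 / 2) (hV : 1 ≤ V) (hν : V < ν) :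
    ‖(∫ x in a..b, (g x : ℂ) * unitExp (f x + (-(ν : ℝ)) * x)) +
      ∫ x in a..b, (g x : ℂ) * unitExp (f x + (ν : ℝ) * x)‖ ≤ 8 * G * V / (ν : ℝ) ^ 2 := by
  have hu : Set.uIcc a b = Set.Icc a b := Set.uIcc_of_le hab
  have hν0 : (0 : ℝ) < ν := by linarith
  have hG : 0 ≤ G := (abs_nonneg _).trans (h.bound_g a ⟨le_rfl, hab⟩)
  have hρ : (0 : ℝ) < ν / 2 := by positivity
  have hm : ∀ x ∈ Set.Icc a b, (ν / 2 : ℝ) ≤ |f' x + (-(ν : ℝ))| := by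
    intro x hx
    have := h.bound_f' x hx
    rw [abs_of_nonpos (by linarith)]
    linarith
  have hp : ∀ x ∈ Set.Icc a b, (ν / 2 : ℝ) ≤ |f' x + (ν : ℝ)| := by
    intro x hx
    have := h.bound_f' x hx
    rw [abs_of_nonneg (by linarith)]
    linarith
  have parts : ∀ c : ℝ, (∀ x ∈ Set.Icc a b, (ν / 2 : ℝ) ≤ |f' x + c|) →
      (∫ x in a..b, (g x : ℂ) * unitExp (f x + c * x)) =
      (((g b / (f' b + c) : ℝ) : ℂ) * unitExp (f b + c * b) -
        ((g a / (f' a + c) : ℝ) : ℂ) * unitExp (f a + c * a) -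
        ∫ x in a..b, ((g' x / (f' x + c) - g x * f'' x / (f' x + c) ^ 2 : ℝ) : ℂ) *
      unitExp (f x + c * x)) / (2 * Real.pi * I) := by
    intro c hc
    have hc0 : ∀ x ∈ Set.Icc a b, f' x + c ≠ 0 := fun x hx h0 => by
      have := hc x hx
      rw [h0, abs_zero] at this
      linarith
    obtain ⟨c1, c2⟩ := h.continuousOn_quot_deriv hc0
    rw [← integral_mul_unitExp_eq hab (h.deriv_quot hc0) (h.deriv_shift c)
      (ContinuousOn.intervalIntegrable (by rw [hu]; exact c1.sub c2))
      (h.continuousOn_f'.add continuousOn_const)]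
    apply intervalIntegral.integral_congr
    intro x hx
    rw [hu] at hx
    have h0 := hc0 x hx
    have : g x / (f' x + c) * (f' x + c) = g x := by field_simp
    simp only [this]
  have per : ∀ n : ℕ, unitExp (-(ν : ℝ) * (n + 1 / 2)) = unitExp ((ν : ℝ) * (n + 1 / 2)) := by
    intro n
    have : (ν : ℝ) * (n + 1 / 2) = -(ν : ℝ) * (n + 1 / 2) + ((ν * (2 * n + 1) : ℤ) : ℝ) := by
      push_cast
      ring
    rw [this, unitExp_add, unitExp_int, mul_one]
  have bd : ∀ x ∈ Set.Icc a b, unitExp (-(ν : ℝ) * x) = unitExp ((ν : ℝ) * x) →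
      ‖((g x / (f' x + -(ν : ℝ)) : ℝ) : ℂ) * unitExp (f x + -(ν : ℝ) * x) +
        ((g x / (f' x + (ν : ℝ)) : ℝ) : ℂ) * unitExp (f x + (ν : ℝ) * x)‖ ≤
        4 / 3 * G * V / (ν : ℝ) ^ 2 := by
    intro x hx he
    rw [unitExp_add, unitExp_add, he, ← add_mul, norm_mul, norm_mul, norm_unitExp, norm_unitExp,
      mul_one, mul_one, ← Complex.ofReal_add, Complex.norm_real, Real.norm_eq_abs]
    obtain ⟨f0, f1⟩ := h.bound_f' x hx
    have n1 : f' x + -(ν : ℝ) ≠ 0 := by linarith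
    have n2 : f' x + (ν : ℝ) ≠ 0 := by linarith
    have e : g x / (f' x + -(ν : ℝ)) + g x / (f' x + (ν : ℝ)) =
        -(g x * (2 * f' x) / ((ν : ℝ) ^ 2 - f' x ^ 2)) := by
      have n3 : (ν : ℝ) ^ 2 - f' x ^ 2 ≠ 0 := by nlinarith
      field_simp
      ring
    have hd : 3 / 4 * (ν : ℝ) ^ 2 ≤ (ν : ℝ) ^ 2 - f' x ^ 2 := by nlinarith
    have hd0 : 0 < 3 / 4 * (ν : ℝ) ^ 2 := by positivity
    rw [e, abs_neg, abs_div, abs_mul, abs_of_pos (hd0.trans_le hd), abs_of_nonneg (by linarith :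
      0 ≤ 2 * f' x)]
    calc _ ≤ G * V / (3 / 4 * (ν : ℝ) ^ 2) := by
          have := h.bound_g x hx
          have : 2 * f' x ≤ V := by linarith
          gcongr
      _ = _ := by field_simp
  have r1 := h.norm_integral_quot_deriv_le hab hρ hm
  have r2 := h.norm_integral_quot_deriv_le hab hρ hp
  have rr : 3 * G / (ν / 2 : ℝ) ^ 2 + G * V / (ν / 2 : ℝ) ^ 3 + G * V / (2 * (ν / 2 : ℝ) ^ 2) ≤
      22 * G * V / (ν : ℝ) ^ 2 := by
    have e : 3 * G / (ν / 2 : ℝ) ^ 2 + G * V / (ν / 2 : ℝ) ^ 3 + G * V / (2 * (ν / 2 : ℝ) ^ 2) =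
        (12 * G + 8 * G * (V / ν) + 2 * G * V) / (ν : ℝ) ^ 2 := by
      field_simp
      ring
    rw [e]
    have : V / ν ≤ 1 := (div_le_one hν0).2 hν.le
    have : G * (V / ν) ≤ G * V := by
      gcongr
      linarith
    have : G ≤ G * V := le_mul_of_one_le_right hG hV
    gcongr
    linarith
  have ba := bd a ⟨le_rfl, hab⟩ (by rw [ha]; exact per p)
  have bb := bd b ⟨hab, le_rfl⟩ (by rw [hb]; exact per q)
  rw [parts _ hm, parts _ hp, ← add_div, norm_div, norm_two_pi_I]
  set I1 := ∫ x in a..b, ((g' x / (f' x + (-(ν : ℝ))) -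
    g x * f'' x / (f' x + (-(ν : ℝ))) ^ 2 : ℝ) : ℂ) * unitExp (f x + (-(ν : ℝ)) * x)
  set I2 := ∫ x in a..b, ((g' x / (f' x + (ν : ℝ)) -
    g x * f'' x / (f' x + (ν : ℝ)) ^ 2 : ℝ) : ℂ) * unitExp (f x + (ν : ℝ) * x)
  set A1 := ((g a / (f' a + -(ν : ℝ)) : ℝ) : ℂ) * unitExp (f a + -(ν : ℝ) * a)
  set A2 := ((g a / (f' a + (ν : ℝ)) : ℝ) : ℂ) * unitExp (f a + (ν : ℝ) * a)
  set B1 := ((g b / (f' b + -(ν : ℝ)) : ℝ) : ℂ) * unitExp (f b + -(ν : ℝ) * b)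
  set B2 := ((g b / (f' b + (ν : ℝ)) : ℝ) : ℂ) * unitExp (f b + (ν : ℝ) * b)
  have e : B1 - A1 - I1 + (B2 - A2 - I2) = (B1 + B2) - (A1 + A2) - I1 - I2 := by ring
  rw [e, div_le_iff₀ (by positivity)]
  have t1 := norm_sub_le ((B1 + B2) - (A1 + A2) - I1) I2
  have t2 := norm_sub_le ((B1 + B2) - (A1 + A2)) I1
  have t3 := norm_sub_le (B1 + B2) (A1 + A2)
  set Q := G * V / (ν : ℝ) ^ 2 with hQ
  have hQ0 : 0 ≤ Q := by
    have : 0 ≤ V := by linarith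
    positivity
  have e1 : 4 / 3 * G * V / (ν : ℝ) ^ 2 = 4 / 3 * Q := by rw [hQ]; ring
  have e2 : 22 * G * V / (ν : ℝ) ^ 2 = 22 * Q := by rw [hQ]; ring
  have e3 : 8 * G * V / (ν : ℝ) ^ 2 = 8 * Q := by rw [hQ]; ring
  rw [e1] at ba bb
  rw [e2] at rr
  rw [e3]
  nlinarith [Real.pi_gt_three]

lemma norm_integral_pos_freq_le (h : AmplitudePhase g g' g'' f f' f'' G V a b) (hab : a ≤ b)
    {c : ℝ} (hc : 0 < c) :
    ‖∫ x in a..b, (g x : ℂ) * unitExp (f x + c * x)‖ ≤ 4 * G / c := by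
  have hu : Set.uIcc a b = Set.Icc a b := Set.uIcc_of_le hab
  have hG : 0 ≤ G := (abs_nonneg _).trans (h.bound_g a ⟨le_rfl, hab⟩)
  have hp : ∀ x ∈ Set.Icc a b, 0 < f' x + c := by
    intro x hx
    linarith [h.bound_f' x hx]
  have hc0 : ∀ x ∈ Set.Icc a b, f' x + c ≠ 0 := fun x hx => (hp x hx).ne'
  obtain ⟨c1, c2⟩ := h.continuousOn_quot_deriv hc0
  have e : ∫ x in a..b, (g x : ℂ) * unitExp (f x + c * x) =
      ∫ x in a..b, ((g x / (f' x + c) * (f' x + c) : ℝ) : ℂ) * unitExp (f x + c * x) := by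
    apply intervalIntegral.integral_congr
    intro x hx
    rw [hu] at hx
    have h0 := hc0 x hx
    have : g x / (f' x + c) * (f' x + c) = g x := by field_simp
    simp only [this]
  have hinv : ∀ x ∈ Set.Icc a b, HasDerivAt (fun x => (f' x + c)⁻¹) (-f'' x / (f' x + c) ^ 2) x :=
    fun x hx => ((h.deriv_f' x hx).add_const c).fun_inv (hc0 x hx)
  have hsign : (∀ x ∈ Set.Icc a b, 0 ≤ -f'' x / (f' x + c) ^ 2) ∨
      (∀ x ∈ Set.Icc a b, -f'' x / (f' x + c) ^ 2 ≤ 0) := by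
    rcases h.sign_f'' with H | H
    · exact Or.inr fun x hx => div_nonpos_of_nonpos_of_nonneg (by linarith [H x hx]) (sq_nonneg _)
    · exact Or.inl fun x hx => div_nonneg (by linarith [H x hx]) (sq_nonneg _)
  obtain ⟨i1, i2⟩ := intervalIntegrable_and_integral_abs_deriv hab hinv hsign
  have i3 : |(f' b + c)⁻¹ - (f' a + c)⁻¹| ≤ 1 / c := by
    have k : ∀ x ∈ Set.Icc a b, 0 ≤ (f' x + c)⁻¹ ∧ (f' x + c)⁻¹ ≤ 1 / c := by
      intro x hx
      refine ⟨(inv_pos.2 (hp x hx)).le, ?_⟩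
      rw [one_div]
      exact inv_anti₀ hc (by linarith [h.bound_f' x hx])
    have ka := k a ⟨le_rfl, hab⟩
    have kb := k b ⟨hab, le_rfl⟩
    rw [abs_le]
    constructor <;> linarith
  have hg1 : IntervalIntegrable (fun x => |g' x|) volume a b :=
    ContinuousOn.intervalIntegrable (by rw [hu]; exact h.continuousOn_g'.abs)
  rw [e]
  refine (norm_integral_mul_unitExp_le hab (h.deriv_quot hc0) (h.deriv_shift c)
    (ContinuousOn.intervalIntegrable (by rw [hu]; exact c1.sub c2))
    (h.continuousOn_f'.add continuousOn_const) (B := G / c) (D := 3 * G / c) ?_ ?_).trans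
    (le_of_eq (by ring))
  · intro x hx
    rw [abs_div, abs_of_pos (hp x hx)]
    have := h.bound_g x hx
    have := (h.bound_f' x hx).1
    gcongr
    linarith
  · calc _ ≤ ∫ x in a..b, (1 / c * |g' x| + G * |(-f'' x / (f' x + c) ^ 2)|) := by
          apply intervalIntegral.integral_mono_on hab
          · exact ContinuousOn.intervalIntegrable (by rw [hu]; exact (c1.sub c2).abs)
          · exact (hg1.const_mul _).add (i1.abs.const_mul _)
          · intro x hx
            refine (abs_sub _ _).trans ?_
            have e1 : |g' x / (f' x + c)| ≤ 1 / c * |g' x| := by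
              rw [abs_div, abs_of_pos (hp x hx), div_mul_eq_mul_div, one_mul]
              have := (h.bound_f' x hx).1
              gcongr
              linarith
            have e2 : |g x * f'' x / (f' x + c) ^ 2| ≤ G * |(-f'' x / (f' x + c) ^ 2)| := by
              rw [mul_div_assoc, abs_mul, neg_div, abs_neg]
              have := h.bound_g x hx
              gcongr
            linarith
      _ ≤ 1 / c * (2 * G) + G * (1 / c) := by
          rw [intervalIntegral.integral_add (hg1.const_mul _) (i1.abs.const_mul _),
            intervalIntegral.integral_const_mul, intervalIntegral.integral_const_mul, i2]
          have := h.integral_abs_g' hab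
          gcongr
      _ = _ := by field_simp; ring

end AmplitudePhase

lemma sum_Icc_inv_le_one_add_log (n : ℕ) :
    ∑ i ∈ Finset.Icc 1 n, (1 / (i : ℝ)) ≤ 1 + Real.log n := by
  have h := harmonic_le_one_add_log n
  rw [harmonic_eq_sum_Icc] at h
  push_cast at h
  simpa [one_div] using h

/-- Truncated Poisson summation between half-integers. -/
lemma AmplitudePhase.norm_sum_sub_integral_half_le {g g' g'' f f' f'' : ℝ → ℝ} {G : ℝ} {V p q : ℕ}
    (h : AmplitudePhase g g' g'' f f' f'' G V (p + 1 / 2) (q + 1 / 2)) (hpq : p ≤ q)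
    (hV : 1 ≤ V) :
    ‖∑ n ∈ Finset.Ioc p q, (g n : ℂ) * unitExp (f n) - ∑ ν ∈ Finset.range (V + 1),
      ∫ x in ((p : ℝ) + 1 / 2)..(q + 1 / 2), (g x : ℂ) * unitExp (f x) * unitExp (-(ν * x))‖ ≤
      16 * G * Real.log (V + 2) := by
  set a : ℝ := p + 1 / 2 with ha
  set b : ℝ := q + 1 / 2 with hb
  have hab : a ≤ b := by
    have : (p : ℝ) ≤ q := by exact_mod_cast hpq
    linarith
  have hu : Set.uIcc a b = Set.Icc a b := Set.uIcc_of_le hab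
  have hV' : (1 : ℝ) ≤ V := by exact_mod_cast hV
  have hG : 0 ≤ G := (abs_nonneg _).trans (h.bound_g a ⟨le_rfl, hab⟩)
  have hF : ∀ x ∈ Set.Icc a b, HasDerivAt (fun x => (g x : ℂ) * unitExp (f x))
      ((g' x : ℂ) * unitExp (f x) + g x * (2 * Real.pi * I * f' x * unitExp (f x))) x :=
    fun x hx => (h.deriv_g x hx).ofReal_comp.mul (hasDerivAt_unitExp (h.deriv_f x hx))
  have hFc : ContinuousOn (fun x => (g x : ℂ) * unitExp (f x)) (Set.Icc a b) :=
    fun x hx => (hF x hx).continuousAt.continuousWithinAt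
  have hcu := continuous_unitExp
  set T : ℝ → ℂ := fun c => ∫ x in a..b, (g x : ℂ) * unitExp (f x + c * x) with hT
  have hTi : ∀ c : ℝ, IntervalIntegrable (fun x => (g x : ℂ) * unitExp (f x + c * x)) volume a b := by
    intro c
    apply ContinuousOn.intervalIntegrable
    rw [hu]
    have : ContinuousOn (fun x => (g x : ℂ) * unitExp (f x) * unitExp (c * x)) (Set.Icc a b) :=
      hFc.mul (by fun_prop)
    refine this.congr fun x _ => ?_
    simp only [unitExp_add, mul_assoc]
  have e0 : ∑ ν ∈ Finset.range (V + 1), ∫ x in a..b,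
      (g x : ℂ) * unitExp (f x) * unitExp (-(ν * x)) =
      T 0 + ∑ ν ∈ Finset.Icc 1 V, T (-(ν : ℝ)) := by
    have : ∀ ν : ℕ, ∫ x in a..b, (g x : ℂ) * unitExp (f x) * unitExp (-(ν * x)) =
        T (-(ν : ℝ)) := by
      intro ν
      simp only [hT]
      congr 1
      ext x
      rw [unitExp_add, neg_mul, mul_assoc]
    simp_rw [this]
    rw [Finset.sum_range_succ', Nat.cast_zero, neg_zero, add_comm]
    congr 1
    rw [Finset.range_eq_Ico, Finset.sum_Ico_add' (fun ν : ℕ => T (-(ν : ℝ))) 0 V 1]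
    congr 1
  have e1 : ∀ M : ℕ, V ≤ M → ∫ x in a..b, (g x : ℂ) * unitExp (f x) *
      (1 + ∑ ν ∈ Finset.Icc 1 M, (unitExp (-(ν * x)) + unitExp (ν * x))) =
      (T 0 + ∑ ν ∈ Finset.Icc 1 V, T (-(ν : ℝ))) + (∑ ν ∈ Finset.Icc 1 V, T ν +
        ∑ ν ∈ Finset.Ioc V M, (T (-(ν : ℝ)) + T ν)) := by
    intro M hM
    have s1 : ∑ ν ∈ Finset.Icc 1 M, (T (-(ν : ℝ)) + T ν) =
        ∑ ν ∈ Finset.Icc 1 V, (T (-(ν : ℝ)) + T ν) +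
          ∑ ν ∈ Finset.Ioc V M, (T (-(ν : ℝ)) + T ν) := by
      have : ∀ n : ℕ, Finset.Icc 1 n = Finset.Ioc 0 n := fun n => rfl
      rw [this, this, Finset.sum_Ioc_consecutive _ (Nat.zero_le _) hM]
    have s2 : ∫ x in a..b, (g x : ℂ) * unitExp (f x) *
        (1 + ∑ ν ∈ Finset.Icc 1 M, (unitExp (-(ν * x)) + unitExp (ν * x))) =
        T 0 + ∑ ν ∈ Finset.Icc 1 M, (T (-(ν : ℝ)) + T ν) := by
      have : (fun x : ℝ => (g x : ℂ) * unitExp (f x) *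
          (1 + ∑ ν ∈ Finset.Icc 1 M, (unitExp (-(ν * x)) + unitExp (ν * x)))) =
          fun x : ℝ => (g x : ℂ) * unitExp (f x + 0 * x) + ∑ ν ∈ Finset.Icc 1 M,
            ((g x : ℂ) * unitExp (f x + (-(ν : ℝ)) * x) + (g x : ℂ) * unitExp (f x + ν * x)) := by
        ext x
        rw [mul_add, Finset.mul_sum, zero_mul, add_zero, mul_one]
        congr 1
        apply Finset.sum_congr rfl
        intro ν _
        rw [unitExp_add, unitExp_add, neg_mul]
        ring
      rw [this, intervalIntegral.integral_add (hTi 0), intervalIntegral.integral_finsetSum]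
      · congr 1
        apply Finset.sum_congr rfl
        intro ν _
        rw [intervalIntegral.integral_add (hTi _) (hTi _)]
      · intro ν _
        exact (hTi _).add (hTi _)
      · have := IntervalIntegrable.sum (Finset.Icc 1 M) (f := fun (ν : ℕ) (x : ℝ) =>
          ((g x : ℂ) * unitExp (f x + (-(ν : ℝ)) * x) + (g x : ℂ) * unitExp (f x + ν * x)))
          (fun ν _ => (hTi _).add (hTi _)) (μ := volume) (a := a) (b := b)
        refine this.congr_ae (ae_of_all _ fun x => ?_)
        simp only [Finset.sum_apply]
    rw [s2, s1, Finset.sum_add_distrib]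
    ring
  have hlim := (tendsto_poisson_sum hpq hF).sub_const (T 0 + ∑ ν ∈ Finset.Icc 1 V, T (-(ν : ℝ)))
  rw [e0]
  refine le_of_tendsto hlim.norm ?_
  filter_upwards [eventually_ge_atTop V] with M hM
  rw [e1 M hM, add_sub_cancel_left]
  have b1 : ‖∑ ν ∈ Finset.Icc 1 V, T ν‖ ≤ 4 * G * (1 + Real.log V) := by
    calc _ ≤ ∑ ν ∈ Finset.Icc 1 V, 4 * G * (1 / (ν : ℝ)) := by
          refine norm_sum_le_of_le _ fun ν hν => ?_
          have : (0 : ℝ) < ν := by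
            have := (Finset.mem_Icc.1 hν).1
            exact_mod_cast this
          rw [mul_one_div]
          exact h.norm_integral_pos_freq_le hab this
      _ ≤ _ := by
          rw [← Finset.mul_sum]
          have := sum_Icc_inv_le_one_add_log V
          gcongr
  have b2 : ‖∑ ν ∈ Finset.Ioc V M, (T (-(ν : ℝ)) + T ν)‖ ≤ 8 * G := by
    calc _ ≤ ∑ ν ∈ Finset.Ioc V M, 8 * G * V * ((ν : ℝ) ^ 2)⁻¹ := by
          refine norm_sum_le_of_le _ fun ν hν => ?_
          have : (V : ℝ) < ν := by
            have := (Finset.mem_Ioc.1 hν).1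
            exact_mod_cast this
          rw [← div_eq_mul_inv]
          exact h.norm_integral_add_integral_le hab ha hb hV' this
      _ ≤ 8 * G * V * ((V : ℝ)⁻¹ - (M : ℝ)⁻¹) := by
          rw [← Finset.mul_sum]
          have := sum_Ioc_inv_sq_le_sub (α := ℝ) (by omega : V ≠ 0) hM
          gcongr
      _ ≤ 8 * G * V * (V : ℝ)⁻¹ := by
          have : (0 : ℝ) ≤ (M : ℝ)⁻¹ := by positivity
          gcongr
          linarith
      _ = 8 * G := by
          have : (V : ℝ) ≠ 0 := by positivity
          field_simp
  have hl1 : Real.log V ≤ Real.log (V + 2) := Real.log_le_log (by linarith) (by linarith)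
  have hl2 : 1 ≤ Real.log (V + 2) := by
    rw [Real.le_log_iff_exp_le (by positivity)]
    linarith [Real.exp_one_lt_d9]
  refine (norm_add_le _ _).trans ?_
  nlinarith

/-- Truncated Poisson summation with arbitrary endpoints. -/
lemma AmplitudePhase.norm_sum_sub_integral_le {g g' g'' f f' f'' : ℝ → ℝ} {G α β : ℝ} {V p q : ℕ}
    (h : AmplitudePhase g g' g'' f f' f'' G V (p + 1 / 2) (q + 1 / 2)) (hpq : p < q)
    (hV : 1 ≤ V) (hp : (p : ℝ) ≤ α) (hp' : α ≤ p + 1) (hq : (q : ℝ) ≤ β) (hq' : β ≤ q + 1)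
    (hg : ContinuousOn g (Set.Icc (p : ℝ) (q + 1))) (hf : ContinuousOn f (Set.Icc (p : ℝ) (q + 1)))
    (hG : ∀ x ∈ Set.Icc (p : ℝ) (q + 1), |g x| ≤ G) :
    ‖∑ n ∈ Finset.Ioc p q, (g n : ℂ) * unitExp (f n) - ∑ ν ∈ Finset.range (V + 1),
      ∫ x in α..β, (g x : ℂ) * unitExp (f x) * unitExp (-(ν * x))‖ ≤
      24 * G * Real.log (V + 2) := by
  have hpq' : (p : ℝ) + 1 ≤ q := by exact_mod_cast hpq
  set F : ℝ → ℂ := fun x => (g x : ℂ) * unitExp (f x) with hF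
  have hFc : ContinuousOn F (Set.Icc (p : ℝ) (q + 1)) :=
    (Complex.continuous_ofReal.comp_continuousOn hg).mul (continuous_unitExp.comp_continuousOn hf)
  have hFG : ∀ x ∈ Set.Icc (p : ℝ) (q + 1), ‖F x‖ ≤ G := by
    intro x hx
    simpa [hF, norm_unitExp] using hG x hx
  have hi : ∀ (ν : ℕ) (u v : ℝ), u ∈ Set.Icc (p : ℝ) (q + 1) → v ∈ Set.Icc (p : ℝ) (q + 1) →
      IntervalIntegrable (fun x => F x * unitExp (-(ν * x))) volume u v := by
    intro ν u v hu hv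
    apply ContinuousOn.intervalIntegrable
    have hcu := continuous_unitExp
    exact (hFc.mul (by fun_prop)).mono (Set.ordConnected_Icc.uIcc_subset hu hv)
  have short : ∀ (n : ℕ) (u v : ℝ), p ≤ n → n ≤ q → u ∈ Set.Icc (n : ℝ) (n + 1) →
      v ∈ Set.Icc (n : ℝ) (n + 1) →
      ‖∑ ν ∈ Finset.range (V + 1), ∫ x in u..v, F x * unitExp (-(ν * x))‖ ≤
        4 * G * Real.log (V + 2) := by
    have aux : ∀ (n : ℕ) (u v : ℝ), p ≤ n → n ≤ q → u ∈ Set.Icc (n : ℝ) (n + 1) →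
      v ∈ Set.Icc (n : ℝ) (n + 1) → u ≤ v →
      ‖∑ ν ∈ Finset.range (V + 1), ∫ x in u..v, F x * unitExp (-(ν * x))‖ ≤
        4 * G * Real.log (V + 2) := by
      intro n u v h1 h2 hu hv huv
      have h1' : (p : ℝ) ≤ n := by exact_mod_cast h1
      have h2' : (n : ℝ) ≤ q := by exact_mod_cast h2
      have hs : Set.Icc u v ⊆ Set.Icc (p : ℝ) (q + 1) :=
        Set.Icc_subset_Icc (by linarith [hu.1]) (by linarith [hv.2])
      exact norm_sum_integral_short_le V hu.1 huv hv.2 (hFc.mono hs) (fun x hx => hFG x (hs hx))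
    intro n u v h1 h2 hu hv
    rcases le_total u v with huv | huv
    · exact aux n u v h1 h2 hu hv huv
    · simp_rw [intervalIntegral.integral_symm v u, Finset.sum_neg_distrib, norm_neg]
      exact aux n v u h1 h2 hv hu huv
  have split : ∑ ν ∈ Finset.range (V + 1), ∫ x in α..β, F x * unitExp (-(ν * x)) =
      ∑ ν ∈ Finset.range (V + 1), (∫ x in α..((p : ℝ) + 1 / 2), F x * unitExp (-(ν * x))) +
      ∑ ν ∈ Finset.range (V + 1), (∫ x in ((p : ℝ) + 1 / 2)..(q + 1 / 2),
        F x * unitExp (-(ν * x))) +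
      ∑ ν ∈ Finset.range (V + 1), (∫ x in ((q : ℝ) + 1 / 2)..β, F x * unitExp (-(ν * x))) := by
    rw [← Finset.sum_add_distrib, ← Finset.sum_add_distrib]
    apply Finset.sum_congr rfl
    intro ν _
    have m1 : α ∈ Set.Icc (p : ℝ) (q + 1) := ⟨hp, by linarith⟩
    have m2 : (p : ℝ) + 1 / 2 ∈ Set.Icc (p : ℝ) (q + 1) := ⟨by linarith, by linarith⟩
    have m3 : (q : ℝ) + 1 / 2 ∈ Set.Icc (p : ℝ) (q + 1) := ⟨by linarith, by linarith⟩
    have m4 : β ∈ Set.Icc (p : ℝ) (q + 1) := ⟨by linarith, by linarith⟩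
    rw [intervalIntegral.integral_add_adjacent_intervals (hi ν _ _ m1 m2) (hi ν _ _ m2 m3),
      intervalIntegral.integral_add_adjacent_intervals (hi ν _ _ m1 m3) (hi ν _ _ m3 m4)]
  have b1 := short p α (p + 1 / 2) le_rfl hpq.le ⟨hp, hp'⟩ ⟨by linarith, by linarith⟩
  have b2 := short q (q + 1 / 2) β hpq.le le_rfl ⟨by linarith, by linarith⟩ ⟨hq, hq'⟩
  have b3 := h.norm_sum_sub_integral_half_le hpq.le hV
  change ‖∑ n ∈ Finset.Ioc p q, F n - ∑ ν ∈ Finset.range (V + 1),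
      ∫ x in ((p : ℝ) + 1 / 2)..(q + 1 / 2), F x * unitExp (-(ν * x))‖ ≤ _ at b3
  change ‖∑ n ∈ Finset.Ioc p q, F n - ∑ ν ∈ Finset.range (V + 1),
      ∫ x in α..β, F x * unitExp (-(ν * x))‖ ≤ _
  rw [split]
  set S1 := ∑ ν ∈ Finset.range (V + 1), (∫ x in α..((p : ℝ) + 1 / 2), F x * unitExp (-(ν * x)))
  set S2 := ∑ ν ∈ Finset.range (V + 1), (∫ x in ((p : ℝ) + 1 / 2)..(q + 1 / 2),
        F x * unitExp (-(ν * x)))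
  set S3 := ∑ ν ∈ Finset.range (V + 1), (∫ x in ((q : ℝ) + 1 / 2)..β, F x * unitExp (-(ν * x)))
  set S := ∑ n ∈ Finset.Ioc p q, F n
  have e : S - (S1 + S2 + S3) = (S - S2) - S1 - S3 := by ring
  rw [e]
  have t1 := norm_sub_le ((S - S2) - S1) S3
  have t2 := norm_sub_le (S - S2) S1
  linarith

lemma norm_integral_sqrt_mul_gauss_sub_le {ω r₁ r₂ : ℝ} (hω : 0 < ω) (h1 : 0 < r₁)
    (h12 : r₁ ≤ r₂) {μ : ℕ} (hμ : 1 ≤ μ) :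
    ‖(∫ x in (ω * r₁)..(ω * r₂), (√x : ℂ) * unitExp (x ^ 2 / (2 * ω ^ 2)) * unitExp (-(μ * x))) -
      (if r₁ < μ * ω ∧ μ * ω ≤ r₂ then
        unitExp (1 / 8) * ((ω ^ 2 * √μ : ℝ) : ℂ) * unitExp (-((μ * ω) ^ 2 / 2)) else 0)‖ ≤
      8 * (ω ^ 2 * √μ * (1 / (1 + |r₁ - μ * ω|) + 1 / (1 + |r₂ - μ * ω|)) + ω / √μ) := by
  have hμ0 : (0 : ℝ) < μ := by exact_mod_cast hμ
  have hy : 0 < μ * ω := by positivity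
  set y : ℝ := μ * ω with hydef
  set c : ℝ := y * ω with hc
  have hc0 : 0 < c := by positivity
  have hsc : √c = √μ * ω := by
    rw [hc, hydef, mul_assoc, Real.sqrt_mul hμ0.le, Real.sqrt_mul_self hω.le]
  have hsub := intervalIntegral.integral_comp_mul_left (a := r₁ / y) (b := r₂ / y)
    (fun x : ℝ => (√x : ℂ) * unitExp (x ^ 2 / (2 * ω ^ 2)) * unitExp (-(μ * x))) hc0.ne'
  have e1 : c * (r₁ / y) = ω * r₁ := by rw [hc]; field_simp
  have e2 : c * (r₂ / y) = ω * r₂ := by rw [hc]; field_simp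
  rw [e1, e2] at hsub
  have hpt : ∀ t : ℝ, (√(c * t) : ℂ) * unitExp ((c * t) ^ 2 / (2 * ω ^ 2)) *
      unitExp (-(μ * (c * t))) =
      (√c * unitExp (-(y ^ 2 / 2))) * ((√t : ℂ) * unitExp (y ^ 2 / 2 * (t - 1) ^ 2)) := by
    intro t
    have : (c * t) ^ 2 / (2 * ω ^ 2) + -(μ * (c * t)) = -(y ^ 2 / 2) + y ^ 2 / 2 * (t - 1) ^ 2 := by
      rw [hc, hydef]
      field_simp
      ring
    rw [mul_assoc, ← unitExp_add, this, unitExp_add, Real.sqrt_mul hc0.le]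
    push_cast
    ring
  simp_rw [hpt] at hsub
  rw [intervalIntegral.integral_const_mul, eq_inv_smul_iff₀ hc0.ne', Complex.real_smul] at hsub
  rw [← hsub]
  have hX : 0 < y ^ 2 := by positivity
  have key := norm_integral_sqrt_mul_quadratic_sub_le hX (div_pos h1 hy)
    (div_le_div_of_nonneg_right h12 hy.le)
  set J := ∫ t in (r₁ / y)..(r₂ / y), (√t : ℂ) * unitExp (y ^ 2 / 2 * (t - 1) ^ 2) with hJ
  rw [Real.sqrt_sq hy.le] at key
  have habs : ∀ r : ℝ, y ^ 2 * |r / y - 1| = y * |r - y| := by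
    intro r
    have : r - y = y * (r / y - 1) := by field_simp
    rw [this, abs_mul, abs_of_pos hy]
    ring
  rw [habs, habs] at key
  set cond := r₁ / y < 1 ∧ 1 ≤ r₂ / y with hcond
  have hiff : (r₁ < y ∧ y ≤ r₂) ↔ cond := by
    rw [hcond, div_lt_one hy, one_le_div hy]
  have hD : (if r₁ < y ∧ y ≤ r₂ then
        unitExp (1 / 8) * ((ω ^ 2 * √μ : ℝ) : ℂ) * unitExp (-(y ^ 2 / 2)) else 0) =
      c * (√c * unitExp (-(y ^ 2 / 2)) * (if cond then unitExp (1 / 8) / (y : ℂ) else 0)) := by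
    simp only [hiff]
    split_ifs
    · have : ω ^ 2 * √μ = c * √c / y := by
        rw [hsc, hc]
        field_simp
      rw [this]
      push_cast
      ring
    · simp
  rw [hD, ← mul_sub, ← mul_sub, norm_mul, norm_mul, norm_mul, norm_unitExp, mul_one,
    Complex.norm_real, Complex.norm_real, Real.norm_of_nonneg hc0.le,
    Real.norm_of_nonneg (Real.sqrt_nonneg c)]
  calc _ ≤ c * (√c * (8 * (1 / (y + y * |r₁ - y|) + 1 / (y + y * |r₂ - y|) + 1 / y ^ 2))) := by
        gcongr
    _ = _ := by
        have h3 : 0 < 1 + |r₁ - y| := by positivity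
        have h4 : 0 < 1 + |r₂ - y| := by positivity
        have h5 : 0 < √(μ : ℝ) := Real.sqrt_pos.2 hμ0
        have h6 : (μ : ℝ) = √μ * √μ := (Real.mul_self_sqrt hμ0.le).symm
        have h7 : y = √μ * √μ * ω := by rw [hydef, ← h6]
        have q1 : y + y * |r₁ - y| = y * (1 + |r₁ - y|) := by ring
        have q2 : y + y * |r₂ - y| = y * (1 + |r₂ - y|) := by ring
        rw [q1, q2, hsc, hc]
        generalize 1 + |r₁ - y| = u at *
        generalize 1 + |r₂ - y| = v at *
        rw [h7]
        field_simp

lemma norm_integral_sqrt_mul_gauss_le {ω r₁ r₂ : ℝ} (hω : 0 < ω) (h1 : 0 < r₁) (h12 : r₁ ≤ r₂) :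
    ‖∫ x in r₁..r₂, (√x : ℂ) * unitExp (x ^ 2 / (2 * ω ^ 2))‖ ≤ 2 * (ω ^ 2 / √r₁) := by
  have hu : Set.uIcc r₁ r₂ = Set.Icc r₁ r₂ := Set.uIcc_of_le h12
  have hp : ∀ x ∈ Set.Icc r₁ r₂, 0 < x := fun x hx => h1.trans_le hx.1
  have e : ∫ x in r₁..r₂, (√x : ℂ) * unitExp (x ^ 2 / (2 * ω ^ 2)) =
      ∫ x in r₁..r₂, ((ω ^ 2 / √x * (x / ω ^ 2) : ℝ) : ℂ) * unitExp (x ^ 2 / (2 * ω ^ 2)) := by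
    apply intervalIntegral.integral_congr
    intro x hx
    rw [hu] at hx
    have h0 := hp x hx
    have : ω ^ 2 / √x * (x / ω ^ 2) = √x := by
      have : ω ^ 2 / √x * (x / ω ^ 2) = x / √x := by field_simp
      rw [this, Real.div_sqrt]
    simp only [this]
  rw [e]
  refine norm_integral_mul_unitExp_le_of_monotone h12
    (q' := fun x => -(ω ^ 2 * (1 / (2 * √x)) / √x ^ 2)) ?_ ?_ ?_ ?_ ?_
  · intro x hx
    have h0 := hp x hx
    refine ((hasDerivAt_const x (ω ^ 2)).fun_div (Real.hasDerivAt_sqrt h0.ne')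
      (Real.sqrt_pos.2 h0).ne').congr_deriv ?_
    ring
  · intro x hx
    refine (((hasDerivAt_id' x).fun_pow 2).div_const (2 * ω ^ 2)).congr_deriv ?_
    simp
    field_simp
  · refine Or.inr fun x hx => ?_
    have : 0 ≤ ω ^ 2 * (1 / (2 * √x)) / √x ^ 2 := by positivity
    linarith
  · fun_prop
  · intro x hx
    have h0 := hp x hx
    refine ⟨by positivity, ?_⟩
    have := Real.sqrt_le_sqrt hx.1
    have := Real.sqrt_pos.2 h1
    gcongr

lemma norm_sum_mul_sub_le {ι : Type*} (s : Finset ι) {S : ℂ} {I M : ι → ℂ} {E : ℝ} {e : ι → ℝ}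
    (h : ‖S - ∑ i ∈ s, I i‖ ≤ E) (hi : ∀ i ∈ s, ‖I i - M i‖ ≤ e i) :
    ‖S - ∑ i ∈ s, M i‖ ≤ E + ∑ i ∈ s, e i := by
  have : S - ∑ i ∈ s, M i = (S - ∑ i ∈ s, I i) + ∑ i ∈ s, (I i - M i) := by
    rw [Finset.sum_sub_distrib]
    ring
  rw [this]
  exact (norm_add_le _ _).trans (add_le_add h (norm_sum_le_of_le _ hi))

lemma sum_range_succ_eq_add_sum_Icc {M : Type*} [AddCommMonoid M] (u : ℕ → M) (V : ℕ) :
    ∑ ν ∈ Finset.range (V + 1), u ν = u 0 + ∑ ν ∈ Finset.Icc 1 V, u ν := by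
  rw [Finset.sum_range_succ', add_comm, Finset.range_eq_Ico, Finset.sum_Ico_add' u 0 V 1]
  congr 1

lemma amplitudePhase_sqrt_gauss {ω a b G V : ℝ} (hω : 0 < ω) (ha : 1 / 2 ≤ a)
    (hG1 : 1 ≤ G) (hG : √b ≤ G) (hV : b / ω ^ 2 ≤ V / 2) :
    AmplitudePhase (fun x => √x) (fun x => 1 / (2 * √x)) (fun x => -(1 / (4 * (x * √x))))
      (fun x => x ^ 2 / (2 * ω ^ 2)) (fun x => x / ω ^ 2) (fun _ => 1 / ω ^ 2) G V a b := by
  have hp : ∀ x ∈ Set.Icc a b, 0 < x := fun x hx => by linarith [hx.1]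
  have hs : ∀ x ∈ Set.Icc a b, 0 < √x := fun x hx => Real.sqrt_pos.2 (hp x hx)
  refine ⟨?_, ?_, ?_, ?_, ?_, ?_, ?_, ?_, ?_, ?_, ?_, ?_⟩
  · intro x hx
    exact Real.hasDerivAt_sqrt (hp x hx).ne'
  · intro x hx
    have h0 := hp x hx
    have h1 := hs x hx
    refine ((hasDerivAt_const x (1 : ℝ)).fun_div ((Real.hasDerivAt_sqrt h0.ne').const_mul 2)
      (by positivity)).congr_deriv ?_
    have h2 : x = √x * √x := (Real.mul_self_sqrt h0.le).symm
    generalize √x = w at *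
    subst h2
    field_simp
    ring
  · intro x hx
    refine (((hasDerivAt_id' x).fun_pow 2).div_const (2 * ω ^ 2)).congr_deriv ?_
    simp
    field_simp
  · intro x hx
    exact (hasDerivAt_id' x).div_const (ω ^ 2)
  · refine (continuousOn_const.div (by fun_prop) fun x hx => ?_).neg
    have h0 := hp x hx
    have h1 := hs x hx
    positivity
  · exact continuousOn_const
  · exact Or.inl fun x hx => by positivity
  · refine Or.inr fun x hx => ?_
    have h0 := hp x hx
    have : 0 ≤ 1 / (4 * (x * √x)) := by positivity
    linarith
  · exact Or.inl fun x hx => by positivity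
  · intro x hx
    rw [abs_of_pos (hs x hx)]
    exact (Real.sqrt_le_sqrt hx.2).trans hG
  · intro x hx
    have h1 := hs x hx
    rw [abs_of_pos (by positivity)]
    have h2 : (1 : ℝ) / 2 ≤ √x := by
      apply Real.le_sqrt_of_sq_le
      linarith [hx.1]
    refine le_trans ?_ hG1
    rw [div_le_one (by positivity)]
    linarith
  · intro x hx
    have h0 := hp x hx
    refine ⟨by positivity, le_trans ?_ hV⟩
    gcongr
    exact hx.2

/-- The van der Corput transform of `∑ √n e(n² / (2ω²))`. -/
lemma norm_sum_sqrt_gauss_sub_le {ω r₁ r₂ : ℝ} (hω : 0 < ω) (h1 : 0 < r₁)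
    (h12 : r₁ ≤ r₂) {V : ℕ} (hV : 1 ≤ V) (hV' : 4 * (r₂ / ω) ≤ V) :
    ‖∑ n ∈ Finset.Ioc ⌊ω * r₁⌋₊ ⌊ω * r₂⌋₊, (√(n : ℝ) : ℂ) * unitExp ((n : ℝ) ^ 2 / (2 * ω ^ 2)) -
      ∑ μ ∈ Finset.Icc 1 V, (if r₁ < μ * ω ∧ μ * ω ≤ r₂ then
        unitExp (1 / 8) * ((ω ^ 2 * √μ : ℝ) : ℂ) * unitExp (-((μ * ω) ^ 2 / 2)) else 0)‖ ≤
      48 * √(ω * r₂) * Real.log (V + 2) + 2 * (ω ^ 2 / √(ω * r₁)) +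
      ∑ μ ∈ Finset.Icc 1 V,
        8 * (ω ^ 2 * √μ * (1 / (1 + |r₁ - μ * ω|) + 1 / (1 + |r₂ - μ * ω|)) + ω / √μ) := by
  have hm1 : 0 < ω * r₁ := by positivity
  have hm12 : ω * r₁ ≤ ω * r₂ := by gcongr
  set p := ⌊ω * r₁⌋₊ with hp
  set q := ⌊ω * r₂⌋₊ with hq
  have hpq : p ≤ q := Nat.floor_mono hm12
  have p1 : (p : ℝ) ≤ ω * r₁ := Nat.floor_le hm1.le
  have p2 : ω * r₁ < p + 1 := Nat.lt_floor_add_one _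
  have q1 : (q : ℝ) ≤ ω * r₂ := Nat.floor_le (hm1.le.trans hm12)
  have q2 : ω * r₂ < q + 1 := Nat.lt_floor_add_one _
  have hl2 : 0 ≤ Real.log (V + 2) := Real.log_nonneg (by linarith [(Nat.cast_nonneg V : (0:ℝ) ≤ V)])
  set F : ℝ → ℂ := fun x => (√x : ℂ) * unitExp (x ^ 2 / (2 * ω ^ 2)) with hF
  have hcu := continuous_unitExp
  have hFc : Continuous F := by
    have : Continuous fun x : ℝ => x ^ 2 / (2 * ω ^ 2) := by fun_prop
    have := hcu.comp this
    exact (Complex.continuous_ofReal.comp Real.continuous_sqrt).mul this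
  have main : ‖∑ n ∈ Finset.Ioc p q, F n - ∑ ν ∈ Finset.range (V + 1),
      ∫ x in (ω * r₁)..(ω * r₂), F x * unitExp (-(ν * x))‖ ≤
      48 * √(ω * r₂) * Real.log (V + 2) := by
    rcases hpq.eq_or_lt with h | h
    · have := norm_sum_integral_short_le (F := F) (G := √(ω * r₂)) (n := p) V p1 hm12
        (by rw [h]; exact q2.le) hFc.continuousOn (by
          intro x hx
          rw [hF]
          simp only [norm_mul, norm_unitExp, mul_one, Complex.norm_real]
          rw [Real.norm_of_nonneg (Real.sqrt_nonneg _)]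
          exact Real.sqrt_le_sqrt hx.2)
      rw [h, Finset.Ioc_self, Finset.sum_empty, zero_sub, norm_neg]
      refine this.trans ?_
      have : 0 ≤ √(ω * r₂) := Real.sqrt_nonneg _
      nlinarith [mul_nonneg this hl2]
    · have hq1 : (1 : ℝ) ≤ q := by
        have : 1 ≤ q := by omega
        exact_mod_cast this
      have hm2 : 1 ≤ ω * r₂ := hq1.trans q1
      have hs1 : 1 ≤ √(ω * r₂) := Real.one_le_sqrt.2 hm2
      have hG2 : ∀ x : ℝ, x ≤ q + 1 → √x ≤ 2 * √(ω * r₂) := by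
        intro x hx
        apply Real.sqrt_le_iff.2
        refine ⟨by positivity, ?_⟩
        rw [mul_pow, Real.sq_sqrt (by linarith)]
        linarith
      have hA : AmplitudePhase (fun x => √x) (fun x => 1 / (2 * √x))
          (fun x => -(1 / (4 * (x * √x)))) (fun x => x ^ 2 / (2 * ω ^ 2)) (fun x => x / ω ^ 2)
          (fun _ => 1 / ω ^ 2) (2 * √(ω * r₂)) V (p + 1 / 2) (q + 1 / 2) := by
        refine amplitudePhase_sqrt_gauss hω (by linarith [(Nat.cast_nonneg p : (0:ℝ) ≤ p)])
          (by linarith) (hG2 _ (by linarith)) ?_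
        have e1 : 4 * (r₂ / ω) = 4 * (ω * r₂) / ω ^ 2 := by field_simp
        rw [e1] at hV'
        have : (q + 1 / 2 : ℝ) / ω ^ 2 ≤ 2 * (ω * r₂) / ω ^ 2 := by
          gcongr
          linarith
        have e2 : 2 * (ω * r₂) / ω ^ 2 = 4 * (ω * r₂) / ω ^ 2 / 2 := by ring
        linarith
      have := hA.norm_sum_sub_integral_le h hV p1 p2.le q1 q2.le
        Real.continuous_sqrt.continuousOn (by fun_prop) (by
          intro x hx
          rw [abs_of_nonneg (Real.sqrt_nonneg _)]
          exact hG2 x hx.2)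
      exact this.trans (le_of_eq (by ring))
  rw [sum_range_succ_eq_add_sum_Icc, ← sub_sub] at main
  have h0 := norm_integral_sqrt_mul_gauss_le hω hm1 hm12
  have main2 : ‖∑ n ∈ Finset.Ioc p q, F n - ∑ ν ∈ Finset.Icc 1 V,
      ∫ x in (ω * r₁)..(ω * r₂), F x * unitExp (-(ν * x))‖ ≤
      48 * √(ω * r₂) * Real.log (V + 2) + 2 * (ω ^ 2 / √(ω * r₁)) := by
    simp only [Nat.cast_zero, zero_mul, neg_zero, unitExp_zero, mul_one] at main
    set I0 := ∫ x in (ω * r₁)..(ω * r₂), F x with hI0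
    set S := ∑ n ∈ Finset.Ioc p q, F n
    set S' := ∑ ν ∈ Finset.Icc 1 V, ∫ x in (ω * r₁)..(ω * r₂), F x * unitExp (-(ν * x))
    have : S - S' = (S - I0 - S') + I0 := by ring
    rw [this]
    exact (norm_add_le _ _).trans (add_le_add main h0)
  exact norm_sum_mul_sub_le _ main2 fun μ hμ =>
    norm_integral_sqrt_mul_gauss_sub_le hω h1 h12 (Finset.mem_Icc.1 hμ).1

lemma cube_rpow_neg_sixth {z : ℝ} (hz : 0 < z) : (z ^ 3) ^ (-(1 : ℝ) / 6) = 1 / √z := by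
  rw [← Real.rpow_natCast, ← Real.rpow_mul hz.le, Real.sqrt_eq_rpow, one_div, ← Real.rpow_neg hz.le]
  norm_num

lemma cube_rpow_two_thirds {z : ℝ} (hz : 0 < z) : (z ^ 3) ^ ((2 : ℝ) / 3) = z ^ 2 := by
  rw [← Real.rpow_natCast, ← Real.rpow_mul hz.le, ← Real.rpow_natCast]
  norm_num

lemma norm_integral_cubeRoot_phase_sub_le {B s₁ s₂ : ℝ} (hB : 0 < B) (h1 : 0 < s₁)
    (h12 : s₁ ≤ s₂) {ν : ℕ} (hν : 1 ≤ ν) :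
    ‖(∫ x in (s₁ ^ 3 / B)..(s₂ ^ 3 / B), (((B * x) ^ (-(1 : ℝ) / 6) : ℝ) : ℂ) *
        unitExp (3 / 2 * (B * x) ^ ((2 : ℝ) / 3)) * unitExp (-(ν * x))) -
      (if s₁ < B / ν ∧ B / ν ≤ s₂ then
        unitExp (-(1 / 8)) * ((√3 * (√(B / ν) / ν) : ℝ) : ℂ) * unitExp ((B / ν) ^ 2 / 2) else 0)‖ ≤
      24 * (√(B / ν) / ν * (1 / (1 + |s₁ - B / ν|) + 1 / (1 + |s₂ - B / ν|)) +
        1 / (ν * √(B / ν))) := by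
  have hν0 : (0 : ℝ) < ν := by exact_mod_cast hν
  set y : ℝ := B / ν with hydef
  have hy : 0 < y := by positivity
  have hBy : B = ν * y := by rw [hydef]; field_simp
  set c : ℝ := y ^ 2 / ν with hc
  have hc0 : 0 < c := by positivity
  have ht1 : 0 < s₁ / y := by positivity
  have ht12 : s₁ / y ≤ s₂ / y := by gcongr
  have hu : Set.uIcc (s₁ / y) (s₂ / y) = Set.Icc (s₁ / y) (s₂ / y) := Set.uIcc_of_le ht12
  have hpos : ∀ t ∈ Set.uIcc (s₁ / y) (s₂ / y), 0 < t := by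
    intro t ht
    rw [hu] at ht
    exact ht1.trans_le ht.1
  have hcu := continuous_unitExp
  have hsub := intervalIntegral.integral_deriv_smul_comp' (a := s₁ / y) (b := s₂ / y)
    (f := fun t => c * t ^ 3) (f' := fun t => 3 * c * t ^ 2)
    (g := fun x => (((B * x) ^ (-(1 : ℝ) / 6) : ℝ) : ℂ) *
        unitExp (3 / 2 * (B * x) ^ ((2 : ℝ) / 3)) * unitExp (-(ν * x)))
    (fun t _ => (((hasDerivAt_id' t).fun_pow 3).const_mul c).congr_deriv (by norm_num; ring))
    (by fun_prop) (by
      have hx0 : ∀ x ∈ (fun t => c * t ^ 3) '' Set.uIcc (s₁ / y) (s₂ / y), B * x ≠ 0 := by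
        rintro x ⟨t, ht, rfl⟩
        have := hpos t ht
        positivity
      have hl : ContinuousOn (fun x : ℝ => B * x) ((fun t => c * t ^ 3) ''
        Set.uIcc (s₁ / y) (s₂ / y)) := by fun_prop
      have r1 := hl.rpow_const (p := -(1 : ℝ) / 6) fun x hx => Or.inl (hx0 x hx)
      have r2 := hl.rpow_const (p := (2 : ℝ) / 3) fun x hx => Or.inl (hx0 x hx)
      exact ((Complex.continuous_ofReal.comp_continuousOn r1).mul
        (hcu.comp_continuousOn (continuousOn_const.mul r2))).mul (by fun_prop))
  have e1 : ∀ s : ℝ, c * (s / y) ^ 3 = s ^ 3 / B := by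
    intro s
    rw [hc, hBy]
    field_simp
  simp only [e1] at hsub
  have hpt : ∀ t ∈ Set.uIcc (s₁ / y) (s₂ / y), (3 * c * t ^ 2) •
      ((fun x : ℝ => (((B * x) ^ (-(1 : ℝ) / 6) : ℝ) : ℂ) *
        unitExp (3 / 2 * (B * x) ^ ((2 : ℝ) / 3)) * unitExp (-(ν * x))) ∘
          (fun t => c * t ^ 3)) t =
      (((3 * c / √y : ℝ) : ℂ) * unitExp (y ^ 2 / 2)) * (starRingEnd ℂ)
        (((t * √t : ℝ) : ℂ) * unitExp (y ^ 2 / 2 * (t - 1) ^ 2 * (2 * t + 1))) := by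
    intro t ht
    have ht0 := hpos t ht
    have hz : B * (c * t ^ 3) = (y * t) ^ 3 := by
      rw [hc, hBy]
      field_simp
    have hph : 3 / 2 * (y * t) ^ 2 + -(ν * (c * t ^ 3)) =
        y ^ 2 / 2 + -(y ^ 2 / 2 * (t - 1) ^ 2 * (2 * t + 1)) := by
      rw [hc]
      field_simp
      ring
    have ham : 3 * c * t ^ 2 * (1 / √(y * t)) = 3 * c / √y * (t * √t) := by
      rw [Real.sqrt_mul hy.le]
      have h5 : 0 < √t := Real.sqrt_pos.2 ht0
      have h6 : 0 < √y := Real.sqrt_pos.2 hy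
      have h7 : t = √t * √t := (Real.mul_self_sqrt ht0.le).symm
      generalize √t = w at *
      subst h7
      field_simp
    simp only [Function.comp]
    rw [hz, cube_rpow_neg_sixth (by positivity), cube_rpow_two_thirds (by positivity),
      mul_assoc (((1 / √(y * t) : ℝ) : ℂ)), ← unitExp_add, hph, unitExp_add, Complex.real_smul,
      ← mul_assoc, ← Complex.ofReal_mul, ham, map_mul, Complex.conj_ofReal, unitExp_conj]
    push_cast
    ring
  rw [intervalIntegral.integral_congr hpt, intervalIntegral.integral_const_mul,
    intervalIntegral.intervalIntegral_conj] at hsub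
  rw [← hsub]
  have hX : 0 < y ^ 2 := by positivity
  have key := norm_integral_mul_sqrt_mul_cubic_sub_le hX ht1 ht12
  set J := ∫ t in (s₁ / y)..(s₂ / y), ((t * √t : ℝ) : ℂ) *
    unitExp (y ^ 2 / 2 * (t - 1) ^ 2 * (2 * t + 1)) with hJ
  rw [Real.sqrt_mul (by norm_num : (0 : ℝ) ≤ 3), Real.sqrt_sq hy.le] at key
  have habs : ∀ r : ℝ, y ^ 2 * |r / y - 1| = y * |r - y| := by
    intro r
    have : r - y = y * (r / y - 1) := by field_simp
    rw [this, abs_mul, abs_of_pos hy]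
    ring
  rw [habs, habs] at key
  set cond := s₁ / y < 1 ∧ 1 ≤ s₂ / y with hcond
  have hiff : (s₁ < y ∧ y ≤ s₂) ↔ cond := by
    rw [hcond, div_lt_one hy, one_le_div hy]
  have h6 : 0 < √y := Real.sqrt_pos.2 hy
  have h7 : y = √y * √y := (Real.mul_self_sqrt hy.le).symm
  have hD : (if s₁ < y ∧ y ≤ s₂ then
        unitExp (-(1 / 8)) * ((√3 * (√y / ν) : ℝ) : ℂ) * unitExp (y ^ 2 / 2) else 0) =
      ((3 * c / √y : ℝ) : ℂ) * unitExp (y ^ 2 / 2) *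
        (starRingEnd ℂ) (if cond then unitExp (1 / 8) / ((√3 * y : ℝ) : ℂ) else 0) := by
    simp only [hiff]
    split_ifs
    · have : √3 * (√y / ν) = 3 * c / √y / (√3 * y) := by
        have h8 : (3 : ℝ) = √3 * √3 := (Real.mul_self_sqrt (by norm_num)).symm
        rw [hc]
        have h9 : 0 < √(3 : ℝ) := by positivity
        rw [div_div, eq_div_iff (by positivity)]
        have : √3 * (√y / ν) * (√y * (√3 * y)) = (√3 * √3) * ((√y * √y) * y / ν) := by ring
        rw [this, ← h7, ← h8]
        ring
      rw [this, map_div₀, unitExp_conj, Complex.conj_ofReal]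
      push_cast
      ring
    · simp
  rw [hD, ← mul_sub, ← map_sub, norm_mul, norm_mul, norm_unitExp, mul_one, RCLike.norm_conj,
    Complex.norm_real, Real.norm_of_nonneg (by positivity)]
  calc _ ≤ 3 * c / √y * (8 * (1 / (y + y * |s₁ - y|) + 1 / (y + y * |s₂ - y|) + 1 / y ^ 2)) := by
        gcongr
    _ = _ := by
        have h3 : 0 < 1 + |s₁ - y| := by positivity
        have h4 : 0 < 1 + |s₂ - y| := by positivity
        have q1 : y + y * |s₁ - y| = y * (1 + |s₁ - y|) := by ring
        have q2 : y + y * |s₂ - y| = y * (1 + |s₂ - y|) := by ring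
        rw [q1, q2, hc]
        generalize 1 + |s₁ - y| = u at *
        generalize 1 + |s₂ - y| = v at *
        clear_value y
        generalize √y = w at *
        subst h7
        field_simp
        ring

lemma hasDerivAt_mul_rpow {B x : ℝ} (r : ℝ) (h : 0 < B * x) :
    HasDerivAt (fun x => (B * x) ^ r) (B * r * (B * x) ^ (r - 1)) x := by
  refine (((hasDerivAt_id' x).const_mul B).rpow_const (Or.inl h.ne')).congr_deriv ?_
  ring

lemma continuousOn_mul_rpow {B : ℝ} (r : ℝ) {s : Set ℝ} (h : ∀ x ∈ s, 0 < B * x) :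
    ContinuousOn (fun x => (B * x) ^ r) s :=
  fun x hx => (hasDerivAt_mul_rpow r (h x hx)).continuousAt.continuousWithinAt

lemma norm_integral_cubeRoot_phase_le {B s₁ s₂ : ℝ} (hB : 0 < B) (h1 : 0 < s₁) (h12 : s₁ ≤ s₂) :
    ‖∫ x in (s₁ ^ 3 / B)..(s₂ ^ 3 / B), (((B * x) ^ (-(1 : ℝ) / 6) : ℝ) : ℂ) *
        unitExp (3 / 2 * (B * x) ^ ((2 : ℝ) / 3))‖ ≤ 2 * (√s₂ / B) := by
  have hs2 : 0 < s₂ := h1.trans_le h12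
  have hab : s₁ ^ 3 / B ≤ s₂ ^ 3 / B := by gcongr
  have hu : Set.uIcc (s₁ ^ 3 / B) (s₂ ^ 3 / B) = Set.Icc (s₁ ^ 3 / B) (s₂ ^ 3 / B) :=
    Set.uIcc_of_le hab
  have hp : ∀ x ∈ Set.Icc (s₁ ^ 3 / B) (s₂ ^ 3 / B), 0 < B * x := by
    intro x hx
    have : 0 < s₁ ^ 3 / B := by positivity
    exact mul_pos hB (this.trans_le hx.1)
  have e : ∫ x in (s₁ ^ 3 / B)..(s₂ ^ 3 / B), (((B * x) ^ (-(1 : ℝ) / 6) : ℝ) : ℂ) *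
        unitExp (3 / 2 * (B * x) ^ ((2 : ℝ) / 3)) =
      ∫ x in (s₁ ^ 3 / B)..(s₂ ^ 3 / B), ((((B * x) ^ ((1 : ℝ) / 6) / B) *
        (B * (B * x) ^ (-(1 : ℝ) / 3)) : ℝ) : ℂ) * unitExp (3 / 2 * (B * x) ^ ((2 : ℝ) / 3)) := by
    apply intervalIntegral.integral_congr
    intro x hx
    rw [hu] at hx
    have h0 := hp x hx
    have : (B * x) ^ ((1 : ℝ) / 6) / B * (B * (B * x) ^ (-(1 : ℝ) / 3)) =
        (B * x) ^ (-(1 : ℝ) / 6) := by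
      have h2 : (B * x) ^ ((1 : ℝ) / 6) * (B * x) ^ (-(1 : ℝ) / 3) = (B * x) ^ (-(1 : ℝ) / 6) := by
        rw [← Real.rpow_add h0]
        norm_num
      rw [← h2]
      field_simp
    simp only [this]
  rw [e]
  refine norm_integral_mul_unitExp_le_of_monotone hab
    (q' := fun x => 1 / 6 * (B * x) ^ ((1 : ℝ) / 6 - 1)) ?_ ?_ ?_ ?_ ?_
  · intro x hx
    refine ((hasDerivAt_mul_rpow (1 / 6) (hp x hx)).div_const B).congr_deriv ?_
    field_simp
  · intro x hx
    refine ((hasDerivAt_mul_rpow (2 / 3) (hp x hx)).const_mul (3 / 2)).congr_deriv ?_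
    rw [show (2 : ℝ) / 3 - 1 = -1 / 3 by norm_num]
    ring
  · refine Or.inl fun x hx => ?_
    have := hp x hx
    positivity
  · exact continuousOn_const.mul (continuousOn_mul_rpow _ hp)
  · intro x hx
    have h0 := hp x hx
    refine ⟨by positivity, ?_⟩
    have h2 : B * x ≤ s₂ ^ 3 := by
      have := hx.2
      rw [le_div_iff₀ hB] at this
      linarith
    have h3 : (s₂ ^ 3) ^ ((1 : ℝ) / 6) = √s₂ := by
      rw [← Real.rpow_natCast, ← Real.rpow_mul hs2.le, Real.sqrt_eq_rpow]
      norm_num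
    rw [← h3]
    gcongr

lemma amplitudePhase_cubeRoot {B s a b V : ℝ} (hB : 0 < B) (hs : 0 < s) (ha : 1 ≤ a)
    (hsa : (s / 4) ^ 3 ≤ B * a) (hV : 8 * (B / s) ≤ V) :
    AmplitudePhase (fun x => (B * x) ^ (-(1 : ℝ) / 6))
      (fun x => -(B / 6 * (B * x) ^ (-(7 : ℝ) / 6)))
      (fun x => 7 / 36 * B ^ 2 * (B * x) ^ (-(13 : ℝ) / 6))
      (fun x => 3 / 2 * (B * x) ^ ((2 : ℝ) / 3)) (fun x => B * (B * x) ^ (-(1 : ℝ) / 3))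
      (fun x => -(B ^ 2 / 3 * (B * x) ^ (-(4 : ℝ) / 3))) (2 / √s) V a b := by
  have hx1 : ∀ x ∈ Set.Icc a b, 1 ≤ x := fun x hx => ha.trans hx.1
  have hp : ∀ x ∈ Set.Icc a b, 0 < B * x := fun x hx => mul_pos hB (by linarith [hx1 x hx])
  have hle : ∀ x ∈ Set.Icc a b, (s / 4) ^ 3 ≤ B * x := fun x hx => hsa.trans (by
    have := hx.1
    gcongr)
  have hs4 : 0 < (s / 4) ^ 3 := by positivity
  have hg : ∀ x ∈ Set.Icc a b, (B * x) ^ (-(1 : ℝ) / 6) ≤ 2 / √s := by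
    intro x hx
    have h4 : √(s / 4) = √s / 2 := by
      rw [Real.sqrt_div hs.le]
      have : √(4 : ℝ) = 2 := by
        rw [show (4 : ℝ) = 2 ^ 2 by norm_num]
        exact Real.sqrt_sq (by norm_num)
      rw [this]
    have h3 : ((s / 4) ^ 3) ^ (-(1 : ℝ) / 6) = 2 / √s := by
      rw [cube_rpow_neg_sixth (by positivity), h4, one_div_div]
    rw [← h3]
    exact Real.rpow_le_rpow_of_nonpos hs4 (hle x hx) (by norm_num)
  refine ⟨?_, ?_, ?_, ?_, ?_, ?_, ?_, ?_, ?_, ?_, ?_, ?_⟩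
  · intro x hx
    refine (hasDerivAt_mul_rpow _ (hp x hx)).congr_deriv ?_
    rw [show -(1 : ℝ) / 6 - 1 = -7 / 6 by norm_num]
    ring
  · intro x hx
    refine ((hasDerivAt_mul_rpow _ (hp x hx)).const_mul (B / 6)).fun_neg.congr_deriv ?_
    rw [show -(7 : ℝ) / 6 - 1 = -13 / 6 by norm_num]
    ring
  · intro x hx
    refine ((hasDerivAt_mul_rpow _ (hp x hx)).const_mul (3 / 2)).congr_deriv ?_
    rw [show (2 : ℝ) / 3 - 1 = -1 / 3 by norm_num]
    ring
  · intro x hx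
    refine ((hasDerivAt_mul_rpow _ (hp x hx)).const_mul B).congr_deriv ?_
    rw [show -(1 : ℝ) / 3 - 1 = -4 / 3 by norm_num]
    ring
  · exact continuousOn_const.mul (continuousOn_mul_rpow _ hp)
  · exact (continuousOn_const.mul (continuousOn_mul_rpow _ hp)).neg
  · refine Or.inr fun x hx => ?_
    have := hp x hx
    have : 0 ≤ B / 6 * (B * x) ^ (-(7 : ℝ) / 6) := by positivity
    linarith
  · refine Or.inl fun x hx => ?_
    have := hp x hx
    positivity
  · refine Or.inr fun x hx => ?_
    have := hp x hx
    have : 0 ≤ B ^ 2 / 3 * (B * x) ^ (-(4 : ℝ) / 3) := by positivity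
    linarith
  · intro x hx
    rw [abs_of_pos (Real.rpow_pos_of_pos (hp x hx) _)]
    exact hg x hx
  · intro x hx
    have h0 := hp x hx
    have hx0 := hx1 x hx
    rw [abs_neg, abs_of_pos (by positivity)]
    have h1 : (B * x) ^ (-(7 : ℝ) / 6) = (B * x) ^ (-(1 : ℝ) / 6) * (B * x)⁻¹ := by
      rw [← Real.rpow_neg_one, ← Real.rpow_add h0]
      norm_num
    rw [h1]
    have h2 : B / 6 * ((B * x) ^ (-(1 : ℝ) / 6) * (B * x)⁻¹) =
        (B * x) ^ (-(1 : ℝ) / 6) * (1 / (6 * x)) := by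
      have : x ≠ 0 := by linarith
      field_simp
    rw [h2]
    refine le_trans (mul_le_of_le_one_right (by positivity) ?_) (hg x hx)
    rw [div_le_one (by linarith)]
    linarith
  · intro x hx
    have h0 := hp x hx
    refine ⟨by positivity, ?_⟩
    have h3 : ((s / 4) ^ 3) ^ (-(1 : ℝ) / 3) = 4 / s := by
      rw [← Real.rpow_natCast, ← Real.rpow_mul (by positivity)]
      norm_num
      rw [Real.rpow_neg_one, inv_div]
    have h4 := Real.rpow_le_rpow_of_nonpos hs4 (hle x hx) (by norm_num : -(1 : ℝ) / 3 ≤ 0)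
    rw [h3] at h4
    calc _ ≤ B * (4 / s) := by gcongr
      _ = 8 * (B / s) / 2 := by ring
      _ ≤ V / 2 := by gcongr

/-- The van der Corput transform of `∑ (Bn)^(-1/6) e(3/2 (Bn)^(2/3))`. -/
lemma norm_sum_cubeRoot_phase_sub_le {B s₁ s₂ : ℝ} (hB : 0 < B) (h1 : 0 < s₁)
    (h12 : s₁ ≤ s₂) (h1' : B ≤ s₁ ^ 3) {V : ℕ} (hV : 1 ≤ V) (hV' : 8 * (B / s₁) ≤ V) :
    ‖∑ n ∈ Finset.Ioc ⌊s₁ ^ 3 / B⌋₊ ⌊s₂ ^ 3 / B⌋₊, (((B * n) ^ (-(1 : ℝ) / 6) : ℝ) : ℂ) *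
        unitExp (3 / 2 * (B * n) ^ ((2 : ℝ) / 3)) -
      ∑ ν ∈ Finset.Icc 1 V, (if s₁ < B / ν ∧ B / ν ≤ s₂ then
        unitExp (-(1 / 8)) * ((√3 * (√(B / ν) / ν) : ℝ) : ℂ) * unitExp ((B / ν) ^ 2 / 2) else 0)‖ ≤
      48 / √s₁ * Real.log (V + 2) + 2 * (√s₂ / B) +
      ∑ ν ∈ Finset.Icc 1 V,
        24 * (√(B / ν) / ν * (1 / (1 + |s₁ - B / ν|) + 1 / (1 + |s₂ - B / ν|)) +
        1 / (ν * √(B / ν))) := by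
  have hα1 : 1 ≤ s₁ ^ 3 / B := (one_le_div hB).2 h1'
  have hαβ : s₁ ^ 3 / B ≤ s₂ ^ 3 / B := by gcongr
  set α := s₁ ^ 3 / B with hα
  set β := s₂ ^ 3 / B with hβ
  set p := ⌊α⌋₊ with hp
  set q := ⌊β⌋₊ with hq
  have hpq : p ≤ q := Nat.floor_mono hαβ
  have hp1 : (1 : ℝ) ≤ p := by
    have : 1 ≤ p := Nat.le_floor (by simpa using hα1)
    exact_mod_cast this
  have p1 : (p : ℝ) ≤ α := Nat.floor_le (by linarith)
  have p2 : α < p + 1 := Nat.lt_floor_add_one _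
  have q1 : (q : ℝ) ≤ β := Nat.floor_le (by linarith)
  have q2 : β < q + 1 := Nat.lt_floor_add_one _
  have hl2 : 0 ≤ Real.log (V + 2) := Real.log_nonneg (by linarith [(Nat.cast_nonneg V : (0:ℝ) ≤ V)])
  have hsp : (s₁ / 4) ^ 3 ≤ B * p := by
    have h2 : s₁ ^ 3 = B * α := by rw [hα]; field_simp
    have h3 : (s₁ / 4) ^ 3 = B * (α / 64) := by
      rw [div_pow, h2]
      ring
    rw [h3]
    gcongr
    linarith
  have hA : ∀ b : ℝ, AmplitudePhase (fun x => (B * x) ^ (-(1 : ℝ) / 6))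
      (fun x => -(B / 6 * (B * x) ^ (-(7 : ℝ) / 6)))
      (fun x => 7 / 36 * B ^ 2 * (B * x) ^ (-(13 : ℝ) / 6))
      (fun x => 3 / 2 * (B * x) ^ ((2 : ℝ) / 3)) (fun x => B * (B * x) ^ (-(1 : ℝ) / 3))
      (fun x => -(B ^ 2 / 3 * (B * x) ^ (-(4 : ℝ) / 3))) (2 / √s₁) V p b := fun b =>
    amplitudePhase_cubeRoot hB h1 hp1 hsp hV'
  set F : ℝ → ℂ := fun x => (((B * x) ^ (-(1 : ℝ) / 6) : ℝ) : ℂ) *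
        unitExp (3 / 2 * (B * x) ^ ((2 : ℝ) / 3)) with hF
  have main : ‖∑ n ∈ Finset.Ioc p q, F n - ∑ ν ∈ Finset.range (V + 1),
      ∫ x in α..β, F x * unitExp (-(ν * x))‖ ≤ 48 / √s₁ * Real.log (V + 2) := by
    have hA' := hA (q + 1)
    rcases hpq.eq_or_lt with h | h
    · have hsub : Set.Icc α β ⊆ Set.Icc (p : ℝ) (q + 1) := Set.Icc_subset_Icc p1 q2.le
      have := norm_sum_integral_short_le (F := F) (G := 2 / √s₁) (n := p) V p1 hαβ
        (by rw [h]; exact q2.le) (((Complex.continuous_ofReal.comp_continuousOn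
          hA'.continuousOn_g).mul
          (continuous_unitExp.comp_continuousOn hA'.continuousOn_f)).mono hsub) (by
          intro x hx
          rw [hF]
          simp only [norm_mul, norm_unitExp, mul_one, Complex.norm_real]
          exact hA'.bound_g x (hsub hx))
      rw [h, Finset.Ioc_self, Finset.sum_empty, zero_sub, norm_neg]
      refine this.trans ?_
      have h4 : 0 ≤ 1 / √s₁ := by positivity
      have e1 : 4 * (2 / √s₁) * Real.log (V + 2) = 8 * (1 / √s₁ * Real.log (V + 2)) := by ring
      have e2 : 48 / √s₁ * Real.log (V + 2) = 48 * (1 / √s₁ * Real.log (V + 2)) := by ring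
      rw [e1, e2]
      nlinarith [mul_nonneg h4 hl2]
    · have := (hA'.mono (by linarith : (p : ℝ) ≤ p + 1 / 2)
        (by linarith : (q : ℝ) + 1 / 2 ≤ q + 1)).norm_sum_sub_integral_le h hV p1 p2.le q1 q2.le
        hA'.continuousOn_g hA'.continuousOn_f hA'.bound_g
      exact this.trans (le_of_eq (by ring))
  rw [sum_range_succ_eq_add_sum_Icc, ← sub_sub] at main
  have h0 := norm_integral_cubeRoot_phase_le hB h1 h12
  have main2 : ‖∑ n ∈ Finset.Ioc p q, F n - ∑ ν ∈ Finset.Icc 1 V,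
      ∫ x in α..β, F x * unitExp (-(ν * x))‖ ≤
      48 / √s₁ * Real.log (V + 2) + 2 * (√s₂ / B) := by
    simp only [Nat.cast_zero, zero_mul, neg_zero, unitExp_zero, mul_one] at main
    set I0 := ∫ x in α..β, F x with hI0
    set S := ∑ n ∈ Finset.Ioc p q, F n
    set S' := ∑ ν ∈ Finset.Icc 1 V, ∫ x in α..β, F x * unitExp (-(ν * x))
    have : S - S' = (S - I0 - S') + I0 := by ring
    rw [this]
    exact (norm_add_le _ _).trans (add_le_add main h0)
  exact norm_sum_mul_sub_le _ main2 fun ν hν =>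
    norm_integral_cubeRoot_phase_sub_le hB h1 h12 (Finset.mem_Icc.1 hν).1

lemma sum_range_inv_one_add_mul_le {κ : ℝ} (hκ : 0 < κ) {K M : ℕ} (hKM : K ≤ M) (hM : 1 ≤ M) :
    ∑ j ∈ Finset.range K, 1 / (1 + κ * j) ≤ 1 + 1 / κ * (1 + Real.log M) := by
  have hM' : (1 : ℝ) ≤ M := by exact_mod_cast hM
  have hlog : 0 ≤ Real.log M := Real.log_nonneg hM'
  calc ∑ j ∈ Finset.range K, 1 / (1 + κ * j) ≤ ∑ j ∈ Finset.range (M + 1), 1 / (1 + κ * j) := by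
        apply Finset.sum_le_sum_of_subset_of_nonneg
        · exact Finset.range_mono (by omega)
        · intro i _ _
          positivity
    _ = 1 + ∑ j ∈ Finset.Icc 1 M, 1 / (1 + κ * j) := by
        rw [sum_range_succ_eq_add_sum_Icc]
        simp
    _ ≤ 1 + ∑ j ∈ Finset.Icc 1 M, 1 / κ * (1 / (j : ℝ)) := by
        gcongr with j hj
        have : (0 : ℝ) < j := by
          have := (Finset.mem_Icc.1 hj).1
          exact_mod_cast this
        rw [div_mul_div_comm, one_mul]
        exact one_div_le_one_div_of_le (by positivity) (by linarith)
    _ ≤ _ := by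
        rw [← Finset.mul_sum]
        have := sum_Icc_inv_le_one_add_log M
        gcongr

lemma sum_inv_one_add_mul_abs_sub_le {κ : ℝ} (hκ : 0 < κ) (z : ℝ) {M : ℕ} {Λ : ℝ}
    (hΛ : 1 + Real.log M ≤ Λ) :
    ∑ m ∈ Finset.Icc 1 M, 1 / (1 + κ * |(m : ℝ) - z|) ≤ 2 + 2 / κ * Λ := by
  rcases Nat.eq_zero_or_pos M with h0 | hM
  · subst h0
    simp only [Nat.cast_zero, Real.log_zero] at hΛ
    simp only [Finset.Icc_eq_empty_of_lt one_pos, Finset.sum_empty]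
    positivity
  set n := min ⌊z⌋₊ M with hn
  obtain ⟨k, hk⟩ := Nat.exists_eq_add_of_le (min_le_right ⌊z⌋₊ M)
  rw [← hn] at hk
  have e1 : ∑ m ∈ Finset.Icc 1 M, 1 / (1 + κ * |(m : ℝ) - z|) =
      ∑ i ∈ Finset.range n, 1 / (1 + κ * |((i : ℝ) + 1) - z|) +
      ∑ i ∈ Finset.range k, 1 / (1 + κ * |((n : ℝ) + i + 1) - z|) := by
    have : ∑ m ∈ Finset.Icc 1 M, 1 / (1 + κ * |(m : ℝ) - z|) =
        ∑ i ∈ Finset.range M, 1 / (1 + κ * |((i + 1 : ℕ) : ℝ) - z|) := by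
      rw [Finset.range_eq_Ico, Finset.sum_Ico_add' (fun m : ℕ => 1 / (1 + κ * |(m : ℝ) - z|)) 0 M 1]
      congr 1
    rw [this, hk, Finset.sum_range_add]
    push_cast
    rfl
  rw [e1]
  have b1 : ∑ i ∈ Finset.range n, 1 / (1 + κ * |((i : ℝ) + 1) - z|) ≤ 1 + 1 / κ * Λ := by
    rw [← Finset.sum_range_reflect]
    refine le_trans ?_ ((sum_range_inv_one_add_mul_le hκ (min_le_right ⌊z⌋₊ M) hM).trans
      (by gcongr))
    apply Finset.sum_le_sum
    intro j hj
    have hj' : j < n := Finset.mem_range.1 hj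
    have h1 : ((n - 1 - j : ℕ) : ℝ) = n - 1 - j := by
      have : n - 1 - j + 1 + j = n := by omega
      have : ((n - 1 - j : ℕ) : ℝ) + 1 + j = n := by exact_mod_cast this
      linarith
    have h2 : (n : ℝ) ≤ z := by
      have h3 : n ≤ ⌊z⌋₊ := min_le_left _ _
      have h4 : n ≠ 0 := by omega
      exact (Nat.le_floor_iff' h4).1 h3
    have h5 : (j : ℝ) ≤ |((n - 1 - j : ℕ) : ℝ) + 1 - z| := by
      rw [h1]
      refine le_trans ?_ (neg_le_abs _)
      linarith
    gcongr
  have b2 : ∑ i ∈ Finset.range k, 1 / (1 + κ * |((n : ℝ) + i + 1) - z|) ≤ 1 + 1 / κ * Λ := by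
    refine le_trans ?_ ((sum_range_inv_one_add_mul_le hκ (by omega : k ≤ M) hM).trans
      (by gcongr))
    apply Finset.sum_le_sum
    intro j hj
    have hj' : j < k := Finset.mem_range.1 hj
    have h2 : z ≤ n + 1 := by
      have h3 : n = ⌊z⌋₊ := by
        rcases le_total ⌊z⌋₊ M with h | h
        · rw [hn, min_eq_left h]
        · have : n = M := by rw [hn, min_eq_right h]
          omega
      rw [h3]
      exact (Nat.lt_floor_add_one z).le
    have h5 : (j : ℝ) ≤ |(n : ℝ) + j + 1 - z| := by
      refine le_trans ?_ (le_abs_self _)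
      linarith
    gcongr
  calc _ ≤ (1 + 1 / κ * Λ) + (1 + 1 / κ * Λ) := add_le_add b1 b2
    _ = _ := by ring

lemma sum_inv_sqrt_le (M : ℕ) : ∑ m ∈ Finset.Icc 1 M, 1 / √(m : ℝ) ≤ 2 * √(M : ℝ) := by
  induction M with
  | zero => simp
  | succ n ih =>
    rw [Finset.sum_Icc_succ_top (by omega)]
    refine (add_le_add_left ih _).trans ?_
    push_cast
    have h1 : 0 < √((n : ℝ) + 1) := by positivity
    have h2 : √(n : ℝ) ≤ √((n : ℝ) + 1) := Real.sqrt_le_sqrt (by linarith)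
    have h3 : √((n : ℝ) + 1) * √((n : ℝ) + 1) = n + 1 := Real.mul_self_sqrt (by positivity)
    have h4 : √(n : ℝ) * √(n : ℝ) = n := Real.mul_self_sqrt (by positivity)
    have h5 : 1 / √((n : ℝ) + 1) ≤ 2 * (√((n : ℝ) + 1) - √(n : ℝ)) := by
      rw [div_le_iff₀ h1]
      nlinarith
    linarith

/-- Dirichlet's hyperbola method, with the diagonal split off. -/
lemma sum_d_mul_eq (h : ℕ → ℂ) {a b : ℝ} (ha : 0 ≤ a) {M : ℕ}
    (hM : ∀ m : ℕ, (m : ℝ) ^ 2 ≤ b → m ≤ M) :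
    ∑ k ∈ Finset.Ioc ⌊a⌋₊ ⌊b⌋₊, (d k : ℂ) * h k =
      2 * ∑ m ∈ Finset.Icc 1 M, ∑ n ∈ Finset.Ioc ⌊max (a / m) m⌋₊ ⌊b / m⌋₊, h (m * n) +
      ∑ m ∈ (Finset.Icc 1 M).filter (fun m : ℕ => a < (m : ℝ) ^ 2 ∧ (m : ℝ) ^ 2 ≤ b), h (m * m) := by
  set N := ⌊b⌋₊ with hN
  set S := (Finset.Icc 1 N ×ˢ Finset.Icc 1 N).filter
    (fun x : ℕ × ℕ => x.1 * x.2 ∈ Finset.Ioc ⌊a⌋₊ N) with hS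
  have memS : ∀ x : ℕ × ℕ, x ∈ S ↔ 1 ≤ x.1 ∧ 1 ≤ x.2 ∧ x.1 * x.2 ∈ Finset.Ioc ⌊a⌋₊ N := by
    intro x
    simp only [hS, Finset.mem_filter, Finset.mem_product, Finset.mem_Icc, Finset.mem_Ioc]
    constructor
    · rintro ⟨⟨⟨h1, -⟩, ⟨h2, -⟩⟩, h3⟩
      exact ⟨h1, h2, h3⟩
    · rintro ⟨h1, h2, h3, h4⟩
      exact ⟨⟨⟨h1, (Nat.le_mul_of_pos_right _ h2).trans h4⟩,
        ⟨h2, (Nat.le_mul_of_pos_left _ h1).trans h4⟩⟩, h3, h4⟩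
  have memI : ∀ k : ℕ, 1 ≤ k → (k ∈ Finset.Ioc ⌊a⌋₊ N ↔ a < k ∧ (k : ℝ) ≤ b) := by
    intro k hk
    rw [Finset.mem_Ioc, Nat.floor_lt ha, hN, Nat.le_floor_iff' (by omega)]
  have e1 : ∑ k ∈ Finset.Ioc ⌊a⌋₊ N, (d k : ℂ) * h k = ∑ x ∈ S, h (x.1 * x.2) := by
    rw [← Finset.sum_fiberwise_of_maps_to (s := S) (t := Finset.Ioc ⌊a⌋₊ N)
      (g := fun x : ℕ × ℕ => x.1 * x.2) (fun x hx => ((memS x).1 hx).2.2)]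
    apply Finset.sum_congr rfl
    intro k hk
    have hk0 : k ≠ 0 := by
      have := (Finset.mem_Ioc.1 hk).1
      omega
    have : S.filter (fun x : ℕ × ℕ => x.1 * x.2 = k) = k.divisorsAntidiagonal := by
      ext x
      rw [Finset.mem_filter, memS, Nat.mem_divisorsAntidiagonal]
      constructor
      · rintro ⟨-, h2⟩
        exact ⟨h2, hk0⟩
      · rintro ⟨h2, -⟩
        rw [h2]
        refine ⟨⟨?_, ?_, hk⟩, rfl⟩
        · exact Nat.one_le_iff_ne_zero.2 fun h0 => hk0 (by rw [← h2, h0, zero_mul])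
        · exact Nat.one_le_iff_ne_zero.2 fun h0 => hk0 (by rw [← h2, h0, mul_zero])
    rw [this, Finset.sum_congr rfl (g := fun _ => h k) (fun x hx => by
      rw [(Nat.mem_divisorsAntidiagonal.1 hx).1]), Finset.sum_const, nsmul_eq_mul]
    congr 2
    rw [d, ← Nat.map_div_right_divisors, Finset.card_map]
  have e2 : ∑ x ∈ S, h (x.1 * x.2) = ∑ x ∈ S.filter (fun x => x.1 < x.2), h (x.1 * x.2) +
      (∑ x ∈ S.filter (fun x => x.2 < x.1), h (x.1 * x.2) +
        ∑ x ∈ S.filter (fun x => x.1 = x.2), h (x.1 * x.2)) := by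
    rw [← Finset.sum_filter_add_sum_filter_not S (fun x => x.1 < x.2)]
    congr 1
    rw [← Finset.sum_filter_add_sum_filter_not (S.filter (fun x => ¬ x.1 < x.2))
      (fun x => x.2 < x.1)]
    congr 1
    · apply Finset.sum_congr _ fun _ _ => rfl
      ext x
      simp only [Finset.mem_filter]
      exact ⟨fun h => ⟨h.1.1, h.2⟩, fun h => ⟨⟨h.1, h.2.not_gt⟩, h.2⟩⟩
    · apply Finset.sum_congr _ fun _ _ => rfl
      ext x
      simp only [Finset.mem_filter]
      exact ⟨fun h => ⟨h.1.1, le_antisymm (not_lt.1 h.2) (not_lt.1 h.1.2)⟩,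
        fun h => ⟨⟨h.1, h.2.not_lt⟩, h.2.not_gt⟩⟩
  have e3 : ∑ x ∈ S.filter (fun x => x.2 < x.1), h (x.1 * x.2) =
      ∑ x ∈ S.filter (fun x => x.1 < x.2), h (x.1 * x.2) := by
    apply Finset.sum_bij (fun x _ => x.swap)
    · intro x hx
      rw [Finset.mem_filter, memS] at hx ⊢
      obtain ⟨⟨h1, h2, h3⟩, h4⟩ := hx
      exact ⟨⟨h2, h1, by rw [Prod.fst_swap, Prod.snd_swap, mul_comm]; exact h3⟩, h4⟩
    · intro x _ y _ hxy
      exact Prod.swap_injective hxy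
    · intro x hx
      refine ⟨x.swap, ?_, Prod.swap_swap x⟩
      rw [Finset.mem_filter, memS] at hx ⊢
      obtain ⟨⟨h1, h2, h3⟩, h4⟩ := hx
      exact ⟨⟨h2, h1, by rw [Prod.fst_swap, Prod.snd_swap, mul_comm]; exact h3⟩, h4⟩
    · intro x _
      rw [Prod.fst_swap, Prod.snd_swap, mul_comm]
  have e4 : ∑ x ∈ S.filter (fun x => x.1 < x.2), h (x.1 * x.2) =
      ∑ m ∈ Finset.Icc 1 M, ∑ n ∈ Finset.Ioc ⌊max (a / m) m⌋₊ ⌊b / m⌋₊, h (m * n) := by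
    rw [Finset.sum_finset_product (S.filter (fun x => x.1 < x.2)) (Finset.Icc 1 M)
      (fun m => Finset.Ioc ⌊max (a / m) m⌋₊ ⌊b / m⌋₊)]
    intro x
    obtain ⟨m, n⟩ := x
    rw [Finset.mem_filter, memS]
    simp only [Finset.mem_Icc, Finset.mem_Ioc]
    constructor
    · rintro ⟨⟨h1, h2, h3⟩, h4⟩
      rw [← Finset.mem_Ioc, memI _ (Nat.mul_pos h1 h2)] at h3
      push_cast at h3
      have hm : (0 : ℝ) < m := by exact_mod_cast h1
      have hmn : (m : ℝ) < n := by exact_mod_cast h4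
      refine ⟨⟨h1, hM m ?_⟩, ?_, ?_⟩
      · nlinarith
      · rw [Nat.floor_lt (le_max_of_le_right hm.le), max_lt_iff, div_lt_iff₀ hm]
        exact ⟨by linarith, hmn⟩
      · rw [Nat.le_floor_iff' (by omega), le_div_iff₀ hm]
        linarith
    · rintro ⟨⟨h1, h2⟩, h3, h4⟩
      have hm : (0 : ℝ) < m := by exact_mod_cast h1
      have hn : n ≠ 0 := by omega
      rw [Nat.floor_lt (le_max_of_le_right hm.le), max_lt_iff, div_lt_iff₀ hm] at h3
      rw [Nat.le_floor_iff' hn, le_div_iff₀ hm] at h4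
      refine ⟨⟨h1, by omega, ?_⟩, by exact_mod_cast h3.2⟩
      rw [← Finset.mem_Ioc, memI _ (Nat.mul_pos h1 (by omega))]
      push_cast
      constructor <;> linarith
  have e5 : ∑ x ∈ S.filter (fun x => x.1 = x.2), h (x.1 * x.2) =
      ∑ m ∈ (Finset.Icc 1 M).filter (fun m : ℕ => a < (m : ℝ) ^ 2 ∧ (m : ℝ) ^ 2 ≤ b), h (m * m) := by
    symm
    apply Finset.sum_bij (fun m _ => (m, m))
    · intro m hm
      rw [Finset.mem_filter, Finset.mem_Icc] at hm
      rw [Finset.mem_filter, memS]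
      refine ⟨⟨hm.1.1, hm.1.1, ?_⟩, rfl⟩
      rw [memI _ (Nat.mul_pos hm.1.1 hm.1.1)]
      push_cast
      rw [← pow_two]
      exact hm.2
    · intro x _ y _ hxy
      exact (Prod.mk.inj hxy).1
    · rintro ⟨m, n⟩ hx
      rw [Finset.mem_filter, memS] at hx
      obtain ⟨⟨h1, h2, h3⟩, h4⟩ := hx
      simp only at h1 h2 h3 h4
      subst h4
      rw [memI _ (Nat.mul_pos h1 h1)] at h3
      push_cast at h3
      rw [← pow_two] at h3
      refine ⟨m, ?_, rfl⟩
      rw [Finset.mem_filter, Finset.mem_Icc]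
      exact ⟨⟨h1, hM m h3.2⟩, h3⟩
    · intro m _
      rfl
  rw [e1, e2, e3, e4, e5]
  ring

lemma sqrt_div_one_add_abs_sub_le {y r R : ℝ} (hy : 0 < y) (hr : r ≤ R) :
    √y / (1 + |r - y|) ≤ 2 / √y + √(2 * R) / (1 + |r - y|) := by
  have hsy : 0 < √y := Real.sqrt_pos.2 hy
  have hyy : √y * √y = y := Real.mul_self_sqrt hy.le
  have h0 : 0 ≤ |r - y| := abs_nonneg _
  rcases le_total y (2 * R) with h | h
  · have : √y / (1 + |r - y|) ≤ √(2 * R) / (1 + |r - y|) := by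
      gcongr
    have : 0 ≤ 2 / √y := by positivity
    linarith
  · have h1 : y / 2 ≤ |r - y| := (by linarith : y / 2 ≤ -(r - y)).trans (neg_le_abs _)
    have h2 : √y / (1 + |r - y|) ≤ 2 / √y := by
      rw [div_le_div_iff₀ (by positivity) hsy]
      nlinarith
    have : 0 ≤ √(2 * R) / (1 + |r - y|) := by positivity
    linarith

lemma sqrt_div_one_add_abs_sub_le_of_eq_mul {c w R y r : ℝ} (hc : 0 < c) (hw : 0 < w)
    (hr : r = c * w ^ 2) (hy : y = c * w ^ 3) (hR : r ≤ R) :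
    √y / (1 + |r - y|) ≤ 2 / √y + √(2 * R) / (1 + c / 7 * |w ^ 3 - 1|) := by
  have hy0 : 0 < y := by
    rw [hy]
    positivity
  rcases lt_or_ge w (1 / 2) with h | h
  · have hsy : 0 < √y := Real.sqrt_pos.2 hy0
    have hyy : √y * √y = y := Real.mul_self_sqrt hy0.le
    have h1 : y ≤ |r - y| := by
      refine le_trans ?_ (le_abs_self _)
      rw [hy, hr]
      have : c * w ^ 2 - c * w ^ 3 - c * w ^ 3 = c * (w ^ 2 * (1 - 2 * w)) := by ring
      have h2 : 0 ≤ c * (w ^ 2 * (1 - 2 * w)) := by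
        have : 0 ≤ 1 - 2 * w := by linarith
        positivity
      linarith
    have h2 : √y / (1 + |r - y|) ≤ 2 / √y := by
      rw [div_le_div_iff₀ (by positivity) hsy]
      nlinarith [abs_nonneg (r - y)]
    have : 0 ≤ √(2 * R) / (1 + c / 7 * |w ^ 3 - 1|) := by positivity
    linarith
  · refine (sqrt_div_one_add_abs_sub_le hy0 hR).trans ?_
    have h1 : c / 7 * |w ^ 3 - 1| ≤ |r - y| := by
      have e1 : r - y = c * (w ^ 2 * -(w - 1)) := by
        rw [hr, hy]
        ring
      have e2 : w ^ 3 - 1 = (w ^ 2 + w + 1) * (w - 1) := by ring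
      rw [e1, e2, abs_mul, abs_mul, abs_mul, abs_neg, abs_of_pos hc,
        abs_of_pos (by positivity : 0 < w ^ 2), abs_of_pos (by positivity : 0 < w ^ 2 + w + 1)]
      have h2 : w ^ 2 + w + 1 ≤ 7 * w ^ 2 := by nlinarith
      have h3 : (w ^ 2 + w + 1) * |w - 1| ≤ 7 * w ^ 2 * |w - 1| :=
        mul_le_mul_of_nonneg_right h2 (abs_nonneg _)
      nlinarith
    gcongr

lemma one_div_one_add_abs_max_sub_le (p r y : ℝ) :
    1 / (1 + |max p r - y|) ≤ 1 / (1 + |p - y|) + 1 / (1 + |r - y|) := by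
  have h1 : 0 ≤ 1 / (1 + |p - y|) := by positivity
  have h2 : 0 ≤ 1 / (1 + |r - y|) := by positivity
  rcases max_choice p r with h | h <;> rw [h] <;> linarith

lemma one_div_one_add_abs_mul_sub_le {x t z q lam : ℝ} (hx : 0 < x) (hl : lam ≤ x)
    (hl' : 0 ≤ lam) (hz : x * z = q) : 1 / (1 + |q - x * t|) ≤ 1 / (1 + lam * |t - z|) := by
  have : |q - x * t| = x * |t - z| := by
    rw [← hz, ← mul_sub, abs_mul, abs_of_pos hx, abs_sub_comm]
  rw [this]
  gcongr

/-- The boundary terms of the cube-root sums, decoupled from the square-root amplitude. -/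
lemma cubeRoot_boundary_term_le {A P Q m v r : ℝ} (hA : 0 < A) (hP : 0 < P) (hPQ : P ≤ Q)
    (hQP : Q ≤ 2 * P) (hm : 0 < m) (hv : 0 < v) (hr : 0 < r) (hr3 : r ^ 3 = A * m ^ 2)
    (hrQ : r ≤ Q) :
    √(A * m / v) / v * (1 / (1 + |max P r - A * m / v|) + 1 / (1 + |Q - A * m / v|)) +
        1 / (v * √(A * m / v)) ≤
      7 * (1 / √A * (1 / √v) * (1 / √m)) + 2 * √P * (1 / v) *
        (1 / (1 + A / (7 * v) * |m - v * P / A|) + 1 / (1 + A / (7 * v) * |m - v * Q / A|) +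
          1 / (1 + A / (7 * v) * |m - v ^ 3 / A ^ 2|)) := by
  set y := A * m / v with hy
  have hy0 : 0 < y := by positivity
  have hsy : 0 < √y := Real.sqrt_pos.2 hy0
  have hyx : y = A / v * m := by rw [hy]; ring
  have hlam : A / (7 * v) ≤ A / v := by
    gcongr
    linarith
  have hs : √(2 * Q) ≤ 2 * √P := by
    rw [show 2 * √P = √(4 * P) by
      rw [Real.sqrt_mul (by norm_num), show (4 : ℝ) = 2 ^ 2 by norm_num,
        Real.sqrt_sq (by norm_num)]]
    exact Real.sqrt_le_sqrt (by linarith)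
  have t1 : √y * (1 / (1 + |P - y|)) ≤
      2 / √y + 2 * √P * (1 / (1 + A / (7 * v) * |m - v * P / A|)) := by
    rw [mul_one_div]
    refine (sqrt_div_one_add_abs_sub_le hy0 hPQ).trans ?_
    rw [← mul_one_div (√(2 * Q))]
    have : 1 / (1 + |P - y|) ≤ 1 / (1 + A / (7 * v) * |m - v * P / A|) := by
      rw [hyx]
      exact one_div_one_add_abs_mul_sub_le (by positivity) hlam (by positivity) (by field_simp)
    gcongr
  have t2 : √y * (1 / (1 + |Q - y|)) ≤
      2 / √y + 2 * √P * (1 / (1 + A / (7 * v) * |m - v * Q / A|)) := by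
    rw [mul_one_div]
    refine (sqrt_div_one_add_abs_sub_le hy0 le_rfl).trans ?_
    rw [← mul_one_div (√(2 * Q))]
    have : 1 / (1 + |Q - y|) ≤ 1 / (1 + A / (7 * v) * |m - v * Q / A|) := by
      rw [hyx]
      exact one_div_one_add_abs_mul_sub_le (by positivity) hlam (by positivity) (by field_simp)
    gcongr
  have t3 : √y * (1 / (1 + |r - y|)) ≤
      2 / √y + 2 * √P * (1 / (1 + A / (7 * v) * |m - v ^ 3 / A ^ 2|)) := by
    rw [mul_one_div]
    have hyr : y / r = r ^ 2 * v⁻¹ * m⁻¹ := by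
      rw [hy, div_eq_iff hr.ne']
      field_simp
      linarith
    have hw3 : (y / r) ^ 3 = A ^ 2 * m / v ^ 3 := by
      rw [div_pow, hr3, hy]
      field_simp
    have h := sqrt_div_one_add_abs_sub_le_of_eq_mul (c := v ^ 2 / A) (w := y / r)
      (R := Q) (y := y) (r := r) (by positivity) (by positivity) ?_ ?_ hrQ
    · refine h.trans ?_
      rw [← mul_one_div (√(2 * Q))]
      have e : v ^ 2 / A / 7 * |(y / r) ^ 3 - 1| = A / (7 * v) * |m - v ^ 3 / A ^ 2| := by
        have : (y / r) ^ 3 - 1 = A ^ 2 / v ^ 3 * (m - v ^ 3 / A ^ 2) := by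
          rw [hw3]
          field_simp
        rw [this, abs_mul, abs_of_pos (by positivity)]
        field_simp
      rw [e]
      gcongr
    · rw [div_pow, mul_div_assoc', eq_div_iff (by positivity), hy]
      field_simp
      linarith
    · rw [hw3, hy]
      field_simp
  have e1 : 1 / (v * √y) = 1 / v * (1 / √y) := by field_simp
  have e2 : 1 / √A * (1 / √v) * (1 / √m) = 1 / v * (1 / √y) := by
    rw [hy, Real.sqrt_div (by positivity), Real.sqrt_mul hA.le]
    have : √v * √v = v := Real.mul_self_sqrt hv.le
    have : 0 < √v := Real.sqrt_pos.2 hv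
    have : 0 < √A := Real.sqrt_pos.2 hA
    have : 0 < √m := Real.sqrt_pos.2 hm
    field_simp
    nlinarith
  rw [e1, e2]
  have e3 : √y / v * (1 / (1 + |max P r - y|) + 1 / (1 + |Q - y|)) ≤
      1 / v * (√y * (1 / (1 + |P - y|)) + √y * (1 / (1 + |r - y|)) +
        √y * (1 / (1 + |Q - y|))) := by
    have := one_div_one_add_abs_max_sub_le P r y
    calc _ = 1 / v * (√y * (1 / (1 + |max P r - y|) + 1 / (1 + |Q - y|))) := by ring
      _ ≤ 1 / v * (√y * (1 / (1 + |P - y|) + 1 / (1 + |r - y|) + 1 / (1 + |Q - y|))) := by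
        gcongr
      _ = _ := by ring
  refine (add_le_add_left e3 _).trans ?_
  calc _ ≤ 1 / v * ((2 / √y + 2 * √P * (1 / (1 + A / (7 * v) * |m - v * P / A|))) +
        (2 / √y + 2 * √P * (1 / (1 + A / (7 * v) * |m - v ^ 3 / A ^ 2|))) +
        (2 / √y + 2 * √P * (1 / (1 + A / (7 * v) * |m - v * Q / A|)))) +
        1 / v * (1 / √y) := by gcongr
    _ = _ := by ring

lemma gauss_boundary_term_le {A P Q m v : ℝ} (hA : 0 < A) (hP : 0 < P) (hPQ : P ≤ Q)
    (hQP : Q ≤ 2 * P) (hm : 0 < m) (hv : 0 < v) (hrQ : v ^ 2 / A ≤ Q) :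
    √(m * (v / A)) * (1 / (1 + |max P (v ^ 2 / A) - m * (v / A)|) + 1 / (1 + |Q - m * (v / A)|)) +
        1 / √(m * (v / A)) ≤
      7 * (√A * (1 / √v) * (1 / √m)) + 2 * √P *
        (1 / (1 + v / A * |m - A * P / v|) + 1 / (1 + v / A * |m - A * Q / v|) +
          1 / (1 + v / A * |m - v|)) := by
  set y := m * (v / A) with hy
  have hy0 : 0 < y := by positivity
  have hsy : 0 < √y := Real.sqrt_pos.2 hy0
  have hyx : y = v / A * m := by rw [hy]; ring
  have hs : √(2 * Q) ≤ 2 * √P := by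
    rw [show 2 * √P = √(4 * P) by
      rw [Real.sqrt_mul (by norm_num), show (4 : ℝ) = 2 ^ 2 by norm_num,
        Real.sqrt_sq (by norm_num)]]
    exact Real.sqrt_le_sqrt (by linarith)
  have t : ∀ q z : ℝ, q ≤ Q → v / A * z = q → √y * (1 / (1 + |q - y|)) ≤
      2 / √y + 2 * √P * (1 / (1 + v / A * |m - z|)) := by
    intro q z hq hz
    rw [mul_one_div]
    refine (sqrt_div_one_add_abs_sub_le hy0 hq).trans ?_
    rw [← mul_one_div (√(2 * Q))]
    have : 1 / (1 + |q - y|) ≤ 1 / (1 + v / A * |m - z|) := by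
      rw [hyx]
      exact one_div_one_add_abs_mul_sub_le (by positivity) le_rfl (by positivity) hz
    gcongr
  have t1 := t P (A * P / v) hPQ (by field_simp)
  have t2 := t Q (A * Q / v) le_rfl (by field_simp)
  have t3 := t (v ^ 2 / A) v hrQ (by field_simp)
  have e2 : √A * (1 / √v) * (1 / √m) = 1 / √y := by
    rw [hy, Real.sqrt_mul hm.le, Real.sqrt_div hv.le]
    have : 0 < √v := Real.sqrt_pos.2 hv
    have : 0 < √A := Real.sqrt_pos.2 hA
    have : 0 < √m := Real.sqrt_pos.2 hm
    field_simp
  rw [e2]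
  have e3 : √y * (1 / (1 + |max P (v ^ 2 / A) - y|) + 1 / (1 + |Q - y|)) ≤
      √y * (1 / (1 + |P - y|)) + √y * (1 / (1 + |v ^ 2 / A - y|)) +
        √y * (1 / (1 + |Q - y|)) := by
    have := one_div_one_add_abs_max_sub_le P (v ^ 2 / A) y
    rw [← mul_add, ← mul_add]
    gcongr
  refine (add_le_add_left e3 _).trans ?_
  calc _ ≤ ((2 / √y + 2 * √P * (1 / (1 + v / A * |m - A * P / v|))) +
        (2 / √y + 2 * √P * (1 / (1 + v / A * |m - v|))) +
        (2 / √y + 2 * √P * (1 / (1 + v / A * |m - A * Q / v|)))) +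
        1 / √y := by gcongr
    _ = _ := by ring

/-- The normalised summand `(Ak)^{-1/6} e(3/2 (Ak)^{2/3})`. -/
noncomputable def cubeRootTerm (A : ℝ) (k : ℕ) : ℂ :=
  (((A * k) ^ (-(1 : ℝ) / 6) : ℝ) : ℂ) * unitExp (3 / 2 * (A * k) ^ ((2 : ℝ) / 3))

/-- The normalised dual summand `(k/A)^{1/2} e(-(k/A)²/2)`. -/
noncomputable def gaussTerm (A : ℝ) (k : ℕ) : ℂ :=
  (√(k / A) : ℂ) * unitExp (-((k / A) ^ 2 / 2))

/-- The intermediate summand produced by the first Poisson summation. -/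
noncomputable def chirpTerm (A : ℝ) (v m : ℕ) : ℂ :=
  unitExp (-(1 / 8)) * ((√3 * (√A / (v * √v)) : ℝ) : ℂ) *
    ((√(m : ℝ) : ℂ) * unitExp ((m : ℝ) ^ 2 / (2 * (v / A) ^ 2)))

lemma exists_pos_cube_eq {x : ℝ} (hx : 0 < x) : ∃ r : ℝ, 0 < r ∧ r ^ 3 = x :=
  ⟨x ^ ((1 : ℝ) / 3), by positivity, by
    rw [← Real.rpow_natCast, ← Real.rpow_mul hx.le]
    norm_num⟩

lemma max_pow_three {x y : ℝ} (hx : 0 < x) (hy : 0 < y) : max x y ^ 3 = max (x ^ 3) (y ^ 3) := by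
  rcases le_total x y with h | h
  · rw [max_eq_right h, max_eq_right (by gcongr)]
  · rw [max_eq_left h, max_eq_left (by gcongr)]

lemma norm_sum_cubeRootTerm_row_sub_le {A P Q Λ : ℝ} (hA : 0 < A) (hP : 0 < P) (hPQ : P ≤ Q)
    (hQP : Q ≤ 2 * P) {m V : ℕ} (hm : 1 ≤ m) (hmQ : (m : ℝ) ^ 2 ≤ Q ^ 3 / A) (hV1 : 1 ≤ V)
    (hV : 8 * √(A * Q) ≤ V) (hlV : Real.log (V + 2) ≤ Λ) :
    ‖∑ n ∈ Finset.Ioc ⌊max (P ^ 3 / A / m) m⌋₊ ⌊Q ^ 3 / A / m⌋₊, cubeRootTerm A (m * n) -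
      ∑ v ∈ Finset.Icc 1 V, (if v / A * max P (v ^ 2 / A) < m ∧ m ≤ v / A * Q then
        chirpTerm A v m else 0)‖ ≤
      48 / √P * Λ + 2 * √Q / A * (1 / m) + ∑ v ∈ Finset.Icc 1 V,
        24 * (7 * (1 / √A * (1 / √v) * (1 / √m)) + 2 * √P * (1 / v) *
        (1 / (1 + A / (7 * v) * |m - v * P / A|) + 1 / (1 + A / (7 * v) * |m - v * Q / A|) +
          1 / (1 + A / (7 * v) * |m - v ^ 3 / A ^ 2|))) := by
  have hm0 : (0 : ℝ) < m := by exact_mod_cast hm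
  have hm1 : (1 : ℝ) ≤ m := by exact_mod_cast hm
  obtain ⟨r, hr, hr3⟩ := exists_pos_cube_eq (x := A * (m : ℝ) ^ 2) (by positivity)
  have hQ : 0 < Q := hP.trans_le hPQ
  have hrQ : r ≤ Q := by
    rw [le_div_iff₀ hA] at hmQ
    refine le_of_pow_le_pow_left₀ (n := 3) (by norm_num) hQ.le ?_
    rw [hr3]
    linarith
  have hB : 0 < A * m := by positivity
  have hs : 0 < max P r := lt_max_of_lt_left hP
  have hBs : A * m ≤ max P r ^ 3 := by
    rw [max_pow_three hP hr, hr3]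
    refine le_max_of_le_right ?_
    have : (m : ℝ) ≤ (m : ℝ) ^ 2 := by nlinarith
    gcongr
  have hVs : 8 * (A * m / max P r) ≤ V := by
    refine le_trans ?_ hV
    have h1 : A * m / max P r ≤ A * m / r := by
      gcongr
      exact le_max_right _ _
    have h2 : A * m / r ≤ √(A * Q) := by
      refine Real.le_sqrt_of_sq_le ?_
      rw [div_pow, show (A * m : ℝ) ^ 2 = A * (A * (m : ℝ) ^ 2) by ring, ← hr3]
      have : A * r ^ 3 / r ^ 2 = A * r := by field_simp
      rw [this]
      gcongr
    linarith
  have key := norm_sum_cubeRoot_phase_sub_le hB hs (max_le hPQ hrQ) hBs hV1 hVs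
  have e1 : max P r ^ 3 / (A * m) = max (P ^ 3 / A / m) m := by
    rw [max_pow_three hP hr, hr3, ← max_div_div_right hB.le, div_div]
    congr 1
    field_simp
  have e2 : ∀ n : ℕ, (((A * m * n) ^ (-(1 : ℝ) / 6) : ℝ) : ℂ) *
      unitExp (3 / 2 * (A * m * n) ^ ((2 : ℝ) / 3)) = cubeRootTerm A (m * n) := by
    intro n
    unfold cubeRootTerm
    push_cast
    rw [mul_assoc]
  have e3 : ∑ v ∈ Finset.Icc 1 V, (if max P r < A * m / v ∧ A * m / v ≤ Q then
        unitExp (-(1 / 8)) * ((√3 * (√(A * m / v) / v) : ℝ) : ℂ) *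
          unitExp ((A * m / v) ^ 2 / 2) else 0) =
      ∑ v ∈ Finset.Icc 1 V, (if v / A * max P (v ^ 2 / A) < m ∧ m ≤ v / A * Q then
        chirpTerm A v m else 0) := by
    apply Finset.sum_congr rfl
    intro v hv
    have hv0 : (0 : ℝ) < v := by exact_mod_cast (Finset.mem_Icc.1 hv).1
    have hc : (max P r < A * m / v ∧ A * m / v ≤ Q) ↔
        (v / A * max P (v ^ 2 / A) < m ∧ m ≤ v / A * Q) := by
      have h1 : ∀ x : ℝ, v / A * x < m ↔ x < A * m / v := by
        intro x
        rw [div_mul_eq_mul_div, div_lt_iff₀ hA, lt_div_iff₀ hv0, mul_comm (v : ℝ), mul_comm A]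
      have h2 : A * m / v ≤ Q ↔ m ≤ v / A * Q := by
        rw [← not_lt, ← h1, not_lt]
      have h3 : r < A * m / v ↔ (v : ℝ) ^ 2 / A < A * m / v := by
        have : r < A * m / v ↔ r ^ 3 < (A * m / v) ^ 3 :=
          (pow_lt_pow_iff_left₀ hr.le (by positivity) (by norm_num)).symm
        rw [this, hr3, div_pow, lt_div_iff₀ (by positivity), div_lt_div_iff₀ hA hv0]
        have : (A * m) ^ 3 - A * (m : ℝ) ^ 2 * v ^ 3 =
          A * (m : ℝ) ^ 2 * (A * m * A - v ^ 2 * v) := by ring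
        have hp : 0 < A * (m : ℝ) ^ 2 := by positivity
        rw [← sub_pos, this, mul_pos_iff_of_pos_left hp, sub_pos]
      rw [h2, h1, max_lt_iff, max_lt_iff, h3]
    have ht : unitExp (-(1 / 8)) * ((√3 * (√(A * m / v) / v) : ℝ) : ℂ) *
          unitExp ((A * m / v) ^ 2 / 2) = chirpTerm A v m := by
      unfold chirpTerm
      have h1 : √(A * m / v) / v = √A / (v * √v) * √m := by
        rw [Real.sqrt_div (by positivity), Real.sqrt_mul hA.le]
        have : 0 < √(v : ℝ) := Real.sqrt_pos.2 hv0
        field_simp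
      have h2 : (A * m / v) ^ 2 / 2 = (m : ℝ) ^ 2 / (2 * (v / A) ^ 2) := by
        field_simp
      rw [h1, h2]
      push_cast
      ring
    rw [ht]
    exact if_congr hc rfl rfl
  rw [e1, show Q ^ 3 / (A * m) = Q ^ 3 / A / m by rw [div_div], e3] at key
  simp only [e2] at key
  refine key.trans ?_
  have b1 : 48 / √(max P r) * Real.log (V + 2) ≤ 48 / √P * Λ := by
    have : √P ≤ √(max P r) := Real.sqrt_le_sqrt (le_max_left _ _)
    have h0 : 0 < √P := Real.sqrt_pos.2 hP
    have h1 : 0 ≤ Real.log (V + 2) :=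
      Real.log_nonneg (by linarith [(Nat.cast_nonneg V : (0 : ℝ) ≤ V)])
    gcongr
  have b2 : 2 * (√Q / (A * m)) = 2 * √Q / A * (1 / m) := by field_simp
  rw [b2]
  refine add_le_add (add_le_add b1 le_rfl) (Finset.sum_le_sum fun v hv => ?_)
  have hv0 : (0 : ℝ) < v := by exact_mod_cast (Finset.mem_Icc.1 hv).1
  exact mul_le_mul_of_nonneg_left
    (cubeRoot_boundary_term_le hA hP hPQ hQP hm0 hv0 hr hr3 hrQ) (by norm_num)

lemma sum_chirpTerm_swap {A P Q : ℝ} (hA : 0 < A) (hP : 0 < P) (hQ : 0 < Q) {V : ℕ}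
    (hV : √(A * Q) ≤ V) :
    ∑ m ∈ Finset.Icc 1 ⌊√(Q ^ 3 / A)⌋₊, ∑ v ∈ Finset.Icc 1 V,
      (if v / A * max P (v ^ 2 / A) < m ∧ m ≤ v / A * Q then chirpTerm A v m else 0) =
    ∑ v ∈ Finset.Icc 1 ⌊√(A * Q)⌋₊,
      ∑ m ∈ Finset.Ioc ⌊v / A * max P (v ^ 2 / A)⌋₊ ⌊v / A * Q⌋₊, chirpTerm A v m := by
  rw [Finset.sum_comm]
  have e1 : ∀ v ∈ Finset.Icc 1 V, ∑ m ∈ Finset.Icc 1 ⌊√(Q ^ 3 / A)⌋₊,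
      (if v / A * max P (v ^ 2 / A) < m ∧ m ≤ v / A * Q then chirpTerm A v m else 0) =
      ∑ m ∈ Finset.Ioc ⌊v / A * max P (v ^ 2 / A)⌋₊ ⌊v / A * Q⌋₊, chirpTerm A v m := by
    intro v hv
    have hv0 : (0 : ℝ) < v := by exact_mod_cast (Finset.mem_Icc.1 hv).1
    rw [← Finset.sum_filter]
    apply Finset.sum_congr _ fun _ _ => rfl
    ext m
    have hpos : 0 ≤ v / A * max P (v ^ 2 / A) :=
      mul_nonneg (by positivity) (le_max_of_le_left hP.le)
    rw [Finset.mem_filter, Finset.mem_Icc, Finset.mem_Ioc, Nat.floor_lt hpos]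
    constructor
    · rintro ⟨⟨h1, -⟩, h3, h4⟩
      exact ⟨h3, (Nat.le_floor_iff' (by omega)).2 h4⟩
    · rintro ⟨h1, h2⟩
      have hm0 : (0 : ℝ) < m := hpos.trans_lt h1
      have hm1 : 1 ≤ m := by exact_mod_cast hm0
      rw [Nat.le_floor_iff' (by omega)] at h2
      refine ⟨⟨hm1, (Nat.le_floor_iff' (by omega)).2 (Real.le_sqrt_of_sq_le ?_)⟩, h1, h2⟩
      rw [le_div_iff₀ hA]
      have h3 : v / A * (v ^ 2 / A) < m :=
        (mul_le_mul_of_nonneg_left (le_max_right _ _) (by positivity)).trans_lt h1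
      have h4 : (m : ℝ) ^ 3 ≤ (v / A * Q) ^ 3 := by gcongr
      have h5 : (v / A * Q) ^ 3 = v / A * (v ^ 2 / A) * (Q ^ 3 / A) := by field_simp
      have h6 : v / A * (v ^ 2 / A) * (Q ^ 3 / A) ≤ m * (Q ^ 3 / A) := by gcongr
      have h7 : (m : ℝ) * m ^ 2 ≤ m * (Q ^ 3 / A) := by
        calc _ = (m : ℝ) ^ 3 := by ring
          _ ≤ _ := by linarith
      have h8 : (m : ℝ) ^ 2 ≤ Q ^ 3 / A := le_of_mul_le_mul_left h7 hm0
      rwa [le_div_iff₀ hA] at h8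
  rw [Finset.sum_congr rfl e1]
  symm
  apply Finset.sum_subset
  · exact Finset.Icc_subset_Icc le_rfl (Nat.floor_le_of_le hV)
  · intro v hv hv'
    rw [Finset.mem_Icc] at hv hv'
    have hv0 : (0 : ℝ) < v := by exact_mod_cast hv.1
    have h1 : √(A * Q) < v := (Nat.floor_lt (Real.sqrt_nonneg _)).1 (by omega)
    rw [Real.sqrt_lt' hv0] at h1
    have h2 : Q ≤ max P (v ^ 2 / A) := by
      refine le_max_of_le_right ?_
      rw [le_div_iff₀ hA]
      linarith
    rw [Finset.Ioc_eq_empty_of_le, Finset.sum_empty]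
    gcongr

lemma norm_sum_cubeRootTerm_sub_chirpTerm_le {A P Q Λ : ℝ} (hA : 0 < A) (hP : 0 < P)
    (hPQ : P ≤ Q) (hQP : Q ≤ 2 * P) {V : ℕ} (hV1 : 1 ≤ V)
    (hV : 8 * √(A * Q) ≤ V) (hlV : Real.log (V + 2) ≤ Λ) (hlV' : 1 + Real.log V ≤ Λ)
    (hlM : 1 + Real.log ⌊√(Q ^ 3 / A)⌋₊ ≤ Λ) :
    ‖∑ m ∈ Finset.Icc 1 ⌊√(Q ^ 3 / A)⌋₊,
        ∑ n ∈ Finset.Ioc ⌊max (P ^ 3 / A / m) m⌋₊ ⌊Q ^ 3 / A / m⌋₊, cubeRootTerm A (m * n) -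
      ∑ v ∈ Finset.Icc 1 ⌊√(A * Q)⌋₊,
        ∑ m ∈ Finset.Ioc ⌊v / A * max P (v ^ 2 / A)⌋₊ ⌊v / A * Q⌋₊, chirpTerm A v m‖ ≤
      48 / √P * Λ * ⌊√(Q ^ 3 / A)⌋₊ + 2 * √Q / A * Λ +
        24 * (28 * (1 / √A * √(V : ℝ) * √(⌊√(Q ^ 3 / A)⌋₊ : ℝ)) +
          2 * √P * (6 * Λ + 42 * V * Λ / A)) := by
  have hQ : 0 < Q := hP.trans_le hPQ
  have hsA : 0 < √A := Real.sqrt_pos.2 hA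
  have hV' : √(A * Q) ≤ V := by linarith [Real.sqrt_nonneg (A * Q)]
  rw [← sum_chirpTerm_swap hA hP hQ hV', ← Finset.sum_sub_distrib]
  set M := ⌊√(Q ^ 3 / A)⌋₊ with hM
  refine (norm_sum_le _ _).trans ((Finset.sum_le_sum fun m hm => ?_).trans
    (b := ∑ m ∈ Finset.Icc 1 M, (48 / √P * Λ + 2 * √Q / A * (1 / m) + ∑ v ∈ Finset.Icc 1 V,
        24 * (7 * (1 / √A * (1 / √v) * (1 / √m)) + 2 * √P * (1 / v) *
        (1 / (1 + A / (7 * v) * |m - v * P / A|) + 1 / (1 + A / (7 * v) * |m - v * Q / A|) +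
          1 / (1 + A / (7 * v) * |m - v ^ 3 / A ^ 2|))))) ?_)
  · rw [Finset.mem_Icc] at hm
    refine norm_sum_cubeRootTerm_row_sub_le hA hP hPQ hQP hm.1 ?_ hV1 hV hlV
    have h1 : (m : ℝ) ≤ √(Q ^ 3 / A) :=
      (Nat.cast_le.2 hm.2).trans (Nat.floor_le (Real.sqrt_nonneg _))
    calc (m : ℝ) ^ 2 ≤ √(Q ^ 3 / A) ^ 2 := by gcongr
      _ = _ := Real.sq_sqrt (by positivity)
  · rw [Finset.sum_add_distrib, Finset.sum_add_distrib, Finset.sum_const, Nat.card_Icc,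
      nsmul_eq_mul, Nat.add_sub_cancel, ← Finset.mul_sum, Finset.sum_comm]
    have b1 : ∑ m ∈ Finset.Icc 1 M, 1 / (m : ℝ) ≤ Λ := (sum_Icc_inv_le_one_add_log M).trans hlM
    have b2 : ∑ v ∈ Finset.Icc 1 V, 1 / (v : ℝ) ≤ Λ := (sum_Icc_inv_le_one_add_log V).trans hlV'
    have b3 : ∀ v ∈ Finset.Icc 1 V, ∑ m ∈ Finset.Icc 1 M,
        24 * (7 * (1 / √A * (1 / √v) * (1 / √m)) + 2 * √P * (1 / v) *
        (1 / (1 + A / (7 * v) * |(m : ℝ) - v * P / A|) +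
          1 / (1 + A / (7 * v) * |(m : ℝ) - v * Q / A|) +
          1 / (1 + A / (7 * v) * |(m : ℝ) - v ^ 3 / A ^ 2|))) ≤
        24 * (14 * (1 / √A * √(M : ℝ)) * (1 / √(v : ℝ)) + 2 * √P * (6 * (1 / v) + 42 * Λ / A)) := by
      intro v hv
      have hv0 : (0 : ℝ) < v := by exact_mod_cast (Finset.mem_Icc.1 hv).1
      have hsv : 0 < √(v : ℝ) := Real.sqrt_pos.2 hv0
      have hk : 0 < A / (7 * v) := by positivity
      rw [← Finset.mul_sum, Finset.sum_add_distrib, ← Finset.mul_sum, ← Finset.mul_sum,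
        ← Finset.mul_sum, Finset.sum_add_distrib, Finset.sum_add_distrib]
      have c0 := sum_inv_sqrt_le M
      have c1 := sum_inv_one_add_mul_abs_sub_le hk (v * P / A) hlM
      have c2 := sum_inv_one_add_mul_abs_sub_le hk (v * Q / A) hlM
      have c3 := sum_inv_one_add_mul_abs_sub_le hk (v ^ 3 / A ^ 2) hlM
      calc _ ≤ 24 * (7 * (1 / √A * (1 / √v) * (2 * √(M : ℝ))) + 2 * √P * (1 / v) *
            ((2 + 2 / (A / (7 * v)) * Λ) + (2 + 2 / (A / (7 * v)) * Λ) +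
              (2 + 2 / (A / (7 * v)) * Λ))) := by gcongr
        _ = _ := by
          field_simp
          ring
    have b4 := Finset.sum_le_sum b3
    rw [← Finset.mul_sum, Finset.sum_add_distrib, ← Finset.mul_sum, ← Finset.mul_sum,
      Finset.sum_add_distrib, ← Finset.mul_sum, Finset.sum_const, Nat.card_Icc,
      nsmul_eq_mul, Nat.add_sub_cancel] at b4
    have b5 := sum_inv_sqrt_le V
    calc _ ≤ M * (48 / √P * Λ) + 2 * √Q / A * Λ + 24 * (14 * (1 / √A * √(M : ℝ)) * (2 * √(V : ℝ)) +
          2 * √P * (6 * Λ + V * (42 * Λ / A))) := by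
          refine add_le_add (by gcongr) (b4.trans ?_)
          gcongr
      _ = _ := by ring

set_option maxHeartbeats 1000000 in
lemma norm_sum_chirpTerm_sub_gaussTerm_row_le {A P Q Λ : ℝ} (hA : 0 < A) (hP : 0 < P)
    (hPQ : P ≤ Q) (hQP : Q ≤ 2 * P) {v : ℕ} (hv : 1 ≤ v) (hvQ : (v : ℝ) ^ 2 ≤ A * Q)
    (hΛ : 1 + Real.log (5 * (A * Q) + 2) ≤ Λ) :
    ‖∑ m ∈ Finset.Ioc ⌊v / A * max P (v ^ 2 / A)⌋₊ ⌊v / A * Q⌋₊, chirpTerm A v m -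
      ((√3 / A : ℝ) : ℂ) * ∑ n ∈ Finset.Ioc ⌊max (A * P / v) v⌋₊ ⌊A * Q / v⌋₊,
        gaussTerm A (v * n)‖ ≤
      √3 * ((432 * √Q * Λ + 96 * √P * Λ) * (1 / v) + (2 / (A * √P) + 96 * √P / A)) := by
  have hQ : 0 < Q := hP.trans_le hPQ
  have hsA : 0 < √A := Real.sqrt_pos.2 hA
  have hsP : 0 < √P := Real.sqrt_pos.2 hP
  have hsQ : 0 < √Q := Real.sqrt_pos.2 hQ
  have hAA : √A * √A = A := Real.mul_self_sqrt hA.le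
  have hv0 : (0 : ℝ) < v := by exact_mod_cast hv
  have hv1 : (1 : ℝ) ≤ v := by exact_mod_cast hv
  have hsv : 0 < √(v : ℝ) := Real.sqrt_pos.2 hv0
  have hvv : √(v : ℝ) * √(v : ℝ) = v := Real.mul_self_sqrt hv0.le
  have hrQ : (v : ℝ) ^ 2 / A ≤ Q := by
    rw [div_le_iff₀ hA]
    linarith
  set ω : ℝ := v / A with hω
  have hω0 : 0 < ω := by positivity
  set r := max P ((v : ℝ) ^ 2 / A) with hr
  have hr0 : 0 < r := lt_max_of_lt_left hP
  have hone : 1 ≤ A * Q / v := by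
    rw [one_le_div hv0]
    nlinarith
  set V := ⌈4 * (Q / ω)⌉₊ with hV
  have hQω : Q / ω = A * Q / v := by
    rw [hω]
    field_simp
  have hV1 : 1 ≤ V := by
    rw [hV, Nat.one_le_ceil_iff]
    positivity
  have hVle : (V : ℝ) ≤ 5 * (A * Q / v) := by
    have := Nat.ceil_lt_add_one (by positivity : 0 ≤ 4 * (Q / ω))
    rw [← hV] at this
    rw [← hQω] at hone ⊢
    linarith
  have hVle' : (V : ℝ) ≤ 5 * (A * Q) := by
    refine hVle.trans ?_
    gcongr
    exact div_le_self (by positivity) hv1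
  have hV0 : (1 : ℝ) ≤ V := by exact_mod_cast hV1
  have hlV : Real.log (V + 2) ≤ Λ := by
    have := Real.log_le_log (by positivity) (by linarith : (V : ℝ) + 2 ≤ 5 * (A * Q) + 2)
    linarith
  have hlV' : 1 + Real.log V ≤ Λ := by
    have := Real.log_le_log (by positivity) (by linarith : (V : ℝ) ≤ 5 * (A * Q) + 2)
    linarith
  have hΛ1 : 1 ≤ Λ := by linarith [Real.log_nonneg hV0]
  have key := norm_sum_sqrt_gauss_sub_le hω0 hr0 (max_le hPQ hrQ) hV1 (Nat.le_ceil (4 * (Q / ω)))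
  set s : ℝ := √3 * (√A / (v * √v)) with hs
  have hs0 : 0 < s := by positivity
  have e1 : ∑ m ∈ Finset.Ioc ⌊ω * r⌋₊ ⌊ω * Q⌋₊, chirpTerm A v m = unitExp (-(1 / 8)) * (s : ℂ) *
      ∑ m ∈ Finset.Ioc ⌊ω * r⌋₊ ⌊ω * Q⌋₊, (√(m : ℝ) : ℂ) * unitExp ((m : ℝ) ^ 2 / (2 * ω ^ 2)) := by
    rw [Finset.mul_sum]
    rfl
  have e2 : ((√3 / A : ℝ) : ℂ) * ∑ n ∈ Finset.Ioc ⌊max (A * P / v) v⌋₊ ⌊A * Q / v⌋₊,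
        gaussTerm A (v * n) = unitExp (-(1 / 8)) * (s : ℂ) *
      ∑ μ ∈ Finset.Icc 1 V, (if r < μ * ω ∧ μ * ω ≤ Q then
        unitExp (1 / 8) * ((ω ^ 2 * √μ : ℝ) : ℂ) * unitExp (-((μ * ω) ^ 2 / 2)) else 0) := by
    rw [← Finset.sum_filter, Finset.mul_sum, Finset.mul_sum]
    apply Finset.sum_congr
    · ext n
      have h1 : ∀ x : ℝ, x < n * ω ↔ A * x / v < n := by
        intro x
        rw [hω, mul_div_assoc', lt_div_iff₀ hA, div_lt_iff₀ hv0, mul_comm x]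
      have h2 : max (A * P / v) v = A * r / v := by
        rw [hr, mul_max_of_nonneg _ _ hA.le, ← max_div_div_right hv0.le]
        congr 1
        field_simp
      rw [Finset.mem_filter, Finset.mem_Icc, Finset.mem_Ioc, Nat.floor_lt (by positivity),
        ← not_lt (a := Q), h1, h1, not_lt, h2]
      constructor
      · rintro ⟨h3, h4⟩
        have h5 : n ≠ 0 := by
          rintro rfl
          have : 0 < A * r / v := by positivity
          rw [Nat.cast_zero] at h3
          linarith
        rw [Nat.le_floor_iff' h5] at h4
        refine ⟨⟨by omega, ?_⟩, h3, h4⟩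
        have : (n : ℝ) ≤ V := h4.trans ((by rw [← hQω] at hone ⊢; linarith :
          A * Q / v ≤ 4 * (Q / ω)).trans (Nat.le_ceil _))
        exact_mod_cast this
      · rintro ⟨⟨h3, h4⟩, h5, h6⟩
        exact ⟨h5, (Nat.le_floor_iff' (by omega)).2 h6⟩
    · intro n _
      unfold gaussTerm
      have h1 : unitExp (-(1 / 8)) * unitExp (1 / 8) = 1 := by
        rw [← unitExp_add]
        norm_num [unitExp_zero]
      have h2 : s * (ω ^ 2 * √n) = √3 / A * √(((v * n : ℕ) : ℝ) / A) := by
        rw [hs, hω, Nat.cast_mul, Real.sqrt_div (by positivity), Real.sqrt_mul hv0.le]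
        field_simp
        rw [pow_two √(v : ℝ), hvv, pow_two √A, hAA]
        ring
      have h3 : (n * ω) ^ 2 / 2 = (((v * n : ℕ) : ℝ) / A) ^ 2 / 2 := by
        rw [hω, Nat.cast_mul]
        ring
      rw [h3]
      calc _ = ((√3 / A * √(((v * n : ℕ) : ℝ) / A) : ℝ) : ℂ) *
            unitExp (-((((v * n : ℕ) : ℝ) / A) ^ 2 / 2)) := by
            push_cast
            ring
        _ = (unitExp (-(1 / 8)) * unitExp (1 / 8)) * ((s * (ω ^ 2 * √n) : ℝ) : ℂ) *
            unitExp (-((((v * n : ℕ) : ℝ) / A) ^ 2 / 2)) := by rw [h1, h2, one_mul]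
        _ = _ := by
            push_cast
            ring
  rw [e1, e2, ← mul_sub, norm_mul, norm_mul, norm_unitExp, one_mul, Complex.norm_real,
    Real.norm_of_nonneg hs0.le]
  refine (mul_le_mul_of_nonneg_left key hs0.le).trans ?_
  rw [mul_add, mul_add, Finset.mul_sum]
  have t1 : s * (48 * √(ω * Q) * Real.log (V + 2)) ≤ √3 * (48 * √Q * Λ * (1 / v)) := by
    have : s * (48 * √(ω * Q) * Λ) = √3 * (48 * √Q * Λ * (1 / v)) := by
      rw [hs, hω, Real.sqrt_mul (by positivity), Real.sqrt_div hv0.le]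
      field_simp
    rw [← this]
    gcongr
  have t2 : s * (2 * (ω ^ 2 / √(ω * r))) ≤ √3 * (2 / (A * √P)) := by
    have : s * (2 * (ω ^ 2 / √(ω * P))) = √3 * (2 / (A * √P)) := by
      rw [hs, hω, Real.sqrt_mul (by positivity), Real.sqrt_div hv0.le]
      field_simp
      rw [pow_two √(v : ℝ), hvv, pow_two √A, hAA]
      field_simp
    rw [← this]
    have : P ≤ r := le_max_left _ _
    gcongr
  have t3 : ∀ μ ∈ Finset.Icc 1 V,
      s * (8 * (ω ^ 2 * √μ * (1 / (1 + |r - μ * ω|) + 1 / (1 + |Q - μ * ω|)) + ω / √μ)) ≤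
      √3 * (8 / A) * (7 * (√A * (1 / √v) * (1 / √μ)) + 2 * √P *
        (1 / (1 + ω * |(μ : ℝ) - A * P / v|) + 1 / (1 + ω * |(μ : ℝ) - A * Q / v|) +
          1 / (1 + ω * |(μ : ℝ) - v|))) := by
    intro μ hμ
    have hμ0 : (0 : ℝ) < μ := by exact_mod_cast (Finset.mem_Icc.1 hμ).1
    have hsμ : 0 < √(μ : ℝ) := Real.sqrt_pos.2 hμ0
    have hμμ : √(μ : ℝ) * √(μ : ℝ) = μ := Real.mul_self_sqrt hμ0.le
    have hb := gauss_boundary_term_le hA hP hPQ hQP hμ0 hv0 hrQ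
    refine le_trans (le_of_eq ?_) (mul_le_mul_of_nonneg_left hb (by positivity))
    have h2 : s * (ω ^ 2 * √μ) = √3 / A * √(μ * (v / A)) := by
      rw [hs, hω, Real.sqrt_mul hμ0.le, Real.sqrt_div hv0.le]
      field_simp
      rw [pow_two √(v : ℝ), hvv, pow_two √A, hAA]
      ring
    have h3 : s * (ω / √μ) = √3 / A * (1 / √(μ * (v / A))) := by
      rw [hs, hω, Real.sqrt_mul hμ0.le, Real.sqrt_div hv0.le]
      field_simp
    calc _ = 8 * (s * (ω ^ 2 * √μ) * (1 / (1 + |r - μ * ω|) + 1 / (1 + |Q - μ * ω|)) +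
          s * (ω / √μ)) := by ring
      _ = _ := by
        rw [h2, h3]
        ring
  have t4 : ∑ μ ∈ Finset.Icc 1 V,
      s * (8 * (ω ^ 2 * √μ * (1 / (1 + |r - μ * ω|) + 1 / (1 + |Q - μ * ω|)) + ω / √μ)) ≤
      √3 * (384 * √Q * Λ * (1 / v) + 96 * √P / A + 96 * √P * Λ * (1 / v)) := by
    refine (Finset.sum_le_sum t3).trans ?_
    rw [← Finset.mul_sum, Finset.sum_add_distrib, ← Finset.mul_sum, ← Finset.mul_sum,
        ← Finset.mul_sum, Finset.sum_add_distrib, Finset.sum_add_distrib]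
    have c0 : ∑ μ ∈ Finset.Icc 1 V, 1 / √(μ : ℝ) ≤ 2 * (16 / 7 * (√A * √Q / √v)) := by
      refine (sum_inv_sqrt_le V).trans ?_
      gcongr
      refine Real.sqrt_le_iff.2 ⟨by positivity, hVle.trans ?_⟩
      rw [mul_pow, div_pow (√A * √Q), mul_pow √A, Real.sq_sqrt hA.le, Real.sq_sqrt hQ.le, Real.sq_sqrt hv0.le]
      have : 0 ≤ A * Q / v := by positivity
      nlinarith
    have c1 := sum_inv_one_add_mul_abs_sub_le hω0 (A * P / v) hlV'
    have c2 := sum_inv_one_add_mul_abs_sub_le hω0 (A * Q / v) hlV'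
    have c3 := sum_inv_one_add_mul_abs_sub_le hω0 (v : ℝ) hlV'
    calc _ ≤ √3 * (8 / A) * (7 * (√A * (1 / √v) * (2 * (16 / 7 * (√A * √Q / √v)))) + 2 * √P *
          ((2 + 2 / ω * Λ) + (2 + 2 / ω * Λ) + (2 + 2 / ω * Λ))) := by gcongr
      _ = √3 * (256 * √Q * 1 * (1 / v) + 96 * √P / A + 96 * √P * Λ * (1 / v)) := by
        have : √A * (1 / √v) * (2 * (16 / 7 * (√A * √Q / √v))) = 32 / 7 * (A * √Q / v) := by
          field_simp
          rw [pow_two √(v : ℝ), hvv, pow_two √A, hAA]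
          field_simp
          ring
        rw [this, hω]
        field_simp
        ring
      _ ≤ _ := by gcongr; norm_num
  calc _ ≤ √3 * (48 * √Q * Λ * (1 / v)) + √3 * (2 / (A * √P)) +
        √3 * (384 * √Q * Λ * (1 / v) + 96 * √P / A + 96 * √P * Λ * (1 / v)) :=
        add_le_add (add_le_add t1 t2) t4
    _ = _ := by ring

lemma norm_sum_chirpTerm_sub_gaussTerm_le {A P Q Λ : ℝ} (hA : 0 < A) (hP : 0 < P)
    (hPQ : P ≤ Q) (hQP : Q ≤ 2 * P) (hΛ : 1 + Real.log (5 * (A * Q) + 2) ≤ Λ)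
    (hlM : 1 + Real.log ⌊√(A * Q)⌋₊ ≤ Λ) :
    ‖∑ v ∈ Finset.Icc 1 ⌊√(A * Q)⌋₊,
        ∑ m ∈ Finset.Ioc ⌊v / A * max P (v ^ 2 / A)⌋₊ ⌊v / A * Q⌋₊, chirpTerm A v m -
      ((√3 / A : ℝ) : ℂ) * ∑ v ∈ Finset.Icc 1 ⌊√(A * Q)⌋₊,
        ∑ n ∈ Finset.Ioc ⌊max (A * P / v) v⌋₊ ⌊A * Q / v⌋₊, gaussTerm A (v * n)‖ ≤
      √3 * ((432 * √Q * Λ + 96 * √P * Λ) * Λ +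
        ⌊√(A * Q)⌋₊ * (2 / (A * √P) + 96 * √P / A)) := by
  have hQ : 0 < Q := hP.trans_le hPQ
  have hΛ0 : 0 ≤ Λ := by
    have : 0 ≤ Real.log (5 * (A * Q) + 2) := by
      apply Real.log_nonneg
      nlinarith [mul_pos hA hQ]
    linarith
  rw [Finset.mul_sum, ← Finset.sum_sub_distrib]
  refine (norm_sum_le _ _).trans ((Finset.sum_le_sum fun v hv => ?_).trans
    (b := ∑ v ∈ Finset.Icc 1 ⌊√(A * Q)⌋₊, √3 * ((432 * √Q * Λ + 96 * √P * Λ) * (1 / (v : ℝ)) +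
      (2 / (A * √P) + 96 * √P / A))) ?_)
  · rw [Finset.mem_Icc] at hv
    refine norm_sum_chirpTerm_sub_gaussTerm_row_le hA hP hPQ hQP hv.1 ?_ hΛ
    have h1 : (v : ℝ) ≤ √(A * Q) :=
      (Nat.cast_le.2 hv.2).trans (Nat.floor_le (Real.sqrt_nonneg _))
    calc (v : ℝ) ^ 2 ≤ √(A * Q) ^ 2 := by gcongr
      _ = _ := Real.sq_sqrt (by positivity)
  · rw [← Finset.mul_sum, Finset.sum_add_distrib, ← Finset.mul_sum, Finset.sum_const,
      Nat.card_Icc, nsmul_eq_mul, Nat.add_sub_cancel]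
    have := (sum_Icc_inv_le_one_add_log ⌊√(A * Q)⌋₊).trans hlM
    gcongr

lemma norm_cubeRootTerm (A : ℝ) (hA : 0 ≤ A) (k : ℕ) :
    ‖cubeRootTerm A k‖ = (A * k) ^ (-(1 : ℝ) / 6) := by
  unfold cubeRootTerm
  rw [norm_mul, norm_unitExp, mul_one, Complex.norm_real, Real.norm_of_nonneg (by positivity)]

lemma norm_gaussTerm (A : ℝ) (k : ℕ) : ‖gaussTerm A k‖ = √(k / A) := by
  unfold gaussTerm
  rw [norm_mul, norm_unitExp, mul_one, Complex.norm_real, Real.norm_of_nonneg (by positivity)]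

lemma norm_cubeRootTerm_le {A P : ℝ} (hA : 0 < A) (hP : 0 < P) {k : ℕ} (hk : P ^ 3 / A ≤ k) :
    ‖cubeRootTerm A k‖ ≤ 1 / √P := by
  rw [norm_cubeRootTerm A hA.le, ← cube_rpow_neg_sixth hP]
  rw [div_le_iff₀ hA] at hk
  refine Real.rpow_le_rpow_of_nonpos (by positivity) (by linarith) (by norm_num)

lemma norm_gaussTerm_le {A Q : ℝ} (hA : 0 < A) {k : ℕ} (hk : (k : ℝ) ≤ A * Q) :
    ‖gaussTerm A k‖ ≤ √Q := by
  rw [norm_gaussTerm]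
  apply Real.sqrt_le_sqrt
  rw [div_le_iff₀ hA]
  linarith

lemma norm_sum_filter_Icc_le {M : ℕ} {p : ℕ → Prop} [DecidablePred p] {f : ℕ → ℂ} {B : ℝ}
    (hB : 0 ≤ B) (h : ∀ m, p m → ‖f m‖ ≤ B) : ‖∑ m ∈ (Finset.Icc 1 M).filter p, f m‖ ≤ M * B := by
  refine (norm_sum_le _ _).trans ((Finset.sum_le_card_nsmul _ _ B fun m hm =>
    h m (Finset.mem_filter.1 hm).2).trans ?_)
  rw [nsmul_eq_mul]
  have : ((Finset.Icc 1 M).filter p).card ≤ M :=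
    (Finset.card_filter_le _ _).trans (by rw [Nat.card_Icc, Nat.add_sub_cancel])
  gcongr

lemma transformation_error_le {α Y κ Λ q s M N V : ℝ} (hα : 0 < α) (hY : 1 ≤ Y) (hκ : 1 ≤ κ)
    (hΛ : 1 ≤ Λ) (hone : 1 ≤ κ * (α * Y)) (hq0 : 0 ≤ q) (hq : q ≤ 2 * Y) (_hs0 : 0 ≤ s)
    (hs : s ≤ 2) (hM0 : 0 ≤ M) (hM : M ≤ 3 * (Y ^ 3 / α)) (hN0 : 0 ≤ N) (hN : N ≤ 2 * (α * Y))
    (hV0 : 0 ≤ V) (hV : V ≤ 17 * (κ * (α * Y))) :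
    2 * (48 / Y * Λ * M + 2 * q / (α * α) * Λ + 24 * (28 * (1 / α * √V * √M) +
        2 * Y * (6 * Λ + 42 * V * Λ / (α * α)))) +
      2 * (s * ((432 * q * Λ + 96 * Y * Λ) * Λ + N * (2 / (α * α * Y) + 96 * Y / (α * α)))) +
      M * (1 / Y) + s / (α * α) * (N * q) ≤
    100000 * κ * (Y * Y / α * Λ + Y * Λ ^ 2) := by
  have hY0 : 0 < Y := by linarith
  have hκ0 : 0 < κ := by linarith
  have hΛ0 : 0 < Λ := by linarith
  set X := Y * Y / α with hX
  have hX0 : 0 < X := by positivity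
  have hMY : M / Y ≤ 3 * X := by
    rw [div_le_iff₀ hY0]
    refine hM.trans (le_of_eq ?_)
    rw [hX]
    field_simp
  have hYA : Y / (α * α) ≤ κ * X := by
    rw [div_le_iff₀ (by positivity), hX]
    have : κ * (Y * Y / α) * (α * α) = κ * (α * Y) * Y := by field_simp
    rw [this]
    nlinarith
  have hNY : N * (Y / (α * α)) ≤ 2 * X := by
    calc N * (Y / (α * α)) ≤ 2 * (α * Y) * (Y / (α * α)) := by gcongr
      _ = _ := by rw [hX]; field_simp
  have hVY : V * (Y / (α * α)) ≤ 17 * κ * X := by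
    calc V * (Y / (α * α)) ≤ 17 * (κ * (α * Y)) * (Y / (α * α)) := by gcongr
      _ = _ := by rw [hX]; field_simp
  have hVM : 1 / α * √V * √M ≤ 8 * κ * X := by
    rw [mul_assoc, ← Real.sqrt_mul hV0]
    have h1 : √(V * M) ≤ 8 * κ * (Y * Y) := by
      refine Real.sqrt_le_iff.2 ⟨by positivity, ?_⟩
      calc V * M ≤ 17 * (κ * (α * Y)) * (3 * (Y ^ 3 / α)) := by gcongr
        _ = 51 * κ * (Y * Y) ^ 2 := by field_simp; ring
        _ ≤ (8 * κ * (Y * Y)) ^ 2 := by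
          rw [mul_pow (8 * κ)]
          have : 51 * κ ≤ (8 * κ) ^ 2 := by nlinarith
          gcongr
    calc 1 / α * √(V * M) ≤ 1 / α * (8 * κ * (Y * Y)) := by gcongr
      _ = _ := by rw [hX]; field_simp
  have hXΛ : X ≤ κ * (X * Λ) := by
    have : X ≤ X * Λ := le_mul_of_one_le_right hX0.le hΛ
    have h2 : X * Λ ≤ κ * (X * Λ) := le_mul_of_one_le_left (by positivity) hκ
    linarith
  have hκX : κ * X ≤ κ * (X * Λ) := by
    have : X ≤ X * Λ := le_mul_of_one_le_right hX0.le hΛ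
    gcongr
  have hYΛ : Y * Λ ≤ κ * (Y * Λ ^ 2) := by
    have h1 : Y * Λ ≤ Y * Λ ^ 2 := by
      have : Λ ≤ Λ ^ 2 := by nlinarith
      gcongr
    have h2 : Y * Λ ^ 2 ≤ κ * (Y * Λ ^ 2) := le_mul_of_one_le_left (by positivity) hκ
    linarith
  have hYΛ2 : Y * Λ ^ 2 ≤ κ * (Y * Λ ^ 2) := le_mul_of_one_le_left (by positivity) hκ
  have t1 : 48 / Y * Λ * M ≤ 144 * (κ * (X * Λ)) := by
    calc 48 / Y * Λ * M = 48 * Λ * (M / Y) := by field_simp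
      _ ≤ 48 * Λ * (3 * X) := by gcongr
      _ = 144 * (1 * (X * Λ)) := by ring
      _ ≤ _ := by gcongr
  have t2 : 2 * q / (α * α) * Λ ≤ 4 * (κ * (X * Λ)) := by
    calc 2 * q / (α * α) * Λ ≤ 2 * (2 * Y) / (α * α) * Λ := by gcongr
      _ = 4 * Λ * (Y / (α * α)) := by ring
      _ ≤ 4 * Λ * (κ * X) := by gcongr
      _ = _ := by ring
  have t3 : 1 / α * √V * √M ≤ 8 * (κ * (X * Λ)) := by linarith
  have t4 : 2 * Y * (6 * Λ + 42 * V * Λ / (α * α)) ≤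
      12 * (κ * (Y * Λ ^ 2)) + 1428 * (κ * (X * Λ)) := by
    calc 2 * Y * (6 * Λ + 42 * V * Λ / (α * α)) =
          12 * (Y * Λ) + 84 * Λ * (V * (Y / (α * α))) := by ring
      _ ≤ 12 * (κ * (Y * Λ ^ 2)) + 84 * Λ * (17 * κ * X) := by gcongr
      _ = _ := by ring
  have t5 : s * ((432 * q * Λ + 96 * Y * Λ) * Λ + N * (2 / (α * α * Y) + 96 * Y / (α * α))) ≤
      1920 * (κ * (Y * Λ ^ 2)) + 392 * (κ * (X * Λ)) := by
    have h1 : 2 / (α * α * Y) ≤ 2 * (Y / (α * α)) := by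
      rw [mul_div_assoc', div_le_div_iff₀ (by positivity) (by positivity)]
      have : 0 < α * α := by positivity
      nlinarith [mul_nonneg this.le (by nlinarith : 0 ≤ Y * Y - 1)]
    calc _ ≤ 2 * ((432 * (2 * Y) * Λ + 96 * Y * Λ) * Λ +
          N * (2 * (Y / (α * α)) + 96 * Y / (α * α))) := by gcongr
      _ = 1920 * (Y * Λ ^ 2) + 196 * (N * (Y / (α * α))) := by ring
      _ ≤ _ := by linarith
  have t6 : M * (1 / Y) ≤ 3 * (κ * (X * Λ)) := by
    rw [mul_one_div]
    linarith
  have t7 : s / (α * α) * (N * q) ≤ 8 * (κ * (X * Λ)) := by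
    calc s / (α * α) * (N * q) ≤ 2 / (α * α) * (N * (2 * Y)) := by gcongr
      _ = 4 * (N * (Y / (α * α))) := by ring
      _ ≤ _ := by linarith
  have p1 : 0 < κ * (X * Λ) := by positivity
  have p2 : 0 < κ * (Y * Λ ^ 2) := by positivity
  have : 100000 * κ * (X * Λ + Y * Λ ^ 2) =
    100000 * (κ * (X * Λ)) + 100000 * (κ * (Y * Λ ^ 2)) := by ring
  rw [this]
  linarith

set_option maxHeartbeats 1000000 in
/-- The transformation formula for the divisor sums, over half-open ranges. -/
lemma norm_sum_d_cubeRootTerm_sub_gaussTerm_le {A P Q κ Λ W : ℝ} (hA : 0 < A) (hP : 1 ≤ P)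
    (hPQ : P ≤ Q) (hQP : Q ≤ 2 * P) (hκ : 1 ≤ κ) (hAP : 1 ≤ κ * (A * P))
    (hW1 : √(Q ^ 3 / A) ≤ W) (hW2 : 8 * √(A * Q) + 1 ≤ W) (hW3 : 5 * (A * Q) ≤ W)
    (hΛ : 1 + Real.log (W + 2) ≤ Λ) :
    ‖∑ k ∈ Finset.Ioc ⌊P ^ 3 / A⌋₊ ⌊Q ^ 3 / A⌋₊, (d k : ℂ) * cubeRootTerm A k -
      ((√3 / A : ℝ) : ℂ) * ∑ k ∈ Finset.Ioc ⌊A * P⌋₊ ⌊A * Q⌋₊, (d k : ℂ) * gaussTerm A k‖ ≤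
      100000 * κ * (P / √A * Λ + √P * Λ ^ 2) := by
  have hP0 : 0 < P := by linarith
  have hQ : 0 < Q := hP0.trans_le hPQ
  have hsAQ := Real.sqrt_nonneg (A * Q)
  have hAQ : 0 < A * Q := by positivity
  have hW0 : 1 ≤ W := by linarith
  have hlog : ∀ n : ℝ, 0 ≤ n → n ≤ W → 1 + Real.log (n + 2) ≤ Λ := by
    intro n hn hnW
    have := Real.log_le_log (by positivity) (by linarith : n + 2 ≤ W + 2)
    linarith
  have hlog' : ∀ n : ℕ, (n : ℝ) ≤ W → 1 + Real.log n ≤ Λ := by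
    intro n hn
    rcases Nat.eq_zero_or_pos n with h | h
    · have := hlog 0 le_rfl (by linarith)
      have h2 : 0 ≤ Real.log (0 + 2) := Real.log_nonneg (by norm_num)
      rw [h, Nat.cast_zero, Real.log_zero]
      linarith
    · have h0 : (0 : ℝ) < n := by exact_mod_cast h
      have := Real.log_le_log h0 (by linarith : (n : ℝ) ≤ n + 2)
      linarith [hlog n h0.le hn]
  have hΛ1 : 1 ≤ Λ := by
    have := Real.log_nonneg (by linarith : 1 ≤ W + 2)
    linarith
  set V := ⌈8 * √(A * Q)⌉₊ with hV
  have hVle : (V : ℝ) ≤ 8 * √(A * Q) + 1 := (Nat.ceil_lt_add_one (by positivity)).le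
  have hV1 : 1 ≤ V := by
    rw [hV, Nat.one_le_ceil_iff]
    positivity
  set M := ⌊√(Q ^ 3 / A)⌋₊ with hM
  set N := ⌊√(A * Q)⌋₊ with hN
  have hMle : (M : ℝ) ≤ √(Q ^ 3 / A) := Nat.floor_le (Real.sqrt_nonneg _)
  have hNle : (N : ℝ) ≤ √(A * Q) := Nat.floor_le (Real.sqrt_nonneg _)
  have hlV : Real.log (V + 2) ≤ Λ := by
    linarith [hlog V (Nat.cast_nonneg V) (by linarith)]
  have E1 := norm_sum_cubeRootTerm_sub_chirpTerm_le hA hP0 hPQ hQP hV1 (Nat.le_ceil _) hlV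
    (hlog' V (by linarith)) (hlog' M (by linarith))
  have E2 := norm_sum_chirpTerm_sub_gaussTerm_le hA hP0 hPQ hQP (hlog _ (by positivity) hW3)
    (hlog' N (by linarith))
  rw [sum_d_mul_eq (cubeRootTerm A) (a := P ^ 3 / A) (b := Q ^ 3 / A) (M := M) (by positivity)
      (fun m hm => Nat.le_floor (Real.le_sqrt_of_sq_le hm)),
    sum_d_mul_eq (gaussTerm A) (a := A * P) (b := A * Q) (M := N) (by positivity)
      (fun m hm => Nat.le_floor (Real.le_sqrt_of_sq_le hm))]
  have D1 : ‖∑ m ∈ (Finset.Icc 1 M).filter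
      (fun m : ℕ => P ^ 3 / A < (m : ℝ) ^ 2 ∧ (m : ℝ) ^ 2 ≤ Q ^ 3 / A), cubeRootTerm A (m * m)‖ ≤
      M * (1 / √P) := by
    apply norm_sum_filter_Icc_le (by positivity)
    intro m hm
    refine norm_cubeRootTerm_le hA hP0 ?_
    push_cast
    linarith [hm.1]
  have D2 : ‖∑ m ∈ (Finset.Icc 1 N).filter
      (fun m : ℕ => A * P < (m : ℝ) ^ 2 ∧ (m : ℝ) ^ 2 ≤ A * Q), gaussTerm A (m * m)‖ ≤
      N * √Q := by
    apply norm_sum_filter_Icc_le (by positivity)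
    intro m hm
    refine norm_gaussTerm_le hA ?_
    push_cast
    linarith [hm.2]
  set X1 := ∑ m ∈ Finset.Icc 1 M,
    ∑ n ∈ Finset.Ioc ⌊max (P ^ 3 / A / m) m⌋₊ ⌊Q ^ 3 / A / m⌋₊, cubeRootTerm A (m * n)
  set X2 := ∑ v ∈ Finset.Icc 1 N,
        ∑ n ∈ Finset.Ioc ⌊max (A * P / v) v⌋₊ ⌊A * Q / v⌋₊, gaussTerm A (v * n)
  set C := ∑ v ∈ Finset.Icc 1 N,
        ∑ m ∈ Finset.Ioc ⌊v / A * max P (v ^ 2 / A)⌋₊ ⌊v / A * Q⌋₊, chirpTerm A v m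
  set G1 := ∑ m ∈ (Finset.Icc 1 M).filter
      (fun m : ℕ => P ^ 3 / A < (m : ℝ) ^ 2 ∧ (m : ℝ) ^ 2 ≤ Q ^ 3 / A), cubeRootTerm A (m * m)
  set G2 := ∑ m ∈ (Finset.Icc 1 N).filter
      (fun m : ℕ => A * P < (m : ℝ) ^ 2 ∧ (m : ℝ) ^ 2 ≤ A * Q), gaussTerm A (m * m)
  have hsplit : 2 * X1 + G1 - ((√3 / A : ℝ) : ℂ) * (2 * X2 + G2) =
      2 * (X1 - C) + 2 * (C - ((√3 / A : ℝ) : ℂ) * X2) + G1 - ((√3 / A : ℝ) : ℂ) * G2 := by ring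
  have hn : ‖2 * X1 + G1 - ((√3 / A : ℝ) : ℂ) * (2 * X2 + G2)‖ ≤
      2 * ‖X1 - C‖ + 2 * ‖C - ((√3 / A : ℝ) : ℂ) * X2‖ + ‖G1‖ + √3 / A * ‖G2‖ := by
    rw [hsplit]
    refine (norm_sub_le _ _).trans (add_le_add ((norm_add_le _ _).trans (add_le_add
      ((norm_add_le _ _).trans (add_le_add ?_ ?_)) le_rfl)) ?_)
    · rw [norm_mul, Complex.norm_ofNat]
    · rw [norm_mul, Complex.norm_ofNat]
    · rw [norm_mul, Complex.norm_real, Real.norm_of_nonneg (by positivity)]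
  refine hn.trans ?_
  clear hn hsplit
  have hα : 0 < √A := Real.sqrt_pos.2 hA
  have hY : 0 < √P := Real.sqrt_pos.2 hP0
  have hY1 : 1 ≤ √P := Real.one_le_sqrt.2 hP
  have hαα : √A * √A = A := Real.mul_self_sqrt hA.le
  have hYY : √P * √P = P := Real.mul_self_sqrt hP0.le
  have hs3 : √3 ≤ 2 := Real.sqrt_le_iff.2 ⟨by norm_num, by norm_num⟩
  have hsQ : √Q ≤ 2 * √P := by
    refine Real.sqrt_le_iff.2 ⟨by positivity, ?_⟩
    nlinarith
  have hone : 1 ≤ κ * (√A * √P) := by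
    have h1 : 1 ≤ (κ * (√A * √P)) ^ 2 := by
      have : (κ * (√A * √P)) ^ 2 = κ * (κ * (A * P)) := by
        rw [mul_pow, mul_pow, Real.sq_sqrt hA.le, Real.sq_sqrt hP0.le]
        ring
      rw [this]
      nlinarith
    by_contra h
    push Not at h
    have : 0 ≤ κ * (√A * √P) := by positivity
    nlinarith
  have hQY : √(A * Q) ≤ 2 * (√A * √P) := by
    rw [Real.sqrt_mul hA.le]
    calc √A * √Q ≤ √A * (2 * √P) := by gcongr
      _ = _ := by ring
  have hM3 : √(Q ^ 3 / A) ≤ 3 * (√P ^ 3 / √A) := by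
    refine Real.sqrt_le_iff.2 ⟨by positivity, ?_⟩
    rw [mul_pow, div_pow, Real.sq_sqrt hA.le, ← pow_mul, show 3 * 2 = 2 * 3 from rfl, pow_mul √P,
      Real.sq_sqrt hP0.le, mul_div_assoc']
    have : Q ^ 3 ≤ (2 * P) ^ 3 := by gcongr
    have h0 : 0 < P ^ 3 := by positivity
    have : Q ^ 3 ≤ 3 ^ 2 * P ^ 3 := by nlinarith
    gcongr
  have fin := transformation_error_le (s := √3) hα hY1 hκ hΛ1 hone (Real.sqrt_nonneg Q) hsQ
    (by positivity) hs3 (Nat.cast_nonneg M) (hMle.trans hM3) (Nat.cast_nonneg N) (hNle.trans hQY)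
    (Nat.cast_nonneg V) (by
      have : √A * √P ≤ κ * (√A * √P) := le_mul_of_one_le_left (by positivity) hκ
      linarith : (V : ℝ) ≤ 17 * (κ * (√A * √P)))
  rw [hαα, hYY] at fin
  refine le_trans ?_ fin
  gcongr

lemma card_filter_mul_self_le_sqrt (k : ℕ) :
    (k.divisors.filter fun x => x * x ≤ k).card ≤ Nat.sqrt k := by
  calc _ ≤ (Finset.Icc 1 (Nat.sqrt k)).card := by
        apply Finset.card_le_card
        intro x hx
        rw [Finset.mem_filter] at hx
        exact Finset.mem_Icc.2 ⟨Nat.pos_of_mem_divisors hx.1, Nat.le_sqrt.2 hx.2⟩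
    _ = _ := by rw [Nat.card_Icc, Nat.add_sub_cancel]

lemma d_le_two_mul_sqrt (k : ℕ) : (d k : ℝ) ≤ 2 * √(k : ℝ) := by
  have h1 : d k ≤ 2 * Nat.sqrt k := by
    have h2 : (k.divisors.filter fun x => ¬ x * x ≤ k).card ≤
        (k.divisors.filter fun x => x * x ≤ k).card := by
      apply Finset.card_le_card_of_injOn (fun x => k / x)
      · intro x hx
        obtain ⟨hx1, hx2⟩ := Finset.mem_filter.1 hx
        refine Finset.mem_filter.2 ⟨Nat.mem_divisors.2
          ⟨Nat.div_dvd_of_dvd (Nat.dvd_of_mem_divisors hx1), (Nat.mem_divisors.1 hx1).2⟩, ?_⟩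
        obtain ⟨y, hy⟩ := Nat.dvd_of_mem_divisors hx1
        have hx0 := Nat.pos_of_mem_divisors hx1
        have hyx : y < x := by
          rw [hy] at hx2
          exact lt_of_mul_lt_mul_left (not_le.1 hx2) (Nat.zero_le x)
        change k / x * (k / x) ≤ k
        rw [hy, Nat.mul_div_cancel_left _ hx0]
        exact Nat.mul_le_mul_right y hyx.le
      · intro x hx y hy hxy
        have hx1 := (Finset.mem_filter.1 hx).1
        have hy1 := (Finset.mem_filter.1 hy).1
        have hk := (Nat.mem_divisors.1 hx1).2
        have := congrArg (fun z => k / z) hxy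
        simpa only [Nat.div_div_self (Nat.dvd_of_mem_divisors hx1) hk,
          Nat.div_div_self (Nat.dvd_of_mem_divisors hy1) hk] using this
    have h3 := Finset.card_filter_add_card_filter_not (s := k.divisors) (fun x => x * x ≤ k)
    have h4 := card_filter_mul_self_le_sqrt k
    unfold d
    omega
  have h2 : ((Nat.sqrt k : ℕ) : ℝ) ≤ √(k : ℝ) := by
    refine Real.le_sqrt_of_sq_le ?_
    exact_mod_cast Nat.sqrt_le' k
  calc (d k : ℝ) ≤ ((2 * Nat.sqrt k : ℕ) : ℝ) := by exact_mod_cast h1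
    _ ≤ _ := by
      push_cast
      gcongr

lemma sum_Icc_d_le (n : ℕ) : ∑ k ∈ Finset.Icc 1 n, (d k : ℝ) ≤ n * (1 + Real.log n) := by
  have e1 : ∑ k ∈ Finset.Icc 1 n, d k = ∑ m ∈ Finset.Icc 1 n, n / m := by
    have : ∀ k ∈ Finset.Icc 1 n, d k = ∑ m ∈ Finset.Icc 1 n, if m ∣ k then 1 else 0 := by
      intro k hk
      rw [Finset.mem_Icc] at hk
      rw [d, ← Finset.sum_filter, Finset.card_eq_sum_ones]
      apply Finset.sum_congr _ fun _ _ => rfl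
      ext m
      rw [Nat.mem_divisors, Finset.mem_filter, Finset.mem_Icc]
      constructor
      · rintro ⟨h1, h2⟩
        exact ⟨⟨Nat.pos_of_dvd_of_pos h1 hk.1, (Nat.le_of_dvd hk.1 h1).trans hk.2⟩, h1⟩
      · rintro ⟨-, h1⟩
        exact ⟨h1, by omega⟩
    rw [Finset.sum_congr rfl this, Finset.sum_comm]
    apply Finset.sum_congr rfl
    intro m _
    rw [← Finset.sum_filter, ← Finset.card_eq_sum_ones, ← Nat.Ioc_filter_dvd_card_eq_div]
    rfl
  have e2 : ∑ k ∈ Finset.Icc 1 n, (d k : ℝ) = ∑ m ∈ Finset.Icc 1 n, ((n / m : ℕ) : ℝ) := by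
    exact_mod_cast e1
  rw [e2]
  calc _ ≤ ∑ m ∈ Finset.Icc 1 n, (n : ℝ) * (1 / (m : ℝ)) := by
        apply Finset.sum_le_sum
        intro m _
        rw [mul_one_div]
        exact Nat.cast_div_le
    _ ≤ _ := by
        rw [← Finset.mul_sum]
        have := sum_Icc_inv_le_one_add_log n
        gcongr

lemma norm_sum_Icc_ceil_sub_sum_Ioc_floor_le {f : ℕ → ℂ} {a b B : ℝ} (ha : 0 ≤ a) (hab : a ≤ b) (hB : 0 ≤ B)
    (h : ∀ k : ℕ, (k : ℝ) = a → ‖f k‖ ≤ B) :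
    ‖∑ k ∈ Finset.Icc ⌈a⌉₊ ⌊b⌋₊, f k - ∑ k ∈ Finset.Ioc ⌊a⌋₊ ⌊b⌋₊, f k‖ ≤ B := by
  by_cases hk : ∃ k : ℕ, (k : ℝ) = a
  · obtain ⟨k, rfl⟩ := hk
    rw [Nat.ceil_natCast, Nat.floor_natCast, ← Finset.sum_Ioc_add_eq_sum_Icc (Nat.le_floor hab),
      add_sub_cancel_left]
    exact h k rfl
  · push Not at hk
    have h2 : Finset.Icc ⌈a⌉₊ ⌊b⌋₊ = Finset.Ioc ⌊a⌋₊ ⌊b⌋₊ := by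
      ext k
      rw [Finset.mem_Icc, Finset.mem_Ioc, Nat.ceil_le, Nat.floor_lt ha, (hk k).symm.le_iff_lt]
    rw [h2, sub_self, norm_zero]
    exact hB

lemma norm_sum_Icc_d_cubeRootTerm_sub_gaussTerm_le {A P Q κ Λ W : ℝ} (hA : 0 < A) (hP : 1 ≤ P)
    (hPQ : P ≤ Q) (hQP : Q ≤ 2 * P) (hκ : 1 ≤ κ) (hAP : 1 ≤ κ * (A * P))
    (hW1 : √(Q ^ 3 / A) ≤ W) (hW2 : 8 * √(A * Q) + 1 ≤ W) (hW3 : 5 * (A * Q) ≤ W)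
    (hΛ : 1 + Real.log (W + 2) ≤ Λ) :
    ‖∑ k ∈ Finset.Icc ⌈P ^ 3 / A⌉₊ ⌊Q ^ 3 / A⌋₊, (d k : ℂ) * cubeRootTerm A k -
      ((√3 / A : ℝ) : ℂ) * ∑ k ∈ Finset.Icc ⌈A * P⌉₊ ⌊A * Q⌋₊, (d k : ℂ) * gaussTerm A k‖ ≤
      100010 * κ * (P / √A * Λ + √P * Λ ^ 2) := by
  have hP0 : 0 < P := by linarith
  have hQ : 0 < Q := hP0.trans_le hPQ
  have hα : 0 < √A := Real.sqrt_pos.2 hA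
  have hY : 0 < √P := Real.sqrt_pos.2 hP0
  have hαα : √A * √A = A := Real.mul_self_sqrt hA.le
  have hYY : √P * √P = P := Real.mul_self_sqrt hP0.le
  have hs3 : √3 ≤ 2 := Real.sqrt_le_iff.2 ⟨by norm_num, by norm_num⟩
  have hsQ : √Q ≤ 2 * √P := by
    refine Real.sqrt_le_iff.2 ⟨by positivity, ?_⟩
    nlinarith
  have hΛ1 : 1 ≤ Λ := by
    have : 0 ≤ Real.log (W + 2) := by
      apply Real.log_nonneg
      linarith [Real.sqrt_nonneg (A * Q)]
    linarith
  have core := norm_sum_d_cubeRootTerm_sub_gaussTerm_le hA hP hPQ hQP hκ hAP hW1 hW2 hW3 hΛ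
  have b1 := norm_sum_Icc_ceil_sub_sum_Ioc_floor_le (f := fun k => (d k : ℂ) * cubeRootTerm A k)
    (a := P ^ 3 / A) (b := Q ^ 3 / A) (B := 2 * (P / √A)) (by positivity) (by gcongr) (by positivity) (by
      intro k hk
      rw [norm_mul, Complex.norm_natCast]
      have h1 : √(k : ℝ) = √P ^ 3 / √A := by
        rw [hk, Real.sqrt_div (by positivity)]
        congr 1
        rw [Real.sqrt_eq_iff_mul_self_eq (by positivity) (by positivity)]
        calc P ^ 3 = (√P * √P) ^ 3 := by rw [hYY]
          _ = √P ^ 3 * √P ^ 3 := by ring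
      calc (d k : ℝ) * ‖cubeRootTerm A k‖ ≤ 2 * √(k : ℝ) * (1 / √P) := by
            have := d_le_two_mul_sqrt k
            have := norm_cubeRootTerm_le hA hP0 hk.ge
            gcongr
        _ = 2 * ((√P * √P) / √A) := by
            rw [h1]
            field_simp
        _ = _ := by rw [hYY])
  have b2 := norm_sum_Icc_ceil_sub_sum_Ioc_floor_le (f := fun k => (d k : ℂ) * gaussTerm A k)
    (a := A * P) (b := A * Q) (B := 4 * (√A * P)) (by positivity) (by gcongr) (by positivity) (by
      intro k hk
      rw [norm_mul, Complex.norm_natCast]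
      calc (d k : ℝ) * ‖gaussTerm A k‖ ≤ 2 * √(k : ℝ) * (2 * √P) := by
            have := d_le_two_mul_sqrt k
            have := (norm_gaussTerm_le hA (hk.le.trans (by gcongr : A * P ≤ A * Q))).trans hsQ
            gcongr
        _ = 4 * (√A * (√P * √P)) := by
            rw [hk, Real.sqrt_mul hA.le]
            ring
        _ = _ := by rw [hYY])
  set S1 := ∑ k ∈ Finset.Icc ⌈P ^ 3 / A⌉₊ ⌊Q ^ 3 / A⌋₊, (d k : ℂ) * cubeRootTerm A k
  set S2 := ∑ k ∈ Finset.Icc ⌈A * P⌉₊ ⌊A * Q⌋₊, (d k : ℂ) * gaussTerm A k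
  set R1 := ∑ k ∈ Finset.Ioc ⌊P ^ 3 / A⌋₊ ⌊Q ^ 3 / A⌋₊, (d k : ℂ) * cubeRootTerm A k
  set R2 := ∑ k ∈ Finset.Ioc ⌊A * P⌋₊ ⌊A * Q⌋₊, (d k : ℂ) * gaussTerm A k
  have hsplit : S1 - ((√3 / A : ℝ) : ℂ) * S2 =
      (R1 - ((√3 / A : ℝ) : ℂ) * R2) + (S1 - R1) - ((√3 / A : ℝ) : ℂ) * (S2 - R2) := by ring
  have hn : ‖S1 - ((√3 / A : ℝ) : ℂ) * S2‖ ≤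
      ‖R1 - ((√3 / A : ℝ) : ℂ) * R2‖ + ‖S1 - R1‖ + √3 / A * ‖S2 - R2‖ := by
    rw [hsplit]
    refine (norm_sub_le _ _).trans (add_le_add (norm_add_le _ _) ?_)
    rw [norm_mul, Complex.norm_real, Real.norm_of_nonneg (by positivity)]
  have b3 : √3 / A * ‖S2 - R2‖ ≤ 8 * (P / √A) := by
    calc √3 / A * ‖S2 - R2‖ ≤ 2 / A * (4 * (√A * P)) := by gcongr
      _ = 2 / (√A * √A) * (4 * (√A * P)) := by rw [hαα]
      _ = _ := by field_simp; ring
  have b4 : P / √A ≤ κ * (P / √A * Λ + √P * Λ ^ 2) := by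
    have h1 : P / √A ≤ P / √A * Λ := le_mul_of_one_le_right (by positivity) hΛ1
    have h2 : 0 ≤ √P * Λ ^ 2 := by positivity
    have h3 : P / √A * Λ + √P * Λ ^ 2 ≤ κ * (P / √A * Λ + √P * Λ ^ 2) :=
      le_mul_of_one_le_left (by positivity) hκ
    linarith
  calc _ ≤ 100000 * κ * (P / √A * Λ + √P * Λ ^ 2) + 2 * (P / √A) + 8 * (P / √A) :=
        hn.trans (add_le_add (add_le_add core b1) b3)
    _ ≤ _ := by linarith

lemma norm_sum_Icc_d_gaussTerm_le {A P Q Λ W : ℝ} (hA : 0 < A) (hP : 0 < P) (hQ : 0 < Q)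
    (hW3 : 5 * (A * Q) ≤ W) (hΛ : 1 + Real.log (W + 2) ≤ Λ) :
    ‖((√3 / A : ℝ) : ℂ) * ∑ k ∈ Finset.Icc ⌈A * P⌉₊ ⌊A * Q⌋₊, (d k : ℂ) * gaussTerm A k‖ ≤
      2 * (√Q * Q * Λ) := by
  have hs3 : √3 ≤ 2 := Real.sqrt_le_iff.2 ⟨by norm_num, by norm_num⟩
  have hAQ : 0 < A * Q := by positivity
  have hAP : 0 < A * P := by positivity
  set n := ⌊A * Q⌋₊ with hn
  have hnle : (n : ℝ) ≤ A * Q := Nat.floor_le hAQ.le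
  have hΛn : 1 + Real.log n ≤ Λ := by
    rcases Nat.eq_zero_or_pos n with h | h
    · have h2 : 0 ≤ Real.log (W + 2) := Real.log_nonneg (by linarith)
      rw [h, Nat.cast_zero, Real.log_zero]
      linarith
    · have h0 : (0 : ℝ) < n := by exact_mod_cast h
      have := Real.log_le_log h0 (by linarith : (n : ℝ) ≤ W + 2)
      linarith
  have h1 : ‖∑ k ∈ Finset.Icc ⌈A * P⌉₊ n, (d k : ℂ) * gaussTerm A k‖ ≤ A * Q * Λ * √Q := by
    calc _ ≤ ∑ k ∈ Finset.Icc ⌈A * P⌉₊ n, (d k : ℝ) * √Q := by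
          refine (norm_sum_le _ _).trans (Finset.sum_le_sum fun k hk => ?_)
          rw [norm_mul, Complex.norm_natCast]
          have : (k : ℝ) ≤ A * Q := (Nat.cast_le.2 (Finset.mem_Icc.1 hk).2).trans hnle
          have := norm_gaussTerm_le hA this
          gcongr
      _ ≤ ∑ k ∈ Finset.Icc 1 n, (d k : ℝ) * √Q := by
          apply Finset.sum_le_sum_of_subset_of_nonneg
          · exact Finset.Icc_subset_Icc (Nat.one_le_ceil_iff.2 hAP) le_rfl
          · intro k _ _
            positivity
      _ ≤ n * (1 + Real.log n) * √Q := by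
          rw [← Finset.sum_mul]
          have := sum_Icc_d_le n
          gcongr
      _ ≤ n * Λ * √Q := by gcongr
      _ ≤ _ := by
          have : 0 ≤ Λ := by
            have := Real.log_nonneg (by linarith : 1 ≤ W + 2)
            linarith
          gcongr
  rw [norm_mul, Complex.norm_real, Real.norm_of_nonneg (by positivity)]
  calc _ ≤ 2 / A * (A * Q * Λ * √Q) := by gcongr
    _ = _ := by field_simp

lemma natCast_d_mul_exp_eq_cubeRootTerm {A : ℝ} (hA : 0 < A) (k : ℕ) :
    (d k : ℂ) * (((k : ℝ) ^ (-(1 : ℝ) / 6) : ℝ) : ℂ) *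
      Complex.exp (3 * π * I * (((A * k) ^ ((2 : ℝ) / 3) : ℝ) : ℂ)) =
    ((A ^ ((1 : ℝ) / 6) : ℝ) : ℂ) * ((d k : ℂ) * cubeRootTerm A k) := by
  have h1 : (k : ℝ) ^ (-(1 : ℝ) / 6) = A ^ ((1 : ℝ) / 6) * (A * k) ^ (-(1 : ℝ) / 6) := by
    rw [Real.mul_rpow hA.le (Nat.cast_nonneg k), ← mul_assoc, ← Real.rpow_add hA]
    norm_num
  rw [cubeRootTerm, unitExp, h1]
  have h2 : (3 * π * I * (((A * k) ^ ((2 : ℝ) / 3) : ℝ) : ℂ)) =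
      ((2 * Real.pi * (3 / 2 * (A * k) ^ ((2 : ℝ) / 3)) : ℝ) : ℂ) * I := by
    push_cast
    ring
  rw [h2, Complex.ofReal_mul]
  ring

lemma natCast_d_mul_exp_eq_gaussTerm {A : ℝ} (hA : 0 < A) (k : ℕ) :
    ((√3 * A ^ (-(4 : ℝ) / 3) : ℝ) : ℂ) * ((d k : ℂ) * (((k : ℝ) ^ ((1 : ℝ) / 2) : ℝ) : ℂ) *
      Complex.exp (-(π * I) * ((((k : ℝ) / A) ^ 2 : ℝ) : ℂ))) =
    ((A ^ ((1 : ℝ) / 6) : ℝ) : ℂ) * (((√3 / A : ℝ) : ℂ) * ((d k : ℂ) * gaussTerm A k)) := by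
  have h1 : √3 * A ^ (-(4 : ℝ) / 3) * (k : ℝ) ^ ((1 : ℝ) / 2) =
      A ^ ((1 : ℝ) / 6) * (√3 / A) * √(k / A) := by
    have h2 : A ^ (-(4 : ℝ) / 3) = A ^ ((1 : ℝ) / 6) * A ^ (-1 : ℝ) * A ^ (-(1 / 2) : ℝ) := by
      rw [← Real.rpow_add hA, ← Real.rpow_add hA]
      norm_num
    rw [Real.sqrt_div (Nat.cast_nonneg k), h2, Real.rpow_neg_one, Real.rpow_neg hA.le,
      ← Real.sqrt_eq_rpow, ← Real.sqrt_eq_rpow]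
    ring
  have h3 : (-(π * I) * ((((k : ℝ) / A) ^ 2 : ℝ) : ℂ)) =
      ((2 * Real.pi * (-((k / A) ^ 2 / 2)) : ℝ) : ℂ) * I := by
    push_cast
    ring
  rw [gaussTerm, unitExp, h3]
  calc _ = ((√3 * A ^ (-(4 : ℝ) / 3) * (k : ℝ) ^ ((1 : ℝ) / 2) : ℝ) : ℂ) * ((d k : ℂ) *
        Complex.exp (((2 * Real.pi * (-((k / A) ^ 2 / 2)) : ℝ) : ℂ) * I)) := by
        push_cast
        ring
    _ = _ := by
        rw [h1]
        push_cast
        ring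

lemma rpow_three_halves_eq_sqrt_pow {x : ℝ} (hx : 0 ≤ x) : x ^ ((3 : ℝ) / 2) = √x ^ 3 := by
  rw [Real.sqrt_eq_rpow, ← Real.rpow_natCast, ← Real.rpow_mul hx]
  norm_num

lemma norm_normalized_sums_le {A T c : ℝ} (hA : 0 < A) (hc : 1 ≤ c) (hT : 17 * c + 2 ≤ T)
    (hlo : 1 ≤ c * (A * √T)) (hhi : A ≤ c * √T ^ 3) :
    ‖∑ k ∈ Finset.Icc ⌈√(T / (2 * π)) ^ 3 / A⌉₊ ⌊√(T / π) ^ 3 / A⌋₊, (d k : ℂ) * cubeRootTerm A k -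
      ((√3 / A : ℝ) : ℂ) * ∑ k ∈ Finset.Icc ⌈A * √(T / (2 * π))⌉₊ ⌊A * √(T / π)⌋₊,
        (d k : ℂ) * gaussTerm A k‖ ≤
      4800480 * c * (√T / √A * Real.log T + √(√T) * Real.log T ^ 2) ∧
    ‖((√3 / A : ℝ) : ℂ) * ∑ k ∈ Finset.Icc ⌈A * √(T / (2 * π))⌉₊ ⌊A * √(T / π)⌋₊,
        (d k : ℂ) * gaussTerm A k‖ ≤ 8 * (√(√T) * √T * Real.log T) := by
  have hπ3 := Real.pi_gt_three
  have hπ4 := Real.pi_le_four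
  have hT0 : 0 < T := by linarith
  have hs0 : 0 < √T := Real.sqrt_pos.2 hT0
  have hss : √T * √T = T := Real.mul_self_sqrt hT0.le
  have hs1 : 1 ≤ √T := Real.one_le_sqrt.2 (by linarith)
  have hT19 : 19 ≤ T := by linarith
  set P := √(T / (2 * π)) with hPdef
  set Q := √(T / π) with hQdef
  have hP1 : 1 ≤ P := by
    refine Real.one_le_sqrt.2 ?_
    rw [le_div_iff₀ (by positivity)]
    linarith
  have hPQ : P ≤ Q := by
    refine Real.sqrt_le_sqrt ?_
    gcongr
    linarith
  have hQP : Q ≤ 2 * P := by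
    refine Real.sqrt_le_iff.2 ⟨by positivity, ?_⟩
    rw [mul_pow, hPdef, Real.sq_sqrt (by positivity)]
    have : T / π = 2 * (T / (2 * π)) := by field_simp
    have : 0 ≤ T / (2 * π) := by positivity
    linarith
  have hQs : Q ≤ √T := Real.sqrt_le_sqrt (div_le_self hT0.le (by linarith))
  have hPs : P ≤ √T := hPQ.trans hQs
  have hP0 : 0 < P := by linarith
  have hQ0 : 0 < Q := by linarith
  have hsP : √T ≤ 3 * P := by
    refine Real.sqrt_le_iff.2 ⟨by positivity, ?_⟩
    rw [mul_pow, hPdef, Real.sq_sqrt (by positivity), mul_div_assoc', le_div_iff₀ (by positivity)]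
    nlinarith
  have hAQ : A * Q ≤ c * T ^ 2 := by
    calc A * Q ≤ (c * √T ^ 3) * √T := by gcongr
      _ = c * (√T * √T) ^ 2 := by ring
      _ = _ := by rw [hss]
  have hQA : Q ^ 3 / A ≤ c * T ^ 2 := by
    rw [div_le_iff₀ hA]
    calc Q ^ 3 ≤ √T ^ 3 := by gcongr
      _ ≤ √T ^ 3 * (c * (A * √T)) := le_mul_of_one_le_right (by positivity) hlo
      _ = c * (√T * √T) ^ 2 * A := by ring
      _ = _ := by rw [hss]
  have hcT : 1 ≤ c * T ^ 2 := by
    have : 1 ≤ T ^ 2 := one_le_pow₀ (by linarith)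
    nlinarith
  have hL1 : 1 ≤ Real.log T := by
    rw [Real.le_log_iff_exp_le hT0]
    linarith [Real.exp_one_lt_d9]
  have hW1 : √(Q ^ 3 / A) ≤ 17 * c * T ^ 2 := by
    refine Real.sqrt_le_iff.2 ⟨by positivity, ?_⟩
    nlinarith
  have hW2 : 8 * √(A * Q) + 1 ≤ 17 * c * T ^ 2 := by
    have : √(A * Q) ≤ c * T ^ 2 := Real.sqrt_le_iff.2 ⟨by positivity, by nlinarith⟩
    linarith
  have hW3 : 5 * (A * Q) ≤ 17 * c * T ^ 2 := by linarith
  have hΛ : 1 + Real.log (17 * c * T ^ 2 + 2) ≤ 4 * Real.log T := by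
    have h1 : Real.log (17 * c * T ^ 2 + 2) ≤ Real.log (T ^ 3) := by
      apply Real.log_le_log (by positivity)
      nlinarith [sq_nonneg T]
    rw [Real.log_pow] at h1
    push_cast at h1
    linarith
  have hκ : 1 ≤ 3 * c * (A * P) := by
    calc 1 ≤ c * (A * √T) := hlo
      _ ≤ c * (A * (3 * P)) := by gcongr
      _ = _ := by ring
  constructor
  · refine (norm_sum_Icc_d_cubeRootTerm_sub_gaussTerm_le hA hP1 hPQ hQP (by linarith) hκ hW1 hW2
      hW3 hΛ).trans ?_
    calc _ ≤ 100010 * (3 * c) * (√T / √A * (4 * Real.log T) + √(√T) * (4 * Real.log T) ^ 2) := by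
          gcongr
      _ ≤ 100010 * (3 * c) * (16 * (√T / √A * Real.log T + √(√T) * Real.log T ^ 2)) := by
          gcongr
          have : 0 ≤ √T / √A * Real.log T := by positivity
          linarith
      _ = _ := by ring
  · refine (norm_sum_Icc_d_gaussTerm_le hA hP0 hQ0 hW3 hΛ).trans ?_
    calc _ ≤ 2 * (√(√T) * √T * (4 * Real.log T)) := by gcongr
      _ = _ := by ring

lemma sum_d_mul_exp_eq {A T : ℝ} (hA : 0 < A) (hT : 0 ≤ T) :
    ∑ k ∈ Finset.Icc ⌈(1 / A) * (T / (2 * π)) ^ ((3 : ℝ) / 2)⌉₊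
        ⌊(1 / A) * (T / π) ^ ((3 : ℝ) / 2)⌋₊,
      (d k : ℂ) * (((k : ℝ) ^ (-(1 : ℝ) / 6) : ℝ) : ℂ) *
        Complex.exp (3 * π * I * (((A * k) ^ ((2 : ℝ) / 3) : ℝ) : ℂ)) =
    ((A ^ ((1 : ℝ) / 6) : ℝ) : ℂ) * ∑ k ∈ Finset.Icc ⌈√(T / (2 * π)) ^ 3 / A⌉₊
      ⌊√(T / π) ^ 3 / A⌋₊, (d k : ℂ) * cubeRootTerm A k := by
  rw [rpow_three_halves_eq_sqrt_pow (by positivity), rpow_three_halves_eq_sqrt_pow (by positivity),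
    one_div_mul_eq_div, one_div_mul_eq_div, Finset.mul_sum]
  exact Finset.sum_congr rfl fun k _ => natCast_d_mul_exp_eq_cubeRootTerm hA k

lemma sum_d_mul_gauss_exp_eq {A : ℝ} (hA : 0 < A) (T : ℝ) :
    ((√3 * A ^ (-(4 : ℝ) / 3) : ℝ) : ℂ) *
      ∑ k ∈ Finset.Icc ⌈A * (T / (2 * π)) ^ ((1 : ℝ) / 2)⌉₊ ⌊A * (T / π) ^ ((1 : ℝ) / 2)⌋₊,
        (d k : ℂ) * (((k : ℝ) ^ ((1 : ℝ) / 2) : ℝ) : ℂ) *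
          Complex.exp (-(π * I) * ((((k : ℝ) / A) ^ 2 : ℝ) : ℂ)) =
    ((A ^ ((1 : ℝ) / 6) : ℝ) : ℂ) * (((√3 / A : ℝ) : ℂ) *
      ∑ k ∈ Finset.Icc ⌈A * √(T / (2 * π))⌉₊ ⌊A * √(T / π)⌋₊, (d k : ℂ) * gaussTerm A k) := by
  rw [← Real.sqrt_eq_rpow, ← Real.sqrt_eq_rpow, Finset.mul_sum, Finset.mul_sum, Finset.mul_sum]
  exact Finset.sum_congr rfl fun k _ => natCast_d_mul_exp_eq_gaussTerm hA k

lemma rpow_error_le {A T ε : ℝ} (hA : 0 < A) (hT : 1 ≤ T) (hε : 0 < ε) :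
    A ^ ((1 : ℝ) / 6) * (√T / √A * Real.log T + √(√T) * Real.log T ^ 2) ≤
      (1 / ε + 4 / ε ^ 2) * (A ^ (-(5 : ℝ) / 6) * T ^ ((3 : ℝ) / 4 + ε) +
        A ^ ((1 : ℝ) / 6) * T ^ ((1 : ℝ) / 4 + ε)) := by
  have hT0 : 0 < T := by linarith
  have hl0 : 0 ≤ Real.log T := Real.log_nonneg hT
  have h1 : Real.log T ≤ 1 / ε * T ^ ε := by
    rw [one_div_mul_eq_div]
    exact Real.log_le_rpow_div hT0.le hε
  have h2 : Real.log T ^ 2 ≤ 4 / ε ^ 2 * T ^ ε := by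
    calc Real.log T ^ 2 ≤ (T ^ (ε / 2) / (ε / 2)) ^ 2 := by
          gcongr
          exact Real.log_le_rpow_div hT0.le (by positivity)
      _ = 4 / ε ^ 2 * (T ^ (ε / 2) * T ^ (ε / 2)) := by
          field_simp
          norm_num
      _ = _ := by
          rw [← Real.rpow_add hT0, add_halves]
  have hq : √(√T) = T ^ ((1 : ℝ) / 4) := by
    rw [Real.sqrt_eq_rpow, Real.sqrt_eq_rpow, ← Real.rpow_mul hT0.le]
    norm_num
  have h34 : T ^ ((3 : ℝ) / 4) = √T * √(√T) := by
    rw [hq, Real.sqrt_eq_rpow, ← Real.rpow_add hT0]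
    norm_num
  have hA56 : A ^ (-(5 : ℝ) / 6) = A ^ ((1 : ℝ) / 6) / (√A * √A) := by
    rw [Real.mul_self_sqrt hA.le, ← Real.rpow_sub_one hA.ne']
    norm_num
  have hα : 0 < √A := Real.sqrt_pos.2 hA
  have hy : 0 < √(√T) := Real.sqrt_pos.2 (Real.sqrt_pos.2 hT0)
  have hyy : √(√T) * √(√T) = √T := Real.mul_self_sqrt (Real.sqrt_nonneg _)
  have hamgm : √T / √A ≤ √T * √(√T) / (√A * √A) + √(√T) := by
    have h5 : √T / √A = √(√T) * (√(√T) * √A) / (√A * √A) := by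
      rw [← mul_assoc, hyy]
      field_simp
    rw [h5, div_add' _ _ _ (by positivity)]
    gcongr
    have h6 : √(√T) * √A ≤ √T + √A * √A := by
      nlinarith [sq_nonneg (√(√T) - √A), mul_pos hα hy]
    calc √(√T) * (√(√T) * √A) ≤ √(√T) * (√T + √A * √A) := by gcongr
      _ = _ := by ring
  rw [Real.rpow_add hT0, Real.rpow_add hT0, h34, ← hq, hA56]
  calc _ ≤ A ^ ((1 : ℝ) / 6) * ((√T * √(√T) / (√A * √A) + √(√T)) * (1 / ε * T ^ ε) +
        (√T * √(√T) / (√A * √A) + √(√T)) * (4 / ε ^ 2 * T ^ ε)) := by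
        have : √(√T) ≤ √T * √(√T) / (√A * √A) + √(√T) := le_add_of_nonneg_left (by positivity)
        gcongr
    _ = _ := by ring

lemma rpow_sum_bound_le {A T c : ℝ} (hA : 0 < A) (hT : 1 ≤ T) (hc : 1 ≤ c)
    (hlo : 1 ≤ c * (A * √T)) :
    √T / √A * Real.log T + √(√T) * Real.log T ^ 2 ≤ 3 * c * (T ^ ((3 : ℝ) / 4) * Real.log T) := by
  have hT0 : 0 < T := by linarith
  have hl0 : 0 ≤ Real.log T := Real.log_nonneg hT
  have hα : 0 < √A := Real.sqrt_pos.2 hA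
  have hs : 0 < √T := Real.sqrt_pos.2 hT0
  have hy : 0 < √(√T) := Real.sqrt_pos.2 hs
  have h34 : T ^ ((3 : ℝ) / 4) = √T * √(√T) := by
    rw [Real.sqrt_eq_rpow, Real.sqrt_eq_rpow, ← Real.rpow_mul hT0.le, ← Real.rpow_add hT0]
    norm_num
  have hl : Real.log T ≤ 2 * √T := by
    have := Real.log_le_rpow_div hT0.le (by norm_num : (0 : ℝ) < 1 / 2)
    rw [← Real.sqrt_eq_rpow] at this
    linarith
  have h1 : √T / √A ≤ c * (√T * √(√T)) := by
    have h2 : 1 ≤ c * (√A * √(√T)) := by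
      rw [← Real.sqrt_mul hA.le]
      calc 1 ≤ √(c * (c * (A * √T))) := Real.one_le_sqrt.2 (hlo.trans
            (le_mul_of_one_le_left (by positivity) hc))
        _ = _ := by
            rw [← mul_assoc, Real.sqrt_mul (by positivity), Real.sqrt_mul_self (by linarith)]
    rw [div_le_iff₀ hα]
    calc √T ≤ √T * (c * (√A * √(√T))) := le_mul_of_one_le_right hs.le h2
      _ = _ := by ring
  rw [h34]
  calc _ ≤ c * (√T * √(√T)) * Real.log T + √(√T) * (2 * √T * Real.log T) := by
        rw [pow_two]
        gcongr
    _ = c * (√T * √(√T) * Real.log T) + 2 * 1 * (√T * √(√T) * Real.log T) := by ring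
    _ ≤ c * (√T * √(√T) * Real.log T) + 2 * c * (√T * √(√T) * Real.log T) := by gcongr
    _ = _ := by ring

lemma exists_const_of_isBigO {A : ℝ → ℝ} (hApos : ∀ T, 0 < A T)
    (hA_lower : (fun T : ℝ => T ^ (-(1 : ℝ) / 2)) =O[atTop] A)
    (hA_upper : A =O[atTop] fun T : ℝ => T ^ ((3 : ℝ) / 2)) :
    ∃ c : ℝ, 1 ≤ c ∧ ∀ᶠ T in atTop, 17 * c + 2 ≤ T ∧ 1 ≤ c * (A T * √T) ∧
      A T ≤ c * √T ^ 3 := by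
  obtain ⟨c₁, h₁⟩ := hA_lower.bound
  obtain ⟨c₂, h₂⟩ := hA_upper.bound
  refine ⟨max 1 (max c₁ c₂), le_max_left _ _, ?_⟩
  filter_upwards [h₁, h₂, eventually_ge_atTop (17 * max 1 (max c₁ c₂) + 2)] with T h1 h2 h3
  have hc : 1 ≤ max 1 (max c₁ c₂) := le_max_left _ _
  have hT0 : 0 < T := by linarith
  have hs : 0 < √T := Real.sqrt_pos.2 hT0
  have hA := hApos T
  rw [Real.norm_of_nonneg (by positivity), Real.norm_of_nonneg hA.le, neg_div,
    Real.rpow_neg hT0.le, ← Real.sqrt_eq_rpow, inv_le_iff_one_le_mul₀ hs] at h1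
  rw [Real.norm_of_nonneg hA.le, Real.norm_of_nonneg (by positivity),
    rpow_three_halves_eq_sqrt_pow hT0.le] at h2
  refine ⟨h3, ?_, ?_⟩
  · calc 1 ≤ c₁ * A T * √T := h1
      _ = c₁ * (A T * √T) := by ring
      _ ≤ _ := by
        gcongr
        exact (le_max_left _ _).trans (le_max_right _ _)
  · refine h2.trans ?_
    gcongr
    exact (le_max_right _ _).trans (le_max_right _ _)

theorem stmt11 (ε : ℝ) (hε : 0 < ε) (A : ℝ → ℝ) (hApos : ∀ T, 0 < A T)
    (hA_lower : (fun T : ℝ => T ^ (-(1:ℝ)/2)) =O[atTop] A)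
    (hA_upper : A =O[atTop] fun T : ℝ => T ^ ((3:ℝ)/2)) :
    ((fun T : ℝ =>
        (∑ k ∈ Finset.Icc ⌈(1 / A T) * (T / (2 * π)) ^ ((3:ℝ)/2)⌉₊
            ⌊(1 / A T) * (T / π) ^ ((3:ℝ)/2)⌋₊,
          (d k : ℂ) * (((k : ℝ) ^ (-(1:ℝ)/6) : ℝ) : ℂ) *
            Complex.exp (3 * π * I * (((A T * k) ^ ((2:ℝ)/3) : ℝ) : ℂ))) -
          ((Real.sqrt 3 * (A T) ^ (-(4:ℝ)/3) : ℝ) : ℂ) *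
            ∑ k ∈ Finset.Icc ⌈A T * (T / (2 * π)) ^ ((1:ℝ)/2)⌉₊ ⌊A T * (T / π) ^ ((1:ℝ)/2)⌋₊,
              (d k : ℂ) * (((k : ℝ) ^ ((1:ℝ)/2) : ℝ) : ℂ) *
                Complex.exp (-(π * I) * ((((k : ℝ) / A T) ^ 2 : ℝ) : ℂ)))
      =O[atTop] fun T : ℝ =>
        (A T) ^ (-(5:ℝ)/6) * T ^ ((3:ℝ)/4 + ε) + (A T) ^ ((1:ℝ)/6) * T ^ ((1:ℝ)/4 + ε) +
          (A T) ^ (-(1:ℝ)/3) * T ^ ((1:ℝ)/3 + ε)) ∧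
    ((fun T : ℝ =>
        ∑ k ∈ Finset.Icc ⌈(1 / A T) * (T / (2 * π)) ^ ((3:ℝ)/2)⌉₊
            ⌊(1 / A T) * (T / π) ^ ((3:ℝ)/2)⌋₊,
          (d k : ℂ) * (((k : ℝ) ^ (-(1:ℝ)/6) : ℝ) : ℂ) *
            Complex.exp (3 * π * I * (((A T * k) ^ ((2:ℝ)/3) : ℝ) : ℂ)))
      =O[atTop] fun T : ℝ => (A T) ^ ((1:ℝ)/6) * T ^ ((3:ℝ)/4) * Real.log T) := by
  obtain ⟨c, hc, hev⟩ := exists_const_of_isBigO hApos hA_lower hA_upper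
  constructor
  · refine Asymptotics.IsBigO.of_bound (4800480 * c * (1 / ε + 4 / ε ^ 2)) ?_
    filter_upwards [hev] with T ⟨hT, hlo, hhi⟩
    have hA := hApos T
    have hT1 : 1 ≤ T := by linarith
    have hT0 : 0 < T := by linarith
    rw [sum_d_mul_exp_eq hA hT0.le, sum_d_mul_gauss_exp_eq hA, ← mul_sub, norm_mul,
      Complex.norm_real, Real.norm_of_nonneg (by positivity), Real.norm_of_nonneg (by positivity)]
    calc _ ≤ (A T) ^ ((1 : ℝ) / 6) * (4800480 * c *
          (√T / √(A T) * Real.log T + √(√T) * Real.log T ^ 2)) := by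
          gcongr
          exact (norm_normalized_sums_le hA hc hT hlo hhi).1
      _ = 4800480 * c * ((A T) ^ ((1 : ℝ) / 6) *
          (√T / √(A T) * Real.log T + √(√T) * Real.log T ^ 2)) := by ring
      _ ≤ 4800480 * c * ((1 / ε + 4 / ε ^ 2) * ((A T) ^ (-(5 : ℝ) / 6) * T ^ ((3 : ℝ) / 4 + ε) +
          (A T) ^ ((1 : ℝ) / 6) * T ^ ((1 : ℝ) / 4 + ε))) := by
          exact mul_le_mul_of_nonneg_left (rpow_error_le hA hT1 hε) (by positivity)
      _ ≤ _ := by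
          rw [← mul_assoc]
          exact mul_le_mul_of_nonneg_left (le_add_of_nonneg_right (by positivity)) (by positivity)
  · refine Asymptotics.IsBigO.of_bound (4800480 * c * (3 * c) + 8) ?_
    filter_upwards [hev] with T ⟨hT, hlo, hhi⟩
    have hA := hApos T
    have hT1 : 1 ≤ T := by linarith
    have hT0 : 0 < T := by linarith
    have hl0 : 0 ≤ Real.log T := Real.log_nonneg hT1
    have h34 : √(√T) * √T = T ^ ((3 : ℝ) / 4) := by
      rw [Real.sqrt_eq_rpow, Real.sqrt_eq_rpow, ← Real.rpow_mul hT0.le, ← Real.rpow_add hT0]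
      norm_num
    obtain ⟨h1, h2⟩ := norm_normalized_sums_le hA hc hT hlo hhi
    rw [h34] at h2
    rw [sum_d_mul_exp_eq hA hT0.le, norm_mul,
      Complex.norm_real, Real.norm_of_nonneg (by positivity), Real.norm_of_nonneg (by positivity)]
    calc _ ≤ (A T) ^ ((1 : ℝ) / 6) * (4800480 * c *
          (√T / √(A T) * Real.log T + √(√T) * Real.log T ^ 2) +
            8 * (T ^ ((3 : ℝ) / 4) * Real.log T)) := by
          gcongr
          refine (norm_le_norm_add_norm_sub' _ _).trans ((add_comm _ _).le.trans (add_le_add h1 h2))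
      _ ≤ (A T) ^ ((1 : ℝ) / 6) * (4800480 * c * (3 * c * (T ^ ((3 : ℝ) / 4) * Real.log T)) +
            8 * (T ^ ((3 : ℝ) / 4) * Real.log T)) := by
          gcongr
          exact rpow_sum_bound_le hA hT1 hc hlo
      _ = _ := by ring
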